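/- Let d ≥ 2, 1 < p < ∞, and j, k ∈ {1,…,d} with j ≠ k. Then the operator norm of 𝓡^{(jj)} − 𝓡^{(kk)} on ℓ^p(ℤ^d) equals p* − 1; moreover p* − 1 ≤ ‖R_dis^{(jj)} − R_dis^{(kk)}‖_{ℓ^p→ℓ^p}. -/

import Mathlib

open MeasureTheory Real Filter

noncomputable section

/-- The lattice ℤ^d. -/
abbrev ZLat (d : ℕ) := Fin d → ℤ

/-- Embedding of the lattice ℤ^d into Euclidean space ℝ^d. -/
def latVec {d : ℕ} (m : ZLat d) : EuclideanSpace ℝ (Fin d) := WithLp.toLp 2 fun i => (m i : ℝ)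

/-- The (Gaussian) heat kernel on ℝ^d. -/
def heatK (d : ℕ) (t : ℝ) (x : EuclideanSpace ℝ (Fin d)) : ℝ :=
  (2 * π * t) ^ (-(d : ℝ) / 2) * Real.exp (-‖x‖ ^ 2 / (2 * t))

/-- The periodic heat kernel H_t(x) = Σ_{n ∈ ℤ^d} P_t(x − n). -/
def pHeatK (d : ℕ) (t : ℝ) (x : EuclideanSpace ℝ (Fin d)) : ℝ :=
  ∑' n : ZLat d, heatK d t (x - latVec n)

/-- Partial derivative in the j-th coordinate direction. -/
def pderiv {d : ℕ} (j : Fin d) (f : EuclideanSpace ℝ (Fin d) → ℝ)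
    (x : EuclideanSpace ℝ (Fin d)) : ℝ :=
  fderiv ℝ f x (EuclideanSpace.single j 1)

/-- The constant c_d = π^{-d/2} Γ((d+2)/2). -/
def cConst (d : ℕ) : ℝ := π ^ (-(d : ℝ) / 2) * Real.Gamma (((d : ℝ) + 2) / 2)

/-- The discrete second-order Riesz kernel K_dis^{(jk)}. -/
def discK (d : ℕ) (j k : Fin d) (m : ZLat d) : ℝ :=
  if m = 0 then 0 else cConst d * (m j : ℝ) * (m k : ℝ) / ‖latVec m‖ ^ (d + 2)

/-- The discrete second-order Riesz transform R_dis^{(jk)}. -/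
def Rdis (d : ℕ) (j k : Fin d) (f : ZLat d → ℝ) (n : ZLat d) : ℝ :=
  ∑' m : ZLat d, discK d j k m * f (n - m)

/-- The probabilistic kernel 𝒦^{(jk)}(m). -/
def probK (d : ℕ) (j k : Fin d) (m : ZLat d) : ℝ :=
  -∫ s in Set.Ioi (0 : ℝ), ∫ x : EuclideanSpace ℝ (Fin d),
      pHeatK d s x *
        (pderiv j (fun y => heatK d s y / pHeatK d s y) x *
         pderiv k (fun y => heatK d s (y - latVec m) / pHeatK d s y) x)

/-- The probabilistic discrete second-order Riesz transform 𝓡^{(jk)}. -/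
def Rprob (d : ℕ) (j k : Fin d) (f : ZLat d → ℝ) (n : ZLat d) : ℝ :=
  ∑' m : ZLat d, probK d j k (n - m) * f m

/-- The ℓ^p norm of f : ℤ^d → ℝ. -/
def lpN (d : ℕ) (p : ℝ) (f : ZLat d → ℝ) : ℝ := (∑' n : ZLat d, |f n| ^ p) ^ (1 / p)

/-- Membership in ℓ^p(ℤ^d). -/
def MemLpLat (d : ℕ) (p : ℝ) (f : ZLat d → ℝ) : Prop := Summable fun n : ZLat d => |f n| ^ p

/-- Operator norm of an operator on ℓ^p(ℤ^d): sup of ‖Tf‖ over ‖f‖ = 1. -/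
def opN (d : ℕ) (p : ℝ) (T : (ZLat d → ℝ) → (ZLat d → ℝ)) : ℝ :=
  sSup {c : ℝ | ∃ f : ZLat d → ℝ, MemLpLat d p f ∧ lpN d p f = 1 ∧ c = lpN d p (T f)}

/-- p* = max{p, p/(p-1)}. -/
def pstar (p : ℝ) : ℝ := max p (p / (p - 1))


section
open MeasureTheory Real Filter
noncomputable section

namespace Bell

lemma G_nonneg {p : ℝ} (hp : 2 ≤ p) {τ : ℝ} (h1 : -(p-1) ≤ τ) (h2 : τ ≤ 1) :
    0 ≤ p^2*τ/(p-1) + (1-τ)^p - (1+τ/(p-1))^p := by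
  have hp1 : 0 < p - 1 := by linarith
  set G : ℝ → ℝ := fun τ => p^2*τ/(p-1) + (1-τ)^p - (1+τ/(p-1))^p with hG
  set G' : ℝ → ℝ := fun τ => p^2/(p-1) - p*(1-τ)^(p-1) - p/(p-1)*(1+τ/(p-1))^(p-1) with hG'
  have hd : ∀ τ, HasDerivAt G (G' τ) τ := by
    intro τ
    have e1 : HasDerivAt (fun τ : ℝ => (1-τ)^p) (-1 * p * (1-τ)^(p-1)) τ :=
      ((hasDerivAt_id τ).const_sub 1).rpow_const (Or.inr (by linarith))
    have e2 : HasDerivAt (fun τ : ℝ => (1+τ/(p-1))^p) ((1/(p-1)) * p * (1+τ/(p-1))^(p-1)) τ :=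
      (((hasDerivAt_id τ).div_const (p-1)).const_add 1).rpow_const (Or.inr (by linarith))
    have e3 : HasDerivAt (fun τ : ℝ => p^2*τ/(p-1)) (p^2*1/(p-1)) τ :=
      ((hasDerivAt_id τ).const_mul (p^2)).div_const (p-1)
    refine ((e3.add e1).sub e2).congr_deriv ?_
    simp only [hG']; ring
  have hcont : Continuous G := continuous_iff_continuousAt.2 fun x => (hd x).continuousAt
  have hG0 : G 0 = 0 := by simp [hG]
  change 0 ≤ G τ
  rcases le_total τ 0 with h0 | h0
  · rw [← hG0]
    have : AntitoneOn G (Set.Icc (-(p-1)) 0) := by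
      apply antitoneOn_of_deriv_nonpos (convex_Icc _ _) hcont.continuousOn
        (fun x _ => (hd x).differentiableAt.differentiableWithinAt)
      intro x hx
      rw [interior_Icc] at hx
      rw [(hd x).deriv]
      have b1 := one_add_mul_self_le_rpow_one_add (s := -x) (by linarith [hx.2]) (p := p-1) (by linarith)
      have b2 := one_add_mul_self_le_rpow_one_add (s := x/(p-1))
        (by rw [le_div_iff₀ hp1]; linarith [hx.1]) (p := p-1) (by linarith)
      have b3 : (p-1) * (x/(p-1)) = x := by field_simp
      rw [b3] at b2
      rw [← sub_eq_add_neg] at b1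
      simp only [hG']
      have c1 : p * (1 + (p-1) * -x) ≤ p * (1-x)^(p-1) := by gcongr
      have c2 : p/(p-1) * (1+x) ≤ p/(p-1) * (1+x/(p-1))^(p-1) := by gcongr
      have c3 : p^2/(p-1) - p * (1 + (p-1) * -x) - p/(p-1) * (1+x) = x * (p * (p*(p-2)) / (p-1)) := by
        field_simp; ring
      have c4 : 0 ≤ p * (p*(p-2)) / (p-1) := by
        have : 0 ≤ p - 2 := by linarith
        positivity
      nlinarith [hx.2, mul_nonneg (neg_nonneg.2 hx.2.le) c4]
    exact this ⟨h1, h0⟩ ⟨by linarith, le_rfl⟩ h0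
  · by_contra hneg
    push Not at hneg
    have hG1 : 0 ≤ G 1 := by
      have b1 := one_add_mul_self_le_rpow_one_add (s := -(1/p)) (by
        rw [neg_le_neg_iff, div_le_one (by linarith)]; linarith) (p := p-1) (by linarith)
      have e1 : 1 + (p-1) * -(1/p) = 1/p := by field_simp; ring
      have e2 : 1 + -(1/p) = (p-1)/p := by field_simp; ring
      rw [e1, e2] at b1
      simp only [hG]
      have e3 : 1 + 1/(p-1) = p/(p-1) := by field_simp; ring
      rw [e3, sub_self, Real.zero_rpow (by linarith)]
      have e4 : (p/(p-1))^p = (p/(p-1))^(p-1) * (p/(p-1)) := by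
        rw [← Real.rpow_add_one (by positivity)]; congr 1; ring
      have e5 : (p/(p-1))^(p-1) ≤ p := by
        have : (p/(p-1)) = ((p-1)/p)⁻¹ := by rw [inv_div]
        rw [this, Real.inv_rpow (by positivity)]
        apply inv_le_of_inv_le₀ (by linarith)
        rw [← one_div]; exact b1
      rw [e4]
      have : (p/(p-1))^(p-1) * (p/(p-1)) ≤ p * (p/(p-1)) := by gcongr
      have : p * (p/(p-1)) = p^2*1/(p-1) := by ring
      linarith
    have h0' : 0 < τ := lt_of_le_of_ne h0 (by rintro rfl; linarith)
    have h1' : τ < 1 := lt_of_le_of_ne h2 (by rintro rfl; linarith)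
    obtain ⟨ξ, hξ, eξ⟩ := exists_hasDerivAt_eq_slope G G' h0' hcont.continuousOn (fun x _ => hd x)
    obtain ⟨η, hη, eη⟩ := exists_hasDerivAt_eq_slope G G' h1' hcont.continuousOn (fun x _ => hd x)
    have n1 : G' ξ < 0 := by
      rw [eξ, hG0]; apply div_neg_of_neg_of_pos <;> linarith
    have n2 : 0 < G' η := by
      rw [eη]; apply div_pos <;> linarith
    have hη0 : 0 < η := by linarith [hη.1]
    set l := ξ/η
    have hl0 : 0 ≤ l := div_nonneg hξ.1.le hη0.le
    have hl1 : l ≤ 1 := (div_le_one hη0).2 (by linarith [hξ.2, hη.1])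
    have hlη : ξ = l * η := by simp only [l]; field_simp
    have cv := convexOn_rpow (p := p-1) (by linarith)
    have k1 := cv.2 (show (1:ℝ) ∈ Set.Ici 0 by simp) (show 1-η ∈ Set.Ici 0 by simp; linarith [hη.2])
      (show 0 ≤ 1 - l by linarith) hl0 (by ring)
    have k2 := cv.2 (show (1:ℝ) ∈ Set.Ici 0 by simp) (show 1+η/(p-1) ∈ Set.Ici 0 by simp only [Set.mem_Ici]; positivity)
      (show 0 ≤ 1 - l by linarith) hl0 (by ring)
    simp only [smul_eq_mul, mul_one, Real.one_rpow] at k1 k2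
    have i1 : 1 - l + l * (1-η) = 1 - ξ := by rw [hlη]; ring
    have i2 : 1 - l + l * (1+η/(p-1)) = 1 + ξ/(p-1) := by rw [hlη]; ring
    rw [i1] at k1; rw [i2] at k2
    have k3 : l * G' η ≤ G' ξ := by
      simp only [hG']
      have q1 : p * (1-ξ)^(p-1) ≤ p * (1 - l + l * (1-η)^(p-1)) := by gcongr
      have q2 : p/(p-1) * (1+ξ/(p-1))^(p-1) ≤ p/(p-1) * (1 - l + l * (1+η/(p-1))^(p-1)) := by gcongr
      have q3 : p^2/(p-1) = p + p/(p-1) := by field_simp; ring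
      rw [q3]; nlinarith
    nlinarith [mul_nonneg hl0 n2.le]

def U (p x w : ℝ) : ℝ := p^(1-p) * ((|w| - (p-1)*|x|) * (|x|+|w|)^(p-1))

lemma U_major {p : ℝ} (hp : 2 ≤ p) (x w : ℝ) :
    (p-1)^(1-p) * |w|^p / p - (p-1) * |x|^p/p ≤ U p x w := by
  have hp1 : 0 < p - 1 := by linarith
  have hp0 : 0 < p := by linarith
  unfold U
  generalize ha : |x| = a
  generalize hb : |w| = b
  have ha0 : 0 ≤ a := ha ▸ abs_nonneg _
  have hb0 : 0 ≤ b := hb ▸ abs_nonneg _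
  rcases eq_or_lt_of_le (add_nonneg ha0 hb0) with h | h
  · have : a = 0 := by linarith
    have : b = 0 := by linarith
    rw [‹a = 0›, ‹b = 0›, Real.zero_rpow (show p ≠ 0 by linarith)]
    simp
  · set c := (a+b)/p with hc
    have hc0 : 0 < c := by positivity
    set τ := 1 - a/c with hτ
    have ea : a = c * (1-τ) := by rw [hτ]; field_simp; ring
    have eb : b = c * (p-1) * (1+τ/(p-1)) := by
      rw [hτ]; field_simp; rw [hc]; field_simp; ring
    have h1τ : 0 ≤ 1 - τ := by rw [hτ]; simp; positivity
    have h2τ : 0 ≤ 1+τ/(p-1) := by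
      by_contra hh
      push Not at hh
      have : b < 0 := by rw [eb]; apply mul_neg_of_pos_of_neg (by positivity) hh
      linarith
    have hg := G_nonneg hp (τ := τ) (by
      have : 0 ≤ (p-1) * (1+τ/(p-1)) := by positivity
      have e : (p-1) * (1+τ/(p-1)) = p - 1 + τ := by field_simp
      linarith) (by linarith)
    have e1 : b - (p-1)*a = c * p * τ := by rw [ea, eb]; field_simp; ring
    have e2 : a + b = c * p := by rw [hc]; field_simp
    rw [e1, e2]
    have e3 : a^p = c^p * (1-τ)^p := by rw [ea, Real.mul_rpow hc0.le h1τ]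
    have e4 : b^p = c^p * (p-1)^p * (1+τ/(p-1))^p := by
      rw [eb, Real.mul_rpow (by positivity) h2τ, Real.mul_rpow hc0.le hp1.le]
    have e5 : (p-1)^(1-p) * (p-1)^p = p - 1 := by
      rw [← Real.rpow_add hp1]; norm_num
    have e6 : p^(1-p) * p^(p-1) = 1 := by
      rw [← Real.rpow_add hp0]; norm_num
    have e7 : c * c^(p-1) = c^p := by
      rw [mul_comm, ← Real.rpow_add_one hc0.ne']; norm_num
    rw [Real.mul_rpow hc0.le hp0.le, e3, e4]
    have e8 : p^(1-p) * (c*p*τ*(c^(p-1)*p^(p-1))) = (p^(1-p) * p^(p-1)) * (c * c^(p-1)) * (p*τ) := by ring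
    have e9 : (p-1)^(1-p) * (c^p * (p-1)^p * (1+τ/(p-1))^p) / p = ((p-1)^(1-p) * (p-1)^p) * c^p * (1+τ/(p-1))^p / p := by ring
    rw [e8, e9, e5, e6, e7, ← sub_nonneg]
    have : 1 * c ^ p * (p * τ) - ((p - 1) * c ^ p * (1 + τ / (p - 1)) ^ p / p - (p - 1) * (c ^ p * (1 - τ) ^ p) / p)
      = c^p * ((p-1)/p) * (p^2*τ/(p-1) + (1-τ)^p - (1+τ/(p-1))^p) := by
      field_simp; ring
    rw [this]
    positivity

lemma zz_aux1 {p w : ℝ} (hp : 2 ≤ p) (hw : 0 ≤ w) :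
    ConcaveOn ℝ (Set.Ici 0) (fun z : ℝ => (w-(p-2)*z)*(2*z+w)^(p-1) - p*w^(p-1)*z) ∧
    AntitoneOn (fun z : ℝ => (w-(p-2)*z)*(2*z+w)^(p-1) - p*w^(p-1)*z) (Set.Ici 0) := by
  set D : ℝ → ℝ := fun z => (2*z+w)^(p-2) * (p*w-2*p*(p-2)*z) with hD
  have hDc : Continuous D := by
    apply Continuous.mul _ (by fun_prop)
    exact Continuous.rpow_const (by fun_prop) (fun x => Or.inr (by linarith))
  have hDa : AntitoneOn D (Set.Ici 0) := by
    have hdd : ∀ z ∈ Set.Ioi (0:ℝ), HasDerivAt D (2 * (p-2) * (2*z+w)^(p-2-1) * (p*w-2*p*(p-2)*z) +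
        (2*z+w)^(p-2) * (-(2*p*(p-2)))) z := by
      intro z hz
      have hz : 0 < z := hz
      have e1 : HasDerivAt (fun z : ℝ => (2*z+w)^(p-2)) (2 * (p-2) * (2*z+w)^(p-2-1)) z := by
        have := (((hasDerivAt_id z).const_mul 2).add_const w).rpow_const (p := p-2) (Or.inl (by simp; positivity))
        simpa using this
      have e2 : HasDerivAt (fun z : ℝ => (p*w-2*p*(p-2)*z)) (-(2*p*(p-2))) z := by
        have := ((hasDerivAt_id z).const_mul (2*p*(p-2))).const_sub (p*w)
        simpa using this
      exact e1.mul e2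
    apply antitoneOn_of_deriv_nonpos (convex_Ici _) hDc.continuousOn
    · rw [interior_Ici]
      exact fun z hz => (hdd z hz).differentiableAt.differentiableWithinAt
    · rw [interior_Ici]
      intro z hz
      rw [(hdd z hz).deriv]
      have hz : 0 < z := hz
      have : (2*z+w)^(p-2) = (2*z+w)^(p-2-1) * (2*z+w) := by
        rw [← Real.rpow_add_one (by positivity)]; congr 1; ring
      rw [this]
      have h2 : 0 ≤ p - 2 := by linarith
      have h1 : 0 ≤ p - 1 := by linarith
      have h0 : 0 ≤ p := by linarith
      have : 0 ≤ (2*z+w)^(p-2-1) * (4*p*(p-1)*(p-2)*z) := by positivity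
      nlinarith
  have hw1 : w^(p-2) * w = w^(p-1) := by
    rcases eq_or_lt_of_le hw with h | h
    · rw [← h, mul_zero, Real.zero_rpow (by linarith)]
    · rw [← Real.rpow_add_one h.ne']; congr 1; ring
  have hD0 : D 0 = p*w^(p-1) := by
    simp only [hD, mul_zero, zero_add, sub_zero]
    rw [← hw1]; ring
  set k : ℝ → ℝ := fun z : ℝ => (w-(p-2)*z)*(2*z+w)^(p-1) - p*w^(p-1)*z with hk
  have hkd : ∀ z ∈ Set.Ioi (0:ℝ), HasDerivAt k (D z - D 0) z := by
    intro z hz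
    have hz : 0 < z := hz
    have e1 : HasDerivAt (fun z : ℝ => (2*z+w)^(p-1)) (2 * (p-1) * (2*z+w)^(p-1-1)) z := by
      have := (((hasDerivAt_id z).const_mul 2).add_const w).rpow_const (p := p-1) (Or.inl (by simp; positivity))
      simpa using this
    have e2 : HasDerivAt (fun z : ℝ => (w-(p-2)*z)) (-(p-2)) z := by
      have := ((hasDerivAt_id z).const_mul (p-2)).const_sub w
      simpa using this
    have e3 : HasDerivAt (fun z : ℝ => p*w^(p-1)*z) (p*w^(p-1)) z := by
      have := ((hasDerivAt_id z).const_mul (p*w^(p-1)))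
      simpa using this
    have := (e2.mul e1).sub e3
    refine this.congr_deriv ?_
    rw [hD0]; simp only [hD]
    have : (2*z+w)^(p-1) = (2*z+w)^(p-2) * (2*z+w) := by
      rw [← Real.rpow_add_one (by positivity)]; congr 1; ring
    rw [this, show p-1-1 = p-2 by ring]; ring
  have hkc : Continuous k := by
    apply Continuous.sub _ (by fun_prop)
    apply Continuous.mul (by fun_prop)
    exact Continuous.rpow_const (by fun_prop) (fun x => Or.inr (by linarith))
  have hdiff : DifferentiableOn ℝ k (interior (Set.Ici 0)) := by
    rw [interior_Ici]
    exact fun z hz => (hkd z hz).differentiableAt.differentiableWithinAt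
  constructor
  · apply AntitoneOn.concaveOn_of_deriv (convex_Ici _) hkc.continuousOn hdiff
    rw [interior_Ici]
    intro a ha b hb hab
    rw [(hkd a ha).deriv, (hkd b hb).deriv]
    have := hDa (Set.mem_Ici.2 (le_of_lt ha)) (Set.mem_Ici.2 (le_of_lt hb)) hab
    linarith
  · apply antitoneOn_of_deriv_nonpos (convex_Ici _) hkc.continuousOn hdiff
    rw [interior_Ici]
    intro a ha
    rw [(hkd a ha).deriv]
    have := hDa (Set.mem_Ici.2 le_rfl) (Set.mem_Ici.2 (le_of_lt ha)) (le_of_lt ha)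
    linarith

lemma zz_aux2 {p w : ℝ} (hp : 2 ≤ p) (hw : 0 ≤ w) :
    ConcaveOn ℝ (Set.Ici 0) (fun y : ℝ => (-(p-2)*y-(p-1)*w)*(w+2*y)^(p-1) + p*w^(p-1)*y) ∧
    AntitoneOn (fun y : ℝ => (-(p-2)*y-(p-1)*w)*(w+2*y)^(p-1) + p*w^(p-1)*y) (Set.Ici 0) := by
  set k : ℝ → ℝ := fun y : ℝ => (-(p-2)*y-(p-1)*w)*(w+2*y)^(p-1) + p*w^(p-1)*y with hk
  set D : ℝ → ℝ := fun y => p*w^(p-1) - ((p-2)*(w+2*y)^(p-1) + 2*(p-1)*(((p-2)*y+(p-1)*w)*(w+2*y)^(p-2))) with hD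
  have h2 : 0 ≤ p - 2 := by linarith
  have h1 : 0 ≤ p - 1 := by linarith
  have hw1 : w^(p-2) * w = w^(p-1) := by
    rcases eq_or_lt_of_le hw with h | h
    · rw [← h, mul_zero, Real.zero_rpow (by linarith)]
    · rw [← Real.rpow_add_one h.ne']; congr 1; ring
  have hDa : AntitoneOn D (Set.Ici 0) := by
    intro a ha b hb hab
    have ha : 0 ≤ a := ha
    have hb : 0 ≤ b := hb
    simp only [hD]
    have q1 : (w+2*a)^(p-1) ≤ (w+2*b)^(p-1) := Real.rpow_le_rpow (by positivity) (by linarith) h1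
    have q2 : (w+2*a)^(p-2) ≤ (w+2*b)^(p-2) := Real.rpow_le_rpow (by positivity) (by linarith) h2
    gcongr
  have hD0 : D 0 ≤ 0 := by
    simp only [hD, mul_zero, zero_add, add_zero]
    have : p * w ^ (p - 1) - ((p - 2) * w ^ (p - 1) + 2 * (p - 1) * ((p - 1) * w * w ^ (p - 2))) = w^(p-1) * (2-2*(p-1)^2) := by
      rw [← hw1]; ring
    rw [this]
    apply mul_nonpos_of_nonneg_of_nonpos (by positivity)
    nlinarith
  have hkd : ∀ z ∈ Set.Ioi (0:ℝ), HasDerivAt k (D z) z := by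
    intro z hz
    have hz : 0 < z := hz
    have e1 : HasDerivAt (fun z : ℝ => (w+2*z)^(p-1)) (2 * (p-1) * (w+2*z)^(p-1-1)) z := by
      have := (((hasDerivAt_id z).const_mul 2).const_add w).rpow_const (p := p-1) (Or.inl (by simp; positivity))
      simpa using this
    have e2 : HasDerivAt (fun z : ℝ => (-(p-2)*z-(p-1)*w)) (-(p-2)) z := by
      have := ((hasDerivAt_id z).const_mul (-(p-2))).sub_const ((p-1)*w)
      simpa using this
    have e3 : HasDerivAt (fun z : ℝ => p*w^(p-1)*z) (p*w^(p-1)) z := by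
      have := ((hasDerivAt_id z).const_mul (p*w^(p-1)))
      simpa using this
    have := (e2.mul e1).add e3
    refine this.congr_deriv ?_
    simp only [hD]
    rw [show p-1-1 = p-2 by ring]; ring
  have hkc : Continuous k := by
    apply Continuous.add _ (by fun_prop)
    apply Continuous.mul (by fun_prop)
    exact Continuous.rpow_const (by fun_prop) (fun x => Or.inr (by linarith))
  have hdiff : DifferentiableOn ℝ k (interior (Set.Ici 0)) := by
    rw [interior_Ici]
    exact fun z hz => (hkd z hz).differentiableAt.differentiableWithinAt
  constructor
  · apply AntitoneOn.concaveOn_of_deriv (convex_Ici _) hkc.continuousOn hdiff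
    rw [interior_Ici]
    intro a ha b hb hab
    rw [(hkd a ha).deriv, (hkd b hb).deriv]
    exact hDa (Set.mem_Ici.2 (le_of_lt ha)) (Set.mem_Ici.2 (le_of_lt hb)) hab
  · apply antitoneOn_of_deriv_nonpos (convex_Ici _) hkc.continuousOn hdiff
    rw [interior_Ici]
    intro a ha
    rw [(hkd a ha).deriv]
    have := hDa (Set.mem_Ici.2 le_rfl) (Set.mem_Ici.2 (le_of_lt ha)) (le_of_lt ha)
    linarith

lemma comp_pos_part {k f : ℝ → ℝ} (hk : ConcaveOn ℝ (Set.Ici 0) k) (hk' : AntitoneOn k (Set.Ici 0))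
    (hf : ConvexOn ℝ Set.univ f) : ConcaveOn ℝ Set.univ (fun x => k (max (f x) 0)) := by
  refine ⟨convex_univ, ?_⟩
  intro x _ y _ a b ha hb hab
  have h1 := hk.2 (x := max (f x) 0) (by simp) (y := max (f y) 0) (by simp) ha hb hab
  refine h1.trans (hk' (by simp) ?_ ?_)
  · simp only [smul_eq_mul, Set.mem_Ici]; positivity
  · have h2 := hf.2 (Set.mem_univ x) (Set.mem_univ y) ha hb hab
    simp only [smul_eq_mul] at h2 ⊢
    apply max_le
    · refine h2.trans ?_
      gcongr <;> exact le_max_left _ _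
    · positivity

lemma zz_pos {p w : ℝ} (hp : 2 ≤ p) (hw : 0 ≤ w) :
    ConcaveOn ℝ Set.univ (fun x => (|w+x| - (p-1)*|x|) * (|x|+|w+x|)^(p-1)) := by
  obtain ⟨a1, a2⟩ := zz_aux1 hp hw
  obtain ⟨b1, b2⟩ := zz_aux2 hp hw
  have c1 := comp_pos_part a1 a2 (f := fun x => x) (convexOn_id convex_univ)
  have c2 := comp_pos_part b1 b2 (f := fun x => -w-x) (by
    refine ⟨convex_univ, ?_⟩
    intro x _ y _ a b ha hb hab
    simp only [smul_eq_mul]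
    have : a = 1 - b := by linarith
    subst this; apply le_of_eq; ring)
  have c3 : ConcaveOn ℝ Set.univ (fun x : ℝ => (p-1) * (w * w^(p-1)) + p*w^(p-1)*x) := by
    refine ⟨convex_univ, ?_⟩
    intro x _ y _ a b ha hb hab
    simp only [smul_eq_mul]
    have : a = 1 - b := by linarith
    subst this; apply le_of_eq; ring
  have := (c1.add c2).add c3
  refine this.congr ?_
  intro x _
  simp only [Pi.add_apply]
  rcases le_total 0 x with hx | hx
  · rw [max_eq_left hx, max_eq_right (by linarith), abs_of_nonneg hx, abs_of_nonneg (by linarith)]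
    rw [show x + (w+x) = 2*x+w by ring]
    simp only [mul_zero, add_zero]; ring
  · rcases le_total (-w) x with hx2 | hx2
    · rw [max_eq_right hx, max_eq_right (by linarith), abs_of_nonpos hx, abs_of_nonneg (by linarith)]
      rw [show -x + (w+x) = w by ring]
      simp only [mul_zero, add_zero, zero_add]; ring
    · rw [max_eq_right hx, max_eq_left (by linarith), abs_of_nonpos hx, abs_of_nonpos (by linarith)]
      rw [show -x + -(w+x) = w + 2*(-w-x) by ring]
      simp only [mul_zero, zero_add]; ring

lemma conc_neg {f : ℝ → ℝ} (h : ConcaveOn ℝ Set.univ f) : ConcaveOn ℝ Set.univ (fun x => f (-x)) := by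
  refine ⟨convex_univ, ?_⟩
  intro x _ y _ a b ha hb hab
  have := h.2 (Set.mem_univ (-x)) (Set.mem_univ (-y)) ha hb hab
  simp only [smul_eq_mul] at this ⊢
  convert this using 2; ring

lemma zz {p : ℝ} (hp : 2 ≤ p) (w : ℝ) : ConcaveOn ℝ Set.univ (fun x => U p x (w+x)) := by
  have hc : 0 ≤ p^(1-p) := Real.rpow_nonneg (by linarith) _
  rcases le_total 0 w with hw | hw
  · exact (zz_pos hp hw).smul hc
  · have := (conc_neg (zz_pos hp (w := -w) (by linarith))).smul hc
    refine this.congr ?_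
    intro x _
    simp only [U, smul_eq_mul, abs_neg]
    rw [show -w + -x = -(w+x) by ring, abs_neg]

lemma zz' {p : ℝ} (hp : 2 ≤ p) (w : ℝ) : ConcaveOn ℝ Set.univ (fun x => U p x (w-x)) := by
  have := conc_neg (zz hp w)
  refine this.congr ?_
  intro x _
  simp [U, sub_eq_add_neg]

def phi (p x y : ℝ) : ℝ := ⨆ w : ℝ, (w*y - U p x w)

lemma young_aux {p q : ℝ} (hp : 2 ≤ p) (hpq : p.HolderConjugate q) (w y : ℝ) :
    w * y ≤ (p-1)^(1-p) * |w|^p/p + (p-1)*|y|^q/q := by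
  have hp1 : 0 < p - 1 := by linarith
  have hq : q ≠ 0 := hpq.symm.ne_zero
  have := Real.young_inequality (w * (p-1)^(-(1/q))) (y * (p-1)^(1/q)) hpq
  have e1 : (w * (p-1)^(-(1/q))) * (y * (p-1)^(1/q)) = w * y * ((p-1)^(-(1/q)) * (p-1)^(1/q)) := by ring
  rw [e1, ← Real.rpow_add hp1, abs_mul, abs_mul, Real.mul_rpow (abs_nonneg _) (abs_nonneg _),
    Real.mul_rpow (abs_nonneg _) (abs_nonneg _), abs_of_pos (Real.rpow_pos_of_pos hp1 _),
    abs_of_pos (Real.rpow_pos_of_pos hp1 _), ← Real.rpow_mul hp1.le, ← Real.rpow_mul hp1.le] at this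
  have e2 : -(1/q) * p = 1 - p := by
    have h1 := hpq.inv_add_inv_eq_one
    have hp0 := hpq.ne_zero
    field_simp at h1 ⊢; linarith
  have e3 : 1/q*q = 1 := by field_simp
  rw [e2, e3] at this
  simp only [neg_add_cancel, Real.rpow_zero, mul_one, Real.rpow_one] at this
  rw [mul_comm (|w|^p), mul_comm (|y|^q)] at this
  exact this

lemma phi_bdd {p q : ℝ} (hp : 2 ≤ p) (hpq : p.HolderConjugate q) (x y w : ℝ) :
    w*y - U p x w ≤ (p-1)*(|x|^p/p+|y|^q/q) := by
  have h1 := young_aux hp hpq w y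
  have h2 := U_major hp x w
  have : (p-1)*(|x|^p/p+|y|^q/q) = (p-1)*|x|^p/p + (p-1)*|y|^q/q := by ring
  linarith

lemma phi_le {p q : ℝ} (hp : 2 ≤ p) (hpq : p.HolderConjugate q) (x y : ℝ) :
    phi p x y ≤ (p-1)*(|x|^p/p+|y|^q/q) := ciSup_le fun w => phi_bdd hp hpq x y w

lemma le_phi {p q : ℝ} (hp : 2 ≤ p) (hpq : p.HolderConjugate q) (x y w : ℝ) :
    w*y - U p x w ≤ phi p x y :=
  le_ciSup (f := fun w => w*y - U p x w) ⟨_, by rintro _ ⟨w, rfl⟩; exact phi_bdd hp hpq x y w⟩ w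

lemma phi_pm_nonneg {p q σ : ℝ} (hp : 2 ≤ p) (hpq : p.HolderConjugate q) (hσ : σ = 1 ∨ σ = -1) (x y : ℝ) :
    0 ≤ phi p x y + σ*(x*y) := by
  have h := le_phi hp hpq x y (-σ*x)
  have : U p x (-σ*x) ≤ 0 := by
    unfold U
    apply mul_nonpos_of_nonneg_of_nonpos (Real.rpow_nonneg (by linarith) _)
    apply mul_nonpos_of_nonpos_of_nonneg _ (by positivity)
    have : |-σ*x| = |x| := by rcases hσ with rfl | rfl <;> simp
    rw [this]; nlinarith [abs_nonneg x]
  linarith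

lemma phi_pm_convex {p q σ : ℝ} (hp : 2 ≤ p) (hpq : p.HolderConjugate q) (hσ : σ = 1 ∨ σ = -1) :
    ConvexOn ℝ Set.univ (fun z : ℝ × ℝ => phi p z.1 z.2 + σ*(z.1*z.2)) := by
  refine ⟨convex_univ, ?_⟩
  rintro ⟨x, y⟩ _ ⟨x', y'⟩ _ a b ha hb hab
  simp only [smul_eq_mul, Prod.fst_add, Prod.smul_fst, Prod.snd_add, Prod.smul_snd]
  rw [← le_sub_iff_add_le]
  apply ciSup_le
  intro w
  set X := a*x+b*x'
  set Y := a*y+b*y'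
  set v := w + σ*X
  have hc : a * U p x (v-σ*x) + b * U p x' (v-σ*x') ≤ U p X (v-σ*X) := by
    rcases hσ with rfl | rfl
    · have := (zz' hp v).2 (Set.mem_univ x) (Set.mem_univ x') ha hb hab
      simpa [smul_eq_mul] using this
    · have := (zz hp v).2 (Set.mem_univ x) (Set.mem_univ x') ha hb hab
      simpa [smul_eq_mul] using this
  have e : v - σ*X = w := by simp [v]
  rw [e] at hc
  have h1 := le_phi hp hpq x y (v-σ*x)
  have h2 := le_phi hp hpq x' y' (v-σ*x')
  have h1' := mul_le_mul_of_nonneg_left h1 ha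
  have h2' := mul_le_mul_of_nonneg_left h2 hb
  have e2 : w*Y = v*Y - σ*(X*Y) := by simp [v]; ring
  have e3 : v*Y = a*(v*y)+b*(v*y') := by simp [Y]; ring
  nlinarith

lemma phi_pm_cont {p q σ : ℝ} (hp : 2 ≤ p) (hpq : p.HolderConjugate q) (hσ : σ = 1 ∨ σ = -1) :
    Continuous (fun z : ℝ × ℝ => phi p z.1 z.2 + σ*(z.1*z.2)) := by
  have := (phi_pm_convex hp hpq hσ).continuousOn isOpen_univ
  rwa [continuousOn_univ] at this

end Bell
end
end

section
open MeasureTheory Real Filter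
noncomputable section

namespace Th

def gp (s x : ℝ) : ℝ := (√(2*π*s))⁻¹ * Real.exp (-x^2/(2*s))
def gp1 (s x : ℝ) : ℝ := -(x/s) * gp s x
def gp2 (s x : ℝ) : ℝ := (x^2/s^2 - 1/s) * gp s x
def th (s x : ℝ) : ℝ := ∑' n : ℤ, gp s (x - n)
def th1 (s x : ℝ) : ℝ := ∑' n : ℤ, gp1 s (x - n)
def th2 (s x : ℝ) : ℝ := ∑' n : ℤ, gp2 s (x - n)
def pr (s : ℝ) (m : ℤ) (x : ℝ) : ℝ := gp s (x - m) / th s x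
def pr1 (s : ℝ) (m : ℤ) (x : ℝ) : ℝ := pr s m x * (-((x - m)/s) - th1 s x / th s x)
def ee (s : ℝ) (m : ℤ) : ℝ := ∫ x, th s x * (pr s 0 x * pr s m x)
def ep (s : ℝ) (m : ℤ) : ℝ := ∫ x, th s x * (pr1 s 0 x * pr1 s m x)

lemma gp_pos {s : ℝ} (hs : 0 < s) (x : ℝ) : 0 < gp s x := by
  unfold gp; positivity

lemma gp_neg (s x : ℝ) : gp s (-x) = gp s x := by simp [gp]
lemma gp1_neg (s x : ℝ) : gp1 s (-x) = -gp1 s x := by simp [gp1, gp_neg]; ring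

lemma gp_hasDeriv {s : ℝ} (x : ℝ) : HasDerivAt (gp s) (gp1 s x) x := by
  have h : HasDerivAt (fun x : ℝ => -x^2/(2*s)) (-(2*x)/(2*s)) x := by
    have := ((hasDerivAt_pow 2 x).neg).div_const (2*s)
    simpa using this
  refine (h.exp.const_mul ((√(2*π*s))⁻¹)).congr_deriv ?_
  unfold gp1 gp
  rcases eq_or_ne s 0 with rfl | hs
  · simp
  · field_simp

lemma gp1_hasDeriv {s : ℝ} (x : ℝ) : HasDerivAt (gp1 s) (gp2 s x) x := by
  have h : HasDerivAt (fun x : ℝ => -(x/s)) (-(1/s)) x := ((hasDerivAt_id x).div_const s).neg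
  refine (h.mul (gp_hasDeriv x)).congr_deriv ?_
  unfold gp2 gp1; ring

lemma gp_hasDeriv_s {s : ℝ} (hs : 0 < s) (x : ℝ) : HasDerivAt (fun s => gp s x) (gp2 s x / 2) s := by
  have h1 : HasDerivAt (fun s : ℝ => (√(2*π*s))⁻¹) (-(2*π/(2*√(2*π*s)))/(√(2*π*s))^2) s := by
    have h := (((hasDerivAt_id s).const_mul (2*π)).sqrt (by simp; positivity))
    have h' := h.fun_inv (by simp; positivity)
    simpa using h'
  have h2 : HasDerivAt (fun s : ℝ => -x^2/(2*s)) (x^2/(2*s^2)) s := by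
    have h := ((hasDerivAt_id s).const_mul 2)
    have h' := (hasDerivAt_const s (-x^2)).div h (by simp; positivity)
    refine h'.congr_deriv ?_
    simp; field_simp
  refine (h1.mul h2.exp).congr_deriv ?_
  unfold gp2 gp
  have hq : 0 < √(2*π*s) := by positivity
  have hq2 : √(2*π*s)^2 = 2*π*s := Real.sq_sqrt (by positivity)
  have e : (-(2*π/(2*√(2*π*s)))/(√(2*π*s))^2) = -(1/(2*s)) * (√(2*π*s))⁻¹ := by
    rw [hq2]; field_simp
  rw [e]; field_simp; ring

def Cab (a b : ℝ) : ℝ := (√(2*π*a))⁻¹ * 2 * Real.exp (2*b) * (1+1/a+1/a^2)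

lemma Cab_pos {a b : ℝ} (ha : 0 < a) : 0 < Cab a b := by unfold Cab; positivity

lemma gp_bound0 {a b s : ℝ} (ha : 0 < a) (h1 : a ≤ s) (h2 : s ≤ b) (v : ℝ) :
    (1+v^2) * gp s v ≤ (√(2*π*a))⁻¹ * 2 * Real.exp (2*b) * Real.exp (-|v|) := by
  have hs : 0 < s := by linarith
  have hb : 0 < b := by linarith
  unfold gp
  have e1 : (√(2*π*s))⁻¹ ≤ (√(2*π*a))⁻¹ := by gcongr
  have e2 : 1 + v^2 ≤ 2 * Real.exp |v| := by
    have := Real.quadratic_le_exp_of_nonneg (abs_nonneg v)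
    rw [sq_abs] at this; nlinarith [abs_nonneg v]
  have e3 : Real.exp (-v^2/(2*s)) ≤ Real.exp (2*b - 2*|v|) := by
    apply Real.exp_le_exp.2
    have : -v^2/(2*s) ≤ -v^2/(2*b) := by
      rw [neg_div, neg_div, neg_le_neg_iff]; gcongr
    refine this.trans ?_
    rw [div_le_iff₀ (by positivity), ← sq_abs]
    nlinarith [sq_nonneg (|v| - 2*b)]
  calc (1+v^2) * ((√(2*π*s))⁻¹ * Real.exp (-v^2/(2*s)))
      ≤ (2 * Real.exp |v|) * ((√(2*π*a))⁻¹ * Real.exp (2*b - 2*|v|)) := by gcongr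
    _ = (√(2*π*a))⁻¹ * 2 * (Real.exp |v| * Real.exp (2*b - 2*|v|)) := by ring
    _ = _ := by rw [← Real.exp_add, mul_assoc _ (Real.exp (2*b)), ← Real.exp_add]; congr 2; ring

lemma gp_bound {a b s : ℝ} (ha : 0 < a) (h1 : a ≤ s) (h2 : s ≤ b) (v : ℝ) :
    (1+v^2) * gp s v ≤ Cab a b * Real.exp (-|v|) ∧ gp s v ≤ Cab a b * Real.exp (-|v|) ∧
    |gp1 s v| ≤ Cab a b * Real.exp (-|v|) ∧ |gp2 s v| ≤ Cab a b * Real.exp (-|v|) := by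
  have hs : 0 < s := by linarith
  have h0 := gp_bound0 ha h1 h2 v
  have hg := gp_pos hs v
  have key : ∀ c, 0 ≤ c → c ≤ (1+1/a+1/a^2) * (1+v^2) → c * gp s v ≤ Cab a b * Real.exp (-|v|) := by
    intro c _ hc
    calc c * gp s v ≤ ((1+1/a+1/a^2) * (1+v^2)) * gp s v := by gcongr
      _ = (1+1/a+1/a^2) * ((1+v^2) * gp s v) := by ring
      _ ≤ (1+1/a+1/a^2) * ((√(2*π*a))⁻¹ * 2 * Real.exp (2*b) * Real.exp (-|v|)) := by gcongr
      _ = _ := by unfold Cab; ring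
  have i1 : 1/s ≤ 1/a := by gcongr
  have i2 : 1/s^2 ≤ 1/a^2 := by gcongr
  have ha1 : 0 < 1/a := by positivity
  have ha2 : 0 < 1/a^2 := by positivity
  have hs2 : 0 < 1/s := by positivity
  have hs3 : 0 < 1/s^2 := by positivity
  refine ⟨key _ (by positivity) ?_, ?_, ?_, ?_⟩
  · nlinarith [sq_nonneg v]
  · have := key 1 (by norm_num) (by nlinarith [sq_nonneg v]); simpa using this
  · unfold gp1
    rw [abs_mul, abs_of_pos hg, abs_neg]
    apply key _ (abs_nonneg _)
    rw [abs_div, abs_of_pos hs, div_eq_mul_one_div]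
    have : |v| ≤ 1 + v^2 := by rw [← sq_abs]; nlinarith [sq_nonneg (|v|-1), abs_nonneg v]
    calc |v| * (1/s) ≤ (1+v^2) * (1/a) := by gcongr
      _ ≤ _ := by nlinarith [sq_nonneg v]
  · unfold gp2
    rw [abs_mul, abs_of_pos hg]
    apply key _ (abs_nonneg _)
    rw [abs_le]
    have : v^2/s^2 = v^2 * (1/s^2) := by ring
    rw [this]
    have : v^2 * (1/s^2) ≤ v^2 * (1/a^2) := by gcongr
    have : 0 ≤ v^2 * (1/s^2) := by positivity
    have : 0 ≤ v^2 * (1/a) := by positivity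
    constructor <;> nlinarith [sq_nonneg v]

lemma summable_exp_abs : Summable (fun n : ℤ => Real.exp (-|(n:ℝ)|)) := by
  have h : Summable (fun n : ℕ => Real.exp (-(n:ℝ))) := Real.summable_exp_neg_nat
  apply Summable.of_nat_of_neg
  · simpa using h
  · simpa using h

def E0 : ℝ := ∑' n : ℤ, Real.exp (-|(n:ℝ)|)

lemma exp_shift (x : ℝ) (n : ℤ) : Real.exp (-|x - n|) ≤ Real.exp |x| * Real.exp (-|(n:ℝ)|) := by
  rw [← Real.exp_add]
  apply Real.exp_le_exp.2
  have := abs_sub_abs_le_abs_sub (n:ℝ) x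
  rw [abs_sub_comm] at this
  linarith

lemma summable_exp_sub (x : ℝ) : Summable (fun n : ℤ => Real.exp (-|x - n|)) :=
  Summable.of_nonneg_of_le (fun _ => (Real.exp_pos _).le) (exp_shift x) (summable_exp_abs.mul_left _)

lemma tsum_exp_sub_le (x : ℝ) : ∑' n : ℤ, Real.exp (-|x - n|) ≤ Real.exp 1 * E0 := by
  have e : ∑' n : ℤ, Real.exp (-|x - n|) = ∑' n : ℤ, Real.exp (-|Int.fract x - n|) := by
    rw [← (Equiv.addRight ⌊x⌋).tsum_eq]
    apply tsum_congr; intro n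
    simp only [Equiv.coe_addRight, Int.cast_add]
    congr 3; rw [Int.fract]; ring
  rw [e, E0, ← tsum_mul_left]
  apply (summable_exp_sub _).tsum_le_tsum _ (summable_exp_abs.mul_left _)
  intro n
  refine (exp_shift _ _).trans ?_
  gcongr
  rw [abs_of_nonneg (Int.fract_nonneg x)]; exact (Int.fract_lt_one x).le

lemma gp_summable {s : ℝ} (hs : 0 < s) (x : ℝ) : Summable (fun n : ℤ => gp s (x - n)) :=
  Summable.of_nonneg_of_le (fun _ => (gp_pos hs _).le) (fun n => (gp_bound hs le_rfl le_rfl (x-n)).2.1)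
    ((summable_exp_sub x).mul_left _)

lemma gp1_summable {s : ℝ} (hs : 0 < s) (x : ℝ) : Summable (fun n : ℤ => gp1 s (x - n)) :=
  Summable.of_norm_bounded ((summable_exp_sub x).mul_left _) (fun n => (gp_bound hs le_rfl le_rfl (x-n)).2.2.1)

lemma gp2_summable {s : ℝ} (hs : 0 < s) (x : ℝ) : Summable (fun n : ℤ => gp2 s (x - n)) :=
  Summable.of_norm_bounded ((summable_exp_sub x).mul_left _) (fun n => (gp_bound hs le_rfl le_rfl (x-n)).2.2.2)

lemma gp1_abs_summable {s : ℝ} (hs : 0 < s) (x : ℝ) : Summable (fun n : ℤ => |gp1 s (x - n)|) := (gp1_summable hs x).abs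

lemma th_pos {s : ℝ} (hs : 0 < s) (x : ℝ) : 0 < th s x :=
  (gp_summable hs x).tsum_pos (fun _ => (gp_pos hs _).le) 0 (gp_pos hs _)

lemma th_le {a b s : ℝ} (ha : 0 < a) (h1 : a ≤ s) (h2 : s ≤ b) (x : ℝ) :
    th s x ≤ Cab a b * (Real.exp 1 * E0) ∧ |th1 s x| ≤ Cab a b * (Real.exp 1 * E0) ∧
    |th2 s x| ≤ Cab a b * (Real.exp 1 * E0) := by
  have hs : 0 < s := by linarith
  have hC := (Cab_pos (b := b) ha).le
  have base : ∑' n : ℤ, Cab a b * Real.exp (-|x - n|) ≤ Cab a b * (Real.exp 1 * E0) := by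
    rw [tsum_mul_left]; gcongr; exact tsum_exp_sub_le x
  have hsum := (summable_exp_sub x).mul_left (Cab a b)
  refine ⟨?_, ?_, ?_⟩
  · exact ((gp_summable hs x).tsum_le_tsum (fun n : ℤ => (gp_bound ha h1 h2 (x-n)).2.1) hsum).trans base
  · exact (tsum_of_norm_bounded hsum.hasSum (f := fun n : ℤ => gp1 s (x-n)) (fun n => (gp_bound ha h1 h2 (x-n)).2.2.1)).trans base
  · exact (tsum_of_norm_bounded hsum.hasSum (f := fun n : ℤ => gp2 s (x-n)) (fun n => (gp_bound ha h1 h2 (x-n)).2.2.2)).trans base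

lemma th_lower {a b s : ℝ} (ha : 0 < a) (h1 : a ≤ s) (h2 : s ≤ b) (x : ℝ) :
    (√(2*π*b))⁻¹ * Real.exp (-1/(2*a)) ≤ th s x := by
  have hs : 0 < s := by linarith
  have hb : 0 < b := by linarith
  have h := (gp_summable hs x).le_tsum ⌊x⌋ (fun n _ => (gp_pos hs _).le)
  refine le_trans ?_ h
  unfold gp
  have hf : (x - ⌊x⌋)^2 ≤ 1 := by
    have h0 : 0 ≤ x - ⌊x⌋ := Int.fract_nonneg x
    have h1 : x - ⌊x⌋ ≤ 1 := (Int.fract_lt_one x).le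
    nlinarith
  have : -1/(2*a) ≤ -(x-⌊x⌋)^2/(2*s) := by
    rw [neg_div, neg_div, neg_le_neg_iff]; gcongr
  gcongr

lemma th_hasDeriv {s : ℝ} (hs : 0 < s) (x : ℝ) : HasDerivAt (th s) (th1 s x) x := by
  apply hasDerivAt_tsum_of_isPreconnected (y := x) (g := fun (n : ℤ) x => gp s (x-n)) (g' := fun (n : ℤ) x => gp1 s (x-n)) (t := Metric.ball x 1) (y₀ := x)
    (u := fun n : ℤ => Cab s s * (Real.exp (|x|+1) * Real.exp (-|(n:ℝ)|)))
    ((summable_exp_abs.mul_left _).mul_left _) Metric.isOpen_ball (convex_ball x 1).isPreconnected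
  · intro n y _
    exact (gp_hasDeriv (y - n)).comp_sub_const y n
  · intro n y hy
    refine (gp_bound hs le_rfl le_rfl (y-n)).2.2.1.trans ?_
    gcongr
    · exact (Cab_pos hs).le
    · refine (exp_shift y n).trans ?_
      gcongr
      have : |y - x| < 1 := by simpa [Real.dist_eq] using hy
      have := abs_sub_abs_le_abs_sub y x
      linarith
  · simp
  · exact gp_summable hs x
  · simp

lemma th1_hasDeriv {s : ℝ} (hs : 0 < s) (x : ℝ) : HasDerivAt (th1 s) (th2 s x) x := by
  apply hasDerivAt_tsum_of_isPreconnected (y := x) (g := fun (n : ℤ) x => gp1 s (x-n)) (g' := fun (n : ℤ) x => gp2 s (x-n)) (t := Metric.ball x 1) (y₀ := x)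
    (u := fun n : ℤ => Cab s s * (Real.exp (|x|+1) * Real.exp (-|(n:ℝ)|)))
    ((summable_exp_abs.mul_left _).mul_left _) Metric.isOpen_ball (convex_ball x 1).isPreconnected
  · intro n y _
    exact (gp1_hasDeriv (y - n)).comp_sub_const y n
  · intro n y hy
    refine (gp_bound hs le_rfl le_rfl (y-n)).2.2.2.trans ?_
    gcongr
    · exact (Cab_pos hs).le
    · refine (exp_shift y n).trans ?_
      gcongr
      have : |y - x| < 1 := by simpa [Real.dist_eq] using hy
      have := abs_sub_abs_le_abs_sub y x
      linarith
  · simp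
  · exact gp1_summable hs x
  · simp

lemma th_hasDeriv_s {s : ℝ} (hs : 0 < s) (x : ℝ) : HasDerivAt (fun s => th s x) (th2 s x / 2) s := by
  have h := hasDerivAt_tsum_of_isPreconnected (t := Set.Ioo (s/2) (2*s)) (y₀ := s) (y := s)
    (g := fun (n : ℤ) s => gp s (x - n)) (g' := fun (n : ℤ) s => gp2 s (x-n)/2)
    (u := fun n : ℤ => Cab (s/2) (2*s) * Real.exp (-|x - n|))
    ((summable_exp_sub x).mul_left _) isOpen_Ioo isPreconnected_Ioo
    (by intro n y hy; exact gp_hasDeriv_s (by linarith [hy.1]) _)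
    (by
      intro n y hy
      have := (gp_bound (by linarith : 0 < s/2) hy.1.le hy.2.le (x-n)).2.2.2
      rw [norm_div, Real.norm_eq_abs]
      simp only [Real.norm_ofNat]
      linarith [abs_nonneg (gp2 y (x-n))])
    ⟨by linarith, by linarith⟩ (gp_summable hs x) ⟨by linarith, by linarith⟩
  refine h.congr_deriv ?_
  rw [tsum_div_const, th2]

lemma th_per (s x : ℝ) (m : ℤ) : th s (x + m) = th s x := by
  unfold th
  rw [← (Equiv.addRight m).tsum_eq]
  apply tsum_congr; intro n
  simp only [Equiv.coe_addRight, Int.cast_add]; congr 1; ring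

lemma th1_per (s x : ℝ) (m : ℤ) : th1 s (x + m) = th1 s x := by
  unfold th1
  rw [← (Equiv.addRight m).tsum_eq]
  apply tsum_congr; intro n
  simp only [Equiv.coe_addRight, Int.cast_add]; congr 1; ring

lemma th_even (s x : ℝ) : th s (-x) = th s x := by
  unfold th
  rw [← (Equiv.neg ℤ).tsum_eq]
  apply tsum_congr; intro n
  rw [← gp_neg]; simp only [Equiv.neg_apply, Int.cast_neg]; congr 1; ring

lemma th1_odd (s x : ℝ) : th1 s (-x) = -th1 s x := by
  unfold th1
  rw [← (Equiv.neg ℤ).tsum_eq, ← tsum_neg]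
  apply tsum_congr; intro n
  rw [← gp1_neg]; simp only [Equiv.neg_apply, Int.cast_neg]; congr 1; ring

lemma gp_cont {s : ℝ} : Continuous (gp s) := continuous_iff_continuousAt.2 fun x => (gp_hasDeriv x).continuousAt
lemma th_cont {s : ℝ} (hs : 0 < s) : Continuous (th s) := continuous_iff_continuousAt.2 fun x => (th_hasDeriv hs x).continuousAt
lemma th1_cont {s : ℝ} (hs : 0 < s) : Continuous (th1 s) := continuous_iff_continuousAt.2 fun x => (th1_hasDeriv hs x).continuousAt
lemma pr_cont {s : ℝ} (hs : 0 < s) (m : ℤ) : Continuous (pr s m) :=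
  (gp_cont.comp (continuous_id.sub continuous_const)).div (th_cont hs) fun x => (th_pos hs x).ne'
lemma pr1_cont {s : ℝ} (hs : 0 < s) (m : ℤ) : Continuous (pr1 s m) :=
  (pr_cont hs m).mul ((((continuous_id.sub continuous_const).div_const _).neg).sub
    ((th1_cont hs).div (th_cont hs) fun x => (th_pos hs x).ne'))

lemma pr_nonneg {s : ℝ} (hs : 0 < s) (m : ℤ) (x : ℝ) : 0 ≤ pr s m x := (div_pos (gp_pos hs _) (th_pos hs x)).le

lemma pr_hasSum {s : ℝ} (hs : 0 < s) (x : ℝ) : HasSum (fun m => pr s m x) 1 := by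
  have := (gp_summable hs x).hasSum.div_const (th s x)
  rwa [show (∑' n : ℤ, gp s (x - n)) = th s x from rfl, div_self (th_pos hs x).ne'] at this

lemma pr_le_one {s : ℝ} (hs : 0 < s) (m : ℤ) (x : ℝ) : pr s m x ≤ 1 :=
  le_hasSum (pr_hasSum hs x) m fun _ _ => pr_nonneg hs _ x

lemma pr_hasDeriv {s : ℝ} (hs : 0 < s) (m : ℤ) (x : ℝ) : HasDerivAt (pr s m) (pr1 s m x) x := by
  have h := ((gp_hasDeriv (s := s) (x - m)).comp_sub_const x m).div (th_hasDeriv hs x) (th_pos hs x).ne'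
  refine h.congr_deriv ?_
  have := (th_pos hs x).ne'
  unfold pr1 pr gp1
  field_simp

lemma pr_shift (s : ℝ) (m k : ℤ) (x : ℝ) : pr s m (x + k) = pr s (m - k) x := by
  unfold pr; rw [th_per]; congr 2; push_cast; ring
lemma pr1_shift (s : ℝ) (m k : ℤ) (x : ℝ) : pr1 s m (x + k) = pr1 s (m - k) x := by
  unfold pr1; rw [pr_shift, th_per, th1_per]; congr 4; push_cast; ring
lemma pr_reflect (s : ℝ) (m : ℤ) (x : ℝ) : pr s m (-x) = pr s (-m) x := by
  unfold pr; rw [th_even, ← gp_neg]; congr 2; push_cast; ring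
lemma pr1_reflect (s : ℝ) (m : ℤ) (x : ℝ) : pr1 s m (-x) = -pr1 s (-m) x := by
  unfold pr1; rw [pr_reflect, th_even, th1_odd]; push_cast; ring

end Th
end
end

section
open MeasureTheory Real Filter
noncomputable section

namespace Th

lemma integrable_exp_abs : Integrable (fun x : ℝ => Real.exp (-|x|)) := by
  rw [← integrableOn_univ, ← Set.Iic_union_Ioi (a := (0:ℝ))]
  apply IntegrableOn.union
  · refine (integrableOn_exp_Iic 0).congr_fun ?_ measurableSet_Iic
    intro x hx; simp only; rw [abs_of_nonpos hx, neg_neg]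
  · refine (integrableOn_exp_neg_Ioi 0).congr_fun ?_ measurableSet_Ioi
    intro x hx; simp only; rw [abs_of_pos hx]

lemma gp_integrable {s : ℝ} (hs : 0 < s) : Integrable (gp s) := by
  have h := (integrable_exp_neg_mul_sq (b := 1/(2*s)) (by positivity)).const_mul ((√(2*π*s))⁻¹)
  refine h.congr (ae_of_all _ fun x => ?_)
  simp only [gp]; congr 2; ring

lemma gp_integral {s : ℝ} (hs : 0 < s) : ∫ x, gp s x = 1 := by
  have : ∀ x, gp s x = (√(2*π*s))⁻¹ * Real.exp (-(1/(2*s)) * x^2) := by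
    intro x; simp only [gp]; congr 2; ring
  simp_rw [this]
  rw [integral_const_mul, integral_gaussian]
  rw [show π/(1/(2*s)) = 2*π*s by field_simp]
  exact inv_mul_cancel₀ (by positivity)

lemma gp_shift_integrable {s : ℝ} (hs : 0 < s) (m : ℝ) : Integrable (fun x => gp s (x - m)) :=
  (gp_integrable hs).comp_sub_right m

lemma gp_shift_integral {s : ℝ} (hs : 0 < s) (m : ℝ) : ∫ x, gp s (x-m) = 1 := by
  rw [integral_sub_right_eq_self (fun x => gp s x) m, gp_integral hs]

lemma u_eq {s : ℝ} (hs : 0 < s) (m : ℤ) (x : ℝ) :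
    th s x * (pr s 0 x * pr s m x) = gp s x * pr s m x := by
  have := (th_pos hs x).ne'
  simp only [pr, Int.cast_zero, sub_zero]; field_simp

lemma u_eq' {s : ℝ} (hs : 0 < s) (m : ℤ) (x : ℝ) :
    th s x * (pr s 0 x * pr s m x) = pr s 0 x * gp s (x-m) := by
  have := (th_pos hs x).ne'
  simp only [pr]; field_simp

lemma u_integrable {s : ℝ} (hs : 0 < s) (m : ℤ) : Integrable (fun x => gp s x * pr s m x) := by
  refine (gp_integrable hs).mono' ((gp_cont.mul (pr_cont hs m)).aestronglyMeasurable) (ae_of_all _ fun x => ?_)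
  rw [Real.norm_eq_abs, abs_mul, abs_of_pos (gp_pos hs x), abs_of_nonneg (pr_nonneg hs m x)]
  exact mul_le_of_le_one_right (gp_pos hs x).le (pr_le_one hs m x)

lemma ee_eq {s : ℝ} (hs : 0 < s) (m : ℤ) : ee s m = ∫ x, gp s x * pr s m x := by
  unfold ee; simp_rw [u_eq hs m]

lemma ee_nonneg {s : ℝ} (hs : 0 < s) (m : ℤ) : 0 ≤ ee s m := by
  rw [ee_eq hs]; exact integral_nonneg fun x => mul_nonneg (gp_pos hs x).le (pr_nonneg hs m x)

lemma ee_hasSum {s : ℝ} (hs : 0 < s) : HasSum (ee s) 1 := by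
  have h := hasSum_integral_of_summable_integral_norm (u_integrable hs) (by
    have e : ∀ m, ∫ x, ‖gp s x * pr s m x‖ = ∫ x, gp s x * pr s m x := by
      intro m; congr 1; ext x
      rw [Real.norm_eq_abs, abs_of_nonneg (mul_nonneg (gp_pos hs x).le (pr_nonneg hs m x))]
    simp_rw [e]
    refine summable_of_sum_le (c := 1) (fun m => ?_) (fun T => ?_)
    · rw [← ee_eq hs]; exact ee_nonneg hs m
    · rw [← integral_finsetSum _ (fun m _ => u_integrable hs m), ← gp_integral hs]
      apply integral_mono (integrable_finsetSum _ (fun m _ => u_integrable hs m)) (gp_integrable hs)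
      intro x
      simp only
      rw [← Finset.mul_sum]
      exact mul_le_of_le_one_right (gp_pos hs x).le (sum_le_hasSum T (fun _ _ => pr_nonneg hs _ x) (pr_hasSum hs x)))
  simp_rw [← ee_eq hs, tsum_mul_left, (pr_hasSum hs _).tsum_eq, mul_one, gp_integral hs] at h
  exact h

lemma ee_le_one {s : ℝ} (hs : 0 < s) (m : ℤ) : ee s m ≤ 1 :=
  le_hasSum (ee_hasSum hs) m fun _ _ => ee_nonneg hs _

lemma ee_gram (s : ℝ) (a b : ℤ) : ∫ x, th s x * (pr s a x * pr s b x) = ee s (b - a) := by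
  unfold ee
  rw [← integral_add_right_eq_self _ (a:ℝ)]
  simp_rw [th_per, pr_shift, sub_self]

lemma ep_gram (s : ℝ) (a b : ℤ) : ∫ x, th s x * (pr1 s a x * pr1 s b x) = ep s (b - a) := by
  unfold ep
  rw [← integral_add_right_eq_self _ (a:ℝ)]
  simp_rw [th_per, pr1_shift, sub_self]

lemma ee_neg (s : ℝ) (m : ℤ) : ee s (-m) = ee s m := by
  have := ee_gram s m 0
  rw [zero_sub] at this
  rw [← this]; unfold ee; congr 1; ext x; ring

lemma ep_neg (s : ℝ) (m : ℤ) : ep s (-m) = ep s m := by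
  have := ep_gram s m 0
  rw [zero_sub] at this
  rw [← this]; unfold ep; congr 1; ext x; ring

def Kab (a b : ℝ) : ℝ := Cab a b * (1 + Cab a b * (Real.exp 1 * E0) * ((√(2*π*b))⁻¹ * Real.exp (-1/(2*a)))⁻¹)
def Lab (a b : ℝ) : ℝ := ((√(2*π*b))⁻¹ * Real.exp (-1/(2*a)))⁻¹

lemma E0_nonneg : 0 ≤ E0 := tsum_nonneg fun _ => (Real.exp_pos _).le

lemma th_inv_le {a b s : ℝ} (ha : 0 < a) (h1 : a ≤ s) (h2 : s ≤ b) (x : ℝ) :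
    (th s x)⁻¹ ≤ Lab a b := by
  have hb : 0 < b := by linarith
  exact inv_anti₀ (by positivity) (th_lower ha h1 h2 x)

lemma Lab_nonneg {a b : ℝ} : 0 ≤ Lab a b := by unfold Lab; positivity

lemma L_le {a b s : ℝ} (ha : 0 < a) (h1 : a ≤ s) (h2 : s ≤ b) (x : ℝ) :
    |th1 s x / th s x| ≤ Cab a b * (Real.exp 1 * E0) * Lab a b ∧
    |th2 s x / th s x| ≤ Cab a b * (Real.exp 1 * E0) * Lab a b := by
  have hs : 0 < s := by linarith
  have hC := (Cab_pos (b := b) ha).le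
  have hE := E0_nonneg
  rw [abs_div, abs_div, abs_of_pos (th_pos hs x), div_eq_mul_inv, div_eq_mul_inv]
  have hi := th_inv_le ha h1 h2 x
  have h3 := th_le ha h1 h2 x
  have := inv_nonneg.2 (th_pos hs x).le
  constructor
  · exact mul_le_mul h3.2.1 hi this (by positivity)
  · exact mul_le_mul h3.2.2 hi this (by positivity)

lemma gpL_le {a b s : ℝ} (ha : 0 < a) (h1 : a ≤ s) (h2 : s ≤ b) (m : ℤ) (x : ℝ) :
    |th s x * pr1 s m x| ≤ Kab a b * Real.exp (-|x-m|) := by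
  have hs : 0 < s := by linarith
  have e : th s x * pr1 s m x = gp1 s (x-m) - gp s (x-m) * (th1 s x / th s x) := by
    have := (th_pos hs x).ne'
    unfold pr1 pr gp1; field_simp
  rw [e]
  have hb := gp_bound ha h1 h2 (x-m)
  have hL := (L_le ha h1 h2 x).1
  have hg := gp_pos hs (x-m)
  calc |gp1 s (x-m) - gp s (x-m) * (th1 s x / th s x)|
      ≤ |gp1 s (x-m)| + |gp s (x-m) * (th1 s x / th s x)| := abs_sub _ _
    _ = |gp1 s (x-m)| + gp s (x-m) * |th1 s x / th s x| := by rw [abs_mul, abs_of_pos hg]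
    _ ≤ Cab a b * Real.exp (-|x-m|) + (Cab a b * Real.exp (-|x-m|)) * (Cab a b * (Real.exp 1 * E0) * Lab a b) := by
        gcongr
        · exact hb.2.2.1
        · exact mul_nonneg (Cab_pos ha).le (Real.exp_pos _).le
        · exact hb.2.1
    _ = _ := by unfold Kab Lab; ring

lemma Kab_nonneg {a b : ℝ} (ha : 0 < a) : 0 ≤ Kab a b := by
  unfold Kab
  have := Cab_pos (b := b) ha
  have := E0_nonneg
  positivity

lemma epi_le {a b s : ℝ} (ha : 0 < a) (h1 : a ≤ s) (h2 : s ≤ b) (n m : ℤ) (x : ℝ) :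
    |th s x * (pr1 s n x * pr1 s m x)| ≤ Lab a b * Kab a b^2 * (Real.exp (-|x-n|) * Real.exp (-|x-m|)) := by
  have hs : 0 < s := by linarith
  have ht := th_pos hs x
  have e : th s x * (pr1 s n x * pr1 s m x) = (th s x)⁻¹ * ((th s x * pr1 s n x) * (th s x * pr1 s m x)) := by
    field_simp
  have g1 := gpL_le ha h1 h2 n x
  have g2 := gpL_le ha h1 h2 m x
  have hi := th_inv_le ha h1 h2 x
  have := Kab_nonneg (b := b) ha
  rw [e, abs_mul, abs_mul, abs_of_pos (inv_pos.2 ht)]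
  calc _ ≤ Lab a b * ((Kab a b * Real.exp (-|x-n|)) * (Kab a b * Real.exp (-|x-m|))) := by
        gcongr
        exact Lab_nonneg
    _ = _ := by ring

lemma exp_abs_le_one (x : ℝ) : Real.exp (-|x|) ≤ 1 := by
  rw [Real.exp_le_one_iff]; linarith [abs_nonneg x]

lemma epi_integrable {s : ℝ} (hs : 0 < s) (n m : ℤ) : Integrable (fun x => th s x * (pr1 s n x * pr1 s m x)) := by
  refine ((integrable_exp_abs.comp_sub_right (n:ℝ)).const_mul (Lab s s * Kab s s^2)).mono'
    (((th_cont hs).mul ((pr1_cont hs n).mul (pr1_cont hs m))).aestronglyMeasurable) (ae_of_all _ fun x => ?_)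
  refine (epi_le hs le_rfl le_rfl n m x).trans ?_
  have h0 := exp_abs_le_one (x-m)
  have := Lab_nonneg (a := s) (b := s)
  gcongr
  exact mul_le_of_le_one_right (Real.exp_pos _).le h0

lemma eei_integrable {s : ℝ} (hs : 0 < s) (n m : ℤ) : Integrable (fun x => th s x * (pr s n x * pr s m x)) := by
  have e : ∀ x, th s x * (pr s n x * pr s m x) = gp s (x-n) * pr s m x := by
    intro x; have := (th_pos hs x).ne'; simp only [pr]; field_simp
  simp_rw [e]
  refine (gp_shift_integrable hs n).mono' (((gp_cont.comp (continuous_id.sub continuous_const)).mul (pr_cont hs m)).aestronglyMeasurable) (ae_of_all _ fun x => ?_)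
  rw [Real.norm_eq_abs, abs_mul, abs_of_pos (gp_pos hs _), abs_of_nonneg (pr_nonneg hs m x)]
  exact mul_le_of_le_one_right (gp_pos hs _).le (pr_le_one hs m x)

lemma ep_zero_nonneg {s : ℝ} (hs : 0 < s) : 0 ≤ ep s 0 := by
  unfold ep
  exact integral_nonneg fun x => mul_nonneg (th_pos hs x).le (mul_self_nonneg _)

lemma ep_abs_le {s : ℝ} (hs : 0 < s) (m : ℤ) : |ep s m| ≤ ep s 0 := by
  have h0 : ep s 0 = ∫ x, th s x * (pr1 s m x * pr1 s m x) := by rw [ep_gram, sub_self]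
  have h1 : ep s 0 = ∫ x, (1/2) * (th s x * (pr1 s 0 x * pr1 s 0 x) + th s x * (pr1 s m x * pr1 s m x)) := by
    rw [integral_const_mul, integral_add (epi_integrable hs 0 0) (epi_integrable hs m m), ← h0]
    unfold ep; ring
  rw [h1]
  unfold ep
  refine (abs_integral_le_integral_abs).trans (integral_mono (epi_integrable hs 0 m).abs
    (((epi_integrable hs 0 0).add (epi_integrable hs m m)).const_mul _) fun x => ?_)
  simp only [Pi.add_apply]
  rw [abs_mul, abs_of_pos (th_pos hs x), ← mul_add, mul_left_comm]
  apply mul_le_mul_of_nonneg_left _ (th_pos hs x).le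
  rw [abs_mul]
  nlinarith [sq_nonneg (|pr1 s 0 x| - |pr1 s m x|), abs_mul_abs_self (pr1 s 0 x), abs_mul_abs_self (pr1 s m x)]

end Th
end
end

section
open MeasureTheory Real Filter
noncomputable section

namespace Th

lemma th2_meas {s : ℝ} (hs : 0 < s) : Measurable (th2 s) := by
  have : th2 s = deriv (th1 s) := by ext x; exact (th1_hasDeriv hs x).deriv.symm
  rw [this]; exact measurable_deriv _

lemma gp2_cont {s : ℝ} : Continuous (gp2 s) := by
  unfold gp2
  exact ((by fun_prop : Continuous fun x : ℝ => x^2/s^2 - 1/s)).mul gp_cont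
lemma gp1_cont {s : ℝ} : Continuous (gp1 s) := by
  unfold gp1
  exact ((by fun_prop : Continuous fun x : ℝ => -(x/s))).mul gp_cont

def Fs (m : ℤ) (s x : ℝ) : ℝ := gp s x * gp s (x-m) / th s x
def Fs' (m : ℤ) (s x : ℝ) : ℝ :=
  (gp2 s x / 2 * gp s (x-m) + gp s x * (gp2 s (x-m)/2)) / th s x - gp s x * gp s (x-m) / th s x * (th2 s x / th s x) / 2

lemma Fs_hasDeriv {s : ℝ} (hs : 0 < s) (m : ℤ) (x : ℝ) : HasDerivAt (fun s => Fs m s x) (Fs' m s x) s := by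
  have ht := (th_pos hs x).ne'
  have h := ((gp_hasDeriv_s hs x).mul (gp_hasDeriv_s hs (x-m))).div (th_hasDeriv_s hs x) ht
  refine h.congr_deriv ?_
  unfold Fs'
  simp only [Pi.mul_apply]
  field_simp

lemma Fs'_bound {a b s : ℝ} (ha : 0 < a) (h1 : a ≤ s) (h2 : s ≤ b) (m : ℤ) (x : ℝ) :
    |Fs' m s x| ≤ Cab a b^2 * Lab a b * (1 + Cab a b * (Real.exp 1 * E0) * Lab a b) * Real.exp (-|x|) := by
  have hs : 0 < s := by linarith
  have ht := th_pos hs x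
  obtain ⟨-, g0, -, g2⟩ := gp_bound ha h1 h2 x
  obtain ⟨-, g0', -, g2'⟩ := gp_bound ha h1 h2 (x-m)
  have hL := (L_le ha h1 h2 x).2
  have hi := th_inv_le ha h1 h2 x
  have hC := (Cab_pos (b := b) ha).le
  have hE := E0_nonneg
  have hm := exp_abs_le_one (x-m)
  have hc2 : gp s (x-m) ≤ Cab a b := g0'.trans (mul_le_of_le_one_right hC hm)
  have hc3 : |gp2 s (x-m)| ≤ Cab a b := g2'.trans (mul_le_of_le_one_right hC hm)
  have p0 := gp_pos hs x
  have p1 := gp_pos hs (x-m)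
  have hLn := Lab_nonneg (a := a) (b := b)
  set e := Real.exp (-|x|)
  have he : 0 < e := Real.exp_pos _
  set Q := Cab a b * (Real.exp 1 * E0) * Lab a b
  have hQ : 0 ≤ Q := by positivity
  have i1 : |gp2 s x / 2 * gp s (x-m) + gp s x * (gp2 s (x-m)/2)| ≤ Cab a b^2 * e := by
    calc _ ≤ |gp2 s x / 2 * gp s (x-m)| + |gp s x * (gp2 s (x-m)/2)| := abs_add_le _ _
      _ = |gp2 s x| * gp s (x-m) / 2 + gp s x * |gp2 s (x-m)| / 2 := by
        rw [abs_mul, abs_mul, abs_div, abs_div, abs_of_pos p0, abs_of_pos p1, abs_two]; ring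
      _ ≤ (Cab a b * e) * Cab a b / 2 + (Cab a b * e) * Cab a b / 2 := by gcongr
      _ = _ := by ring
  have i2 : gp s x * gp s (x-m) ≤ Cab a b^2 * e := by
    calc _ ≤ (Cab a b * e) * Cab a b := by gcongr
      _ = _ := by ring
  unfold Fs'
  calc _ ≤ |(gp2 s x / 2 * gp s (x-m) + gp s x * (gp2 s (x-m)/2)) / th s x| + |gp s x * gp s (x-m) / th s x * (th2 s x / th s x) / 2| := abs_sub _ _
    _ = |gp2 s x / 2 * gp s (x-m) + gp s x * (gp2 s (x-m)/2)| * (th s x)⁻¹ + gp s x * gp s (x-m) * (th s x)⁻¹ * |th2 s x / th s x| / 2 := by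
      rw [abs_div, abs_of_pos ht, abs_div, abs_two, abs_mul, abs_of_pos (by positivity : 0 < gp s x * gp s (x-m) / th s x)]
      simp only [div_eq_mul_inv]
    _ ≤ (Cab a b^2 * e) * Lab a b + (Cab a b^2 * e) * Lab a b * Q / 2 := by gcongr
    _ ≤ (Cab a b^2 * e) * Lab a b + (Cab a b^2 * e) * Lab a b * Q := by
      have : 0 ≤ (Cab a b^2 * e) * Lab a b * Q := by positivity
      linarith
    _ = _ := by ring

def ux (m : ℤ) (s x : ℝ) : ℝ :=
  (gp1 s x * gp s (x-m) + gp s x * gp1 s (x-m)) / th s x - gp s x * gp s (x-m) * th1 s x / (th s x)^2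

lemma ux_hasDeriv {s : ℝ} (hs : 0 < s) (m : ℤ) (x : ℝ) :
    HasDerivAt (ux m s) (2 * (Fs' m s x + th s x * (pr1 s 0 x * pr1 s m x))) x := by
  have ht := (th_pos hs x).ne'
  have a0 := gp_hasDeriv (s := s) x
  have a1 := gp1_hasDeriv (s := s) x
  have b0 := (gp_hasDeriv (s := s) (x-m)).comp_sub_const x m
  have b1 := (gp1_hasDeriv (s := s) (x-m)).comp_sub_const x m
  have t0 := th_hasDeriv hs x
  have t1 := th1_hasDeriv hs x
  have h := (((a1.mul b0).add (a0.mul b1)).div t0 ht).sub (((a0.mul b0).mul t1).div (t0.pow 2) (by simpa using ht))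
  refine h.congr_deriv ?_
  simp only [Pi.mul_apply, Pi.add_apply, Pi.pow_apply]
  unfold Fs' pr1 pr gp2 gp1
  simp only [Int.cast_zero, sub_zero]
  field_simp
  ring

lemma ux_integrable {s : ℝ} (hs : 0 < s) (m : ℤ) : Integrable (ux m s) := by
  have hc : Continuous (ux m s) := continuous_iff_continuousAt.2 fun x => (ux_hasDeriv hs m x).continuousAt
  refine (integrable_exp_abs.const_mul (2 * (Kab s s * (Lab s s * Cab s s) + Cab s s * (Lab s s * Kab s s)))).mono' hc.aestronglyMeasurable (ae_of_all _ fun x => ?_)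
  have ht := th_pos hs x
  have e : ux m s x = (th s x * pr1 s 0 x) * ((th s x)⁻¹ * gp s (x-m)) + gp s x * ((th s x)⁻¹ * (th s x * pr1 s m x)) + gp s x * ((th s x)⁻¹ * (gp s (x-m) * (th1 s x / th s x))) := by
    unfold ux pr1 pr gp1; simp only [Int.cast_zero, sub_zero]; field_simp; ring
  have e2 : gp s (x-m) * (th1 s x / th s x) = gp1 s (x-m) - th s x * pr1 s m x := by
    unfold pr1 pr gp1; field_simp; ring
  have k0 := gpL_le hs le_rfl le_rfl 0 x
  have k1 := gpL_le hs le_rfl le_rfl m x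
  obtain ⟨-, g0, -, -⟩ := gp_bound hs le_rfl le_rfl x
  obtain ⟨-, g0', g1', -⟩ := gp_bound hs le_rfl le_rfl (x-m)
  have hi := th_inv_le hs le_rfl le_rfl x
  have hm := exp_abs_le_one (x-m)
  have hC := (Cab_pos (b := s) hs).le
  have hK := (Kab_nonneg (b := s) hs)
  have hLn := Lab_nonneg (a := s) (b := s)
  have hL := (L_le hs le_rfl le_rfl x).1
  have hE := E0_nonneg
  have hKC : Cab s s * (Cab s s * (Real.exp 1 * E0) * Lab s s) ≤ Kab s s := by
    have : Kab s s = Cab s s * (1 + Cab s s * (Real.exp 1 * E0) * Lab s s) := rfl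
    rw [this]; nlinarith
  have p0 := gp_pos hs x
  have p1 := gp_pos hs (x-m)
  simp only [Int.cast_zero, sub_zero] at k0
  set ex := Real.exp (-|x|)
  have he : 0 < ex := Real.exp_pos _
  have hc2 : gp s (x-m) ≤ Cab s s := g0'.trans (mul_le_of_le_one_right hC hm)
  have hk1 : |th s x * pr1 s m x| ≤ Kab s s := k1.trans (mul_le_of_le_one_right hK hm)
  have hk2 : |gp s (x-m) * (th1 s x / th s x)| ≤ Kab s s := by
    rw [abs_mul, abs_of_pos p1]
    refine (mul_le_mul hc2 hL (abs_nonneg _) hC).trans hKC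
  rw [Real.norm_eq_abs, e]
  refine (abs_add_three _ _ _).trans ?_
  rw [abs_mul, abs_mul (gp s x), abs_mul (gp s x), abs_mul (th s x)⁻¹, abs_mul (th s x)⁻¹, abs_mul (th s x)⁻¹, abs_of_pos (inv_pos.2 ht), abs_of_pos p0, abs_of_pos p1]
  calc _ ≤ (Kab s s * ex) * (Lab s s * Cab s s) + (Cab s s * ex) * (Lab s s * Kab s s) + (Cab s s * ex) * (Lab s s * Kab s s) := by
        gcongr
    _ ≤ _ := by
      have : 0 ≤ (Kab s s * ex) * (Lab s s * Cab s s) := by positivity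
      linarith

lemma Fs_eq {s : ℝ} (hs : 0 < s) (m : ℤ) (x : ℝ) : Fs m s x = th s x * (pr s 0 x * pr s m x) := by
  rw [u_eq hs]; unfold Fs pr; ring

lemma ee_hasDeriv {s : ℝ} (hs : 0 < s) (m : ℤ) : HasDerivAt (fun s => ee s m) (-ep s m) s := by
  have hm : ∀ s, 0 < s → Measurable (Fs' m s) := by
    intro s hs
    have a := (gp2_cont (s := s)).measurable
    have b := (gp_cont (s := s)).measurable
    have c := (th_cont hs).measurable
    have d := th2_meas hs
    have a' := a.comp (measurable_id.sub_const (m:ℝ))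
    have b' := b.comp (measurable_id.sub_const (m:ℝ))
    exact ((((a.div_const 2).mul b').add (b.mul (a'.div_const 2))).div c).sub ((((b.mul b').div c).mul (d.div c)).div_const 2)
  have hF : ∀ s, 0 < s → ∀ x, Fs m s x = th s x * (pr s 0 x * pr s m x) := fun s hs x => Fs_eq hs m x
  have h := hasDerivAt_integral_of_dominated_loc_of_deriv_le (F := Fs m) (F' := Fs' m) (x₀ := s) (μ := volume)
    (s := Set.Ioo (s/2) (2*s)) (bound := fun x => Cab (s/2) (2*s)^2 * Lab (s/2) (2*s) * (1 + Cab (s/2) (2*s) * (Real.exp 1 * E0) * Lab (s/2) (2*s)) * Real.exp (-|x|))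
    (Ioo_mem_nhds (by linarith) (by linarith)) (by
      filter_upwards [Ioi_mem_nhds hs] with t ht
      have ht : 0 < t := ht
      have : Fs m t = fun x => th t x * (pr t 0 x * pr t m x) := by ext x; exact hF t ht x
      rw [this]
      exact (eei_integrable ht 0 m).aestronglyMeasurable) (by
      have : Fs m s = fun x => th s x * (pr s 0 x * pr s m x) := by ext x; exact hF s hs x
      rw [this]
      exact eei_integrable hs 0 m) (hm s hs).aestronglyMeasurable
    (ae_of_all _ fun x t ht => Fs'_bound (by linarith) ht.1.le ht.2.le m x)
    (integrable_exp_abs.const_mul _)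
    (ae_of_all _ fun x t ht => Fs_hasDeriv (by linarith [ht.1]) m x)
  have h2 : ∫ x, Fs' m s x = -ep s m := by
    have hz := integral_eq_zero_of_hasDerivAt_of_integrable (ux_hasDeriv hs m)
      ((h.1.add (epi_integrable hs 0 m)).const_mul 2) (ux_integrable hs m)
    rw [integral_const_mul, integral_add h.1 (epi_integrable hs 0 m)] at hz
    unfold ep; linarith
  rw [← h2]
  refine h.2.congr_of_eventuallyEq ?_
  filter_upwards [Ioi_mem_nhds hs] with t ht
  unfold ee
  congr 1; ext x; exact (hF t ht x).symm

lemma gp_half {s : ℝ} (hs : 0 < s) {a v : ℝ} (h : a^2/4 ≤ v^2) :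
    gp s v ≤ Real.exp (-a^2/(16*s)) * (√2 * gp (2*s) v) := by
  unfold gp
  have e1 : √(2*π*(2*s)) = √2 * √(2*π*s) := by
    rw [← Real.sqrt_mul (by norm_num)]; congr 1; ring
  rw [e1]
  have e2 : √2 * ((√2 * √(2*π*s))⁻¹ * Real.exp (-v^2/(2*(2*s)))) = (√(2*π*s))⁻¹ * Real.exp (-v^2/(2*(2*s))) := by
    have : √2 ≠ 0 := by positivity
    field_simp
  rw [e2, mul_left_comm]
  gcongr
  rw [← Real.exp_add]
  apply Real.exp_le_exp.2
  have : -v^2/(2*s) = -v^2/(4*s) + -v^2/(2*(2*s)) := by field_simp; ring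
  rw [this]
  have : -v^2/(4*s) ≤ -a^2/(16*s) := by
    rw [div_le_div_iff₀ (by positivity) (by positivity)]; nlinarith
  linarith

lemma ee_le {s : ℝ} (hs : 0 < s) (m : ℤ) : ee s m ≤ 3 * Real.exp (-(m:ℝ)^2/(16*s)) := by
  have h2s : 0 < 2*s := by positivity
  rw [ee_eq hs]
  have hpt : ∀ x, gp s x * pr s m x ≤ Real.exp (-(m:ℝ)^2/(16*s)) * √2 * (gp (2*s) x + gp (2*s) (x-m)) := by
    intro x
    have q0 := gp_pos h2s x
    have q1 := gp_pos h2s (x-m)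
    have hh : 0 < Real.exp (-(m:ℝ)^2/(16*s)) * √2 := by positivity
    rcases le_or_gt ((m:ℝ)^2/4) (x^2) with h | h
    · have k := gp_half hs h
      have : gp s x * pr s m x ≤ gp s x := mul_le_of_le_one_right (gp_pos hs x).le (pr_le_one hs m x)
      nlinarith
    · have h' : (m:ℝ)^2/4 ≤ (x-m)^2 := by
        have h1 : |x| < |(m:ℝ)/2| := by apply sq_lt_sq.1; nlinarith
        have h2 : |(m:ℝ)/2| ≤ |x - m| := by
          have := abs_sub_abs_le_abs_sub (m:ℝ) x
          rw [abs_sub_comm] at this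
          rw [abs_div, abs_two] at h1 ⊢; linarith
        have := sq_le_sq.2 h2
        nlinarith
      have k := gp_half hs h'
      have : gp s x * pr s m x ≤ gp s (x-m) := by
        rw [← u_eq hs, u_eq' hs]
        exact mul_le_of_le_one_left (gp_pos hs _).le (pr_le_one hs 0 x)
      nlinarith
  have hi := ((gp_integrable h2s).add (gp_shift_integrable h2s m)).const_mul (Real.exp (-(m:ℝ)^2/(16*s)) * √2)
  refine (integral_mono (u_integrable hs m) hi hpt).trans ?_
  simp only [Pi.add_apply]
  rw [integral_const_mul, integral_add (gp_integrable h2s) (gp_shift_integrable h2s m), gp_integral h2s, gp_shift_integral h2s]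
  have : √2 ≤ 3/2 := by rw [Real.sqrt_le_left (by norm_num)]; norm_num
  nlinarith [Real.exp_pos (-(m:ℝ)^2/(16*s))]

lemma exp_neg_le1 {v : ℝ} (hv : 0 < v) : Real.exp (-v) ≤ 1/v := by
  rw [Real.exp_neg, ← one_div]
  apply one_div_le_one_div_of_le hv
  linarith [Real.add_one_le_exp v]

lemma exp_neg_le2 {v : ℝ} (hv : 0 < v) : Real.exp (-v) ≤ 2/v^2 := by
  rw [Real.exp_neg, show 2/v^2 = (v^2/2)⁻¹ by rw [inv_div]]
  apply inv_anti₀ (by positivity)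
  linarith [Real.quadratic_le_exp_of_nonneg hv.le]

lemma ee_small {s : ℝ} (hs : 0 < s) {m : ℤ} (hm : m ≠ 0) : ee s m ≤ 48 * s * (1/(m:ℝ)^2) := by
  have hm' : (m:ℝ) ≠ 0 := by exact_mod_cast hm
  refine (ee_le hs m).trans ?_
  have hv : 0 < (m:ℝ)^2/(16*s) := by positivity
  have := exp_neg_le1 hv
  rw [neg_div]
  calc _ ≤ 3 * (1/((m:ℝ)^2/(16*s))) := by gcongr
    _ = _ := by field_simp; ring

def Z2 : ℝ := ∑' n : ℤ, 1/(n:ℝ)^2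
lemma Z2_summable : Summable (fun n : ℤ => 1/(n:ℝ)^2) := Real.summable_one_div_int_pow.2 (by norm_num)
lemma Z2_nonneg : 0 ≤ Z2 := tsum_nonneg fun _ => by positivity

lemma ee_zero_ge {s : ℝ} (hs : 0 < s) : 1 - 48 * s * Z2 ≤ ee s 0 := by
  have h := (ee_hasSum hs)
  have h2 : HasSum (fun m : ℤ => if m = 0 then ee s 0 else 48 * s * (1/(m:ℝ)^2)) (ee s 0 + 48 * s * Z2) := by
    have := (hasSum_ite_eq (0:ℤ) (ee s 0)).add (Z2_summable.hasSum.mul_left (48*s))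
    refine HasSum.congr_fun this fun m => ?_
    by_cases hm : m = 0 <;> simp [hm]
  have := hasSum_le (fun m => ?_) h h2
  · linarith
  · split_ifs with hm
    · rw [hm]
    · exact ee_small hs hm

lemma mom_hasSum {s : ℝ} (hs : 0 < s) (x : ℝ) :
    HasSum (fun m : ℤ => pr s m x * ((m:ℝ)/s)) (th1 s x / th s x + x/s) ∧
    HasSum (fun m : ℤ => pr s m x * ((m:ℝ)/s)^2) ((x/s)^2 + 2*(x/s)*(th1 s x / th s x) + th2 s x / th s x + 1/s) := by
  have ht := (th_pos hs x).ne'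
  have h0 := pr_hasSum hs x
  have h1 := (gp1_summable hs x).hasSum.div_const (th s x)
  have h2 := (gp2_summable hs x).hasSum.div_const (th s x)
  rw [show (∑' n : ℤ, gp1 s (x - n)) = th1 s x from rfl] at h1
  rw [show (∑' n : ℤ, gp2 s (x - n)) = th2 s x from rfl] at h2
  constructor
  · have := h1.add (h0.mul_left (x/s))
    rw [mul_one] at this
    refine HasSum.congr_fun this fun m => ?_
    unfold pr gp1; field_simp; ring
  · have := ((h0.mul_left ((x/s)^2)).add (h1.mul_left (2*(x/s)))).add (h2.add (h0.mul_left (1/s)))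
    simp only [mul_one] at this
    rw [show (x/s)^2 + 2*(x/s)*(th1 s x / th s x) + th2 s x / th s x + 1/s = (x/s)^2 + 2*(x/s)*(th1 s x / th s x) + (th2 s x / th s x + 1/s) by ring]
    refine HasSum.congr_fun this fun m => ?_
    unfold pr gp1 gp2; field_simp; ring

end Th
end
end

section
open MeasureTheory Real Filter
noncomputable section
namespace Th

lemma sum_int_le0 {T : Finset ℤ} {u : ℤ → ℝ → ℝ} {h : ℝ → ℝ}
    (hu : ∀ m, Integrable (u m)) (hh : Integrable h)
    (hb : ∀ x, ∑ m ∈ T, |u m x| ≤ h x) : ∑ m ∈ T, ∫ x, |u m x| ≤ ∫ x, h x := by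
  rw [← integral_finsetSum _ fun m _ => (hu m).abs]
  exact integral_mono (integrable_finsetSum _ fun m _ => (hu m).abs) hh hb

lemma sum_int_le {T : Finset ℤ} {a : ℤ → ℝ} {u : ℤ → ℝ → ℝ} {h : ℝ → ℝ}
    (hu : ∀ m, Integrable (u m)) (ha : ∀ m, a m = ∫ x, u m x) (hh : Integrable h)
    (hb : ∀ x, ∑ m ∈ T, |u m x| ≤ h x) : ∑ m ∈ T, |a m| ≤ ∫ x, h x := by
  calc _ ≤ ∑ m ∈ T, ∫ x, |u m x| := Finset.sum_le_sum fun m _ => by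
        rw [ha m]; exact abs_integral_le_integral_abs
    _ ≤ _ := sum_int_le0 hu hh hb

def D0 : ℝ := 768 * Z2
lemma D0_nonneg : 0 ≤ D0 := by unfold D0; have := Z2_nonneg; positivity

lemma ee_mom_le {s : ℝ} (hs : 0 < s) (m : ℤ) : ((m:ℝ)/s)^2 * ee s m ≤ 1536 * (1/(m:ℝ)^2) := by
  rcases eq_or_ne m 0 with rfl | hm
  · simp
  have hm' : (0:ℝ) < (m:ℝ)^2 := by positivity
  have h1 := ee_le hs m
  have h2 := exp_neg_le2 (v := (m:ℝ)^2/(16*s)) (by positivity)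
  rw [neg_div] at h1
  calc _ ≤ ((m:ℝ)/s)^2 * (3 * (2/((m:ℝ)^2/(16*s))^2)) := by gcongr; linarith
    _ = _ := by field_simp; norm_num

lemma ep_l10 {s : ℝ} (hs : 0 < s) (T : Finset ℤ) : ∑ m ∈ T, ∫ x, |th s x * (pr1 s 0 x * pr1 s m x)| ≤ D0 := by
  set B : ℝ → ℝ := fun x => gp s x * (∑' m : ℤ, pr s m x * ((m:ℝ)/s)^2) with hB
  have hBe : B = fun x => gp s x * ((x/s)^2 + 2*(x/s)*(th1 s x / th s x) + th2 s x / th s x + 1/s) := by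
    funext x; simp only [hB]; rw [(mom_hasSum hs x).2.tsum_eq]
  have hBm : Measurable B := by
    rw [hBe]
    have h1 := (th1_cont hs).measurable
    have h2 := th2_meas hs
    have h3 := (th_cont hs).measurable
    have h4 := (gp_cont (s := s)).measurable
    fun_prop
  have hB0 : ∀ x, 0 ≤ B x := fun x => mul_nonneg (gp_pos hs x).le
    (tsum_nonneg fun m => mul_nonneg (pr_nonneg hs m x) (sq_nonneg _))
  have hsum : Summable (fun m : ℤ => ((m:ℝ)/s)^2 * ee s m) :=
    Summable.of_nonneg_of_le (fun m => mul_nonneg (sq_nonneg _) (ee_nonneg hs m)) (ee_mom_le hs)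
      (Z2_summable.mul_left _)
  have hl : ∫⁻ x, ENNReal.ofReal (B x) ≤ ENNReal.ofReal (1536 * Z2) := by
    have : ∀ x, ENNReal.ofReal (B x) = ∑' m : ℤ, ENNReal.ofReal (((m:ℝ)/s)^2 * (gp s x * pr s m x)) := by
      intro x
      rw [← ENNReal.ofReal_tsum_of_nonneg]
      · simp only [hB]; rw [← tsum_mul_left]; congr 2; ext m; ring
      · intro m; exact mul_nonneg (sq_nonneg _) (mul_nonneg (gp_pos hs x).le (pr_nonneg hs m x))
      · refine ((mom_hasSum hs x).2.summable.mul_left (gp s x)).congr fun m => ?_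
        ring
    simp_rw [this]
    rw [lintegral_tsum (fun m => by
      have := ((gp_cont (s := s)).measurable.mul (pr_cont hs m).measurable).const_mul (((m:ℝ)/s)^2)
      exact this.ennreal_ofReal.aemeasurable)]
    have : ∀ m : ℤ, ∫⁻ x, ENNReal.ofReal (((m:ℝ)/s)^2 * (gp s x * pr s m x)) = ENNReal.ofReal (((m:ℝ)/s)^2 * ee s m) := by
      intro m
      rw [ee_eq hs, ← integral_const_mul, ofReal_integral_eq_lintegral_ofReal ((u_integrable hs m).const_mul _)]
      exact ae_of_all _ fun x => mul_nonneg (sq_nonneg _) (mul_nonneg (gp_pos hs x).le (pr_nonneg hs m x))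
    simp_rw [this]
    rw [← ENNReal.ofReal_tsum_of_nonneg (fun m => mul_nonneg (sq_nonneg _) (ee_nonneg hs m)) hsum]
    apply ENNReal.ofReal_le_ofReal
    rw [Z2, ← tsum_mul_left]
    exact hsum.tsum_le_tsum (ee_mom_le hs) (Z2_summable.mul_left _)
  have hBi : Integrable B := by
    refine ⟨hBm.aestronglyMeasurable, ?_⟩
    rw [hasFiniteIntegral_iff_ofReal (ae_of_all _ hB0)]
    exact hl.trans_lt ENNReal.ofReal_lt_top
  have hBint : ∫ x, B x ≤ 1536 * Z2 := by
    rw [integral_eq_lintegral_of_nonneg_ae (ae_of_all _ hB0) hBi.1]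
    exact ENNReal.toReal_le_of_le_ofReal (by have := Z2_nonneg; positivity) hl
  have := sum_int_le0 (T := T) (fun m => epi_integrable hs 0 m) (hBi.const_mul (1/2)) (fun x => ?_)
  · rw [integral_const_mul] at this
    unfold D0; linarith
  · obtain ⟨m1, m2⟩ := mom_hasSum hs x
    set c := th1 s x / th s x + x/s with hc
    have ht := th_pos hs x
    have hs3 : HasSum (fun m : ℤ => pr s m x * (c^2 + ((m:ℝ)/s - c)^2)) (∑' m : ℤ, pr s m x * ((m:ℝ)/s)^2) := by
      have h := (((pr_hasSum hs x).mul_left (2*c^2)).add (m1.mul_left (-(2*c)))).add m2.summable.hasSum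
      rw [show 2*c^2*1 + -(2*c)*c + (∑' m : ℤ, pr s m x * ((m:ℝ)/s)^2) = ∑' m : ℤ, pr s m x * ((m:ℝ)/s)^2 by ring] at h
      refine h.congr_fun fun m => ?_
      ring
    have hle : ∑ m ∈ T, pr s m x * (c^2 + ((m:ℝ)/s - c)^2) ≤ ∑' m : ℤ, pr s m x * ((m:ℝ)/s)^2 :=
      sum_le_hasSum _ (fun m _ => mul_nonneg (pr_nonneg hs m x) (by positivity)) hs3
    have hg := gp_pos hs x
    calc _ ≤ ∑ m ∈ T, 1/2 * (gp s x * (pr s m x * (c^2 + ((m:ℝ)/s - c)^2))) := by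
          refine Finset.sum_le_sum fun m _ => ?_
          have he : th s x * (pr1 s 0 x * pr1 s m x) = gp s x * pr s m x * (-c * ((m:ℝ)/s - c)) := by
            unfold pr1 pr; rw [hc]; simp only [Int.cast_zero, sub_zero]; field_simp; ring
          rw [he, abs_mul, abs_of_nonneg (mul_nonneg hg.le (pr_nonneg hs m x))]
          have : |-c * ((m:ℝ)/s - c)| ≤ 1/2 * (c^2 + ((m:ℝ)/s - c)^2) := by
            rw [abs_le]; constructor <;> nlinarith [sq_nonneg (c + ((m:ℝ)/s - c)), sq_nonneg (c - ((m:ℝ)/s - c))]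
          calc _ ≤ gp s x * pr s m x * (1/2 * (c^2 + ((m:ℝ)/s - c)^2)) :=
                mul_le_mul_of_nonneg_left this (mul_nonneg hg.le (pr_nonneg hs m x))
            _ = _ := by ring
      _ ≤ _ := by
          rw [← Finset.mul_sum, ← Finset.mul_sum]
          exact mul_le_mul_of_nonneg_left (mul_le_mul_of_nonneg_left hle hg.le) (by norm_num)

lemma ep_l1 {s : ℝ} (hs : 0 < s) (T : Finset ℤ) : ∑ m ∈ T, |ep s m| ≤ D0 :=
  (Finset.sum_le_sum fun m _ => abs_integral_le_integral_abs).trans (ep_l10 hs T)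

lemma ep_le {s : ℝ} (hs : 0 < s) (m : ℤ) : |ep s m| ≤ D0 := by
  simpa using ep_l1 hs {m}

/-- total variation comparison of sum and integral -/
lemma tv_sum {g g' : ℝ → ℝ} (hg : ∀ x, HasDerivAt g (g' x) x) (hc : Continuous g') (hi : Integrable g)
    (hi' : Integrable g') (hsum : Summable (fun n : ℤ => g n)) :
    |∑' n : ℤ, g n - ∫ x, g x| ≤ ∫ x, |g' x| := by
  have h1 := hi.hasSum_intervalIntegral 0
  have h2 := hi'.abs.hasSum_intervalIntegral 0
  have hgc : Continuous g := continuous_iff_continuousAt.2 fun x => (hg x).continuousAt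
  have hk : ∀ n : ℤ, |g n - ∫ x in (0 + (n:ℝ))..(0 + (n:ℝ) + 1), g x| ≤ ∫ x in (0+(n:ℝ))..(0+(n:ℝ)+1), |g' x| := by
    intro n
    rw [zero_add]
    have : g n - ∫ x in (n:ℝ)..(n+1), g x = ∫ x in (n:ℝ)..(n+1), (g n - g x) := by
      rw [intervalIntegral.integral_sub (by simp) (hgc.intervalIntegrable _ _)]; simp
    rw [this]
    have := intervalIntegral.norm_integral_le_of_norm_le_const (a := (n:ℝ)) (b := n+1) (f := fun x => g n - g x)
      (C := ∫ x in (n:ℝ)..(n+1), |g' x|) (fun x hx => ?_)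
    · rw [Real.norm_eq_abs, add_sub_cancel_left, abs_one, mul_one] at this
      exact this
    rw [Set.uIoc_of_le (by linarith)] at hx
    have e : g x - g n = ∫ y in (n:ℝ)..x, g' y :=
      (intervalIntegral.integral_eq_sub_of_hasDerivAt (fun y _ => hg y) (hc.intervalIntegrable _ _)).symm
    rw [norm_sub_rev, e]
    calc _ ≤ ∫ y in (n:ℝ)..x, |g' y| := intervalIntegral.norm_integral_le_integral_norm (f := g') hx.1.le
      _ ≤ _ := intervalIntegral.integral_mono_interval le_rfl hx.1.le hx.2 (ae_of_all _ fun _ => abs_nonneg _)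
          (hc.abs.intervalIntegrable _ _)
  have h3 := hsum.hasSum.sub h1
  rw [← h3.tsum_eq, ← h2.tsum_eq]
  have hs' := Summable.of_nonneg_of_le (fun n => abs_nonneg _) hk h2.summable
  have := norm_tsum_le_tsum_norm (f := fun n : ℤ => g n - ∫ x in (0 + (n:ℝ))..(0 + (n:ℝ) + 1), g x) hs'
  rw [Real.norm_eq_abs] at this
  exact this.trans (Summable.tsum_le_tsum hk hs' h2.summable)

lemma tv_diff {g g' : ℝ → ℝ} (hg : ∀ x, HasDerivAt g (g' x) x) (hc : Continuous g')
    (hi' : Integrable g') (T : Finset ℤ) :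
    ∑ n ∈ T, |g ((n+1 : ℤ)) - g n| ≤ ∫ x, |g' x| := by
  have h2 := hi'.abs.hasSum_intervalIntegral 0
  refine le_trans (Finset.sum_le_sum fun n _ => ?_) (sum_le_hasSum T (fun n _ => ?_) h2)
  · have e : g ((n+1:ℤ)) - g n = ∫ y in (0+(n:ℝ))..(0+(n:ℝ)+1), g' y := by
      rw [zero_add, (intervalIntegral.integral_eq_sub_of_hasDerivAt (fun y _ => hg y) (hc.intervalIntegrable _ _))]
      push_cast; rfl
    rw [e]
    rw [← Real.norm_eq_abs]
    exact intervalIntegral.norm_integral_le_integral_norm (f := g') (by linarith)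
  · exact intervalIntegral.integral_nonneg (by linarith) fun _ _ => abs_nonneg _

end Th
end
end

section
open MeasureTheory Real Filter
noncomputable section
namespace Th

lemma gp_mul {s r : ℝ} (hs : 0 < s) (hr : 0 < r) (x y : ℝ) :
    gp s y * gp r (x - y) = gp (s+r) x * gp (s*r/(s+r)) (y - s*x/(s+r)) := by
  unfold gp
  have h1 : (√(2*π*s))⁻¹ * (√(2*π*r))⁻¹ = (√(2*π*(s+r)))⁻¹ * (√(2*π*(s*r/(s+r))))⁻¹ := by
    rw [← mul_inv, ← mul_inv, ← Real.sqrt_mul (by positivity), ← Real.sqrt_mul (by positivity)]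
    congr 2; field_simp
  calc _ = ((√(2*π*s))⁻¹ * (√(2*π*r))⁻¹) * (Real.exp (-y^2/(2*s)) * Real.exp (-(x-y)^2/(2*r))) := by ring
    _ = ((√(2*π*(s+r)))⁻¹ * (√(2*π*(s*r/(s+r))))⁻¹) * (Real.exp (-x^2/(2*(s+r))) * Real.exp (-(y-s*x/(s+r))^2/(2*(s*r/(s+r))))) := by
        rw [h1, ← Real.exp_add, ← Real.exp_add]
        congr 2; field_simp; ring
    _ = _ := by ring

lemma gp_conv {s r : ℝ} (hs : 0 < s) (hr : 0 < r) (x : ℝ) :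
    Integrable (fun y => gp s y * gp r (x - y)) ∧ ∫ y, gp s y * gp r (x - y) = gp (s+r) x := by
  have : (fun y => gp s y * gp r (x - y)) = fun y => gp (s+r) x * gp (s*r/(s+r)) (y - s*x/(s+r)) :=
    funext fun y => gp_mul hs hr x y
  rw [this]
  exact ⟨(gp_shift_integrable (by positivity) _).const_mul _, by
    rw [integral_const_mul, gp_shift_integral (by positivity), mul_one]⟩

lemma gp_conv_shift {s r : ℝ} (hs : 0 < s) (hr : 0 < r) (x m : ℝ) :
    Integrable (fun y => gp s (y-m) * gp r (x - y)) ∧ ∫ y, gp s (y-m) * gp r (x - y) = gp (s+r) (x-m) := by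
  have h := gp_conv hs hr (x-m)
  have e : (fun y => gp s (y-m) * gp r (x - y)) = fun y => (fun y => gp s y * gp r (x-m-y)) (y-m) := by
    funext y; simp only; congr 2; ring
  rw [e]
  exact ⟨h.1.comp_sub_right m, by rw [integral_sub_right_eq_self (fun y => gp s y * gp r (x-m-y)), h.2]⟩

lemma gp1_integrable {s : ℝ} (hs : 0 < s) : Integrable (gp1 s) :=
  (integrable_exp_abs.const_mul (Cab s s)).mono' gp1_cont.aestronglyMeasurable
    (ae_of_all _ fun x => (gp_bound hs le_rfl le_rfl x).2.2.1)
lemma gp2_integrable {s : ℝ} (hs : 0 < s) : Integrable (gp2 s) :=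
  (integrable_exp_abs.const_mul (Cab s s)).mono' gp2_cont.aestronglyMeasurable
    (ae_of_all _ fun x => (gp_bound hs le_rfl le_rfl x).2.2.2)
lemma gp1_integral {s : ℝ} (hs : 0 < s) : ∫ x, gp1 s x = 0 :=
  integral_eq_zero_of_hasDerivAt_of_integrable (fun x => gp_hasDeriv x) (gp1_integrable hs) (gp_integrable hs)
lemma gp2_integral {s : ℝ} (hs : 0 < s) : ∫ x, gp2 s x = 0 :=
  integral_eq_zero_of_hasDerivAt_of_integrable (fun x => gp1_hasDeriv x) (gp2_integrable hs) (gp1_integrable hs)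

lemma ee0_eq {s : ℝ} (hs : 0 < s) (m : ℤ) : Integrable (fun x => gp s x * gp s (x-m)) ∧
    ∫ x, gp s x * gp s (x-m) = gp (2*s) m := by
  have h := gp_conv hs hs (m:ℝ)
  have e : (fun x => gp s x * gp s (x-m)) = fun x => gp s x * gp s (m-x) := by
    funext x; rw [← gp_neg s (x-m), neg_sub]
  rw [e, two_mul]; exact h

lemma ep0_eq {s : ℝ} (hs : 0 < s) (m : ℤ) : Integrable (fun x => gp1 s x * gp1 s (x-m)) ∧
    ∫ x, gp1 s x * gp1 s (x-m) = -gp2 (2*s) m := by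
  have e : (fun x => gp1 s x * gp1 s (x-m)) = fun x => (gp (2*s) m/4) * gp2 (s/2) (x - m/2) +
      (gp (2*s) m * (1/(2*s) - (m:ℝ)^2/(4*s^2))) * gp (s/2) (x - m/2) := by
    funext x
    have := gp_mul hs hs (m:ℝ) x
    rw [← gp_neg s (m-x), neg_sub, ← two_mul, show s*s/(2*s) = s/2 by field_simp, show s*m/(2*s) = (m:ℝ)/2 by field_simp] at this
    have h2 : gp1 s x * gp1 s (x-m) = (x*(x-m)/s^2) * (gp s x * gp s (x-m)) := by unfold gp1; field_simp
    rw [h2, this]; unfold gp2; field_simp; ring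
  have i1 := ((gp2_integrable (s := s/2) (by positivity)).comp_sub_right ((m:ℝ)/2)).const_mul (gp (2*s) m/4)
  have i2 := (gp_shift_integrable (s := s/2) (by positivity) ((m:ℝ)/2)).const_mul (gp (2*s) m * (1/(2*s) - (m:ℝ)^2/(4*s^2)))
  rw [e]
  refine ⟨i1.add i2, ?_⟩
  rw [integral_add i1 i2, integral_const_mul, integral_const_mul, integral_sub_right_eq_self (gp2 (s/2)),
    gp2_integral (by positivity), gp_shift_integral (by positivity)]
  unfold gp2; field_simp; ring

lemma gp_dbl {s : ℝ} (hs : 0 < s) (v : ℝ) : gp s v = √2 * (gp (2*s) v * Real.exp (-v^2/(4*s))) := by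
  have h1 : √(2*π*(2*s)) = √2 * √(2*π*s) := by
    rw [show 2*π*(2*s) = 2*(2*π*s) by ring, Real.sqrt_mul (by norm_num)]
  have h2 : (0:ℝ) < √2 := by positivity
  have h3 : 0 < √(2*π*s) := by positivity
  have h4 : Real.exp (-v^2/(2*s)) = Real.exp (-v^2/(2*(2*s))) * Real.exp (-v^2/(4*s)) := by
    rw [← Real.exp_add]; congr 1; field_simp; ring
  unfold gp
  rw [h1, h4]
  generalize √(2*π*s) = a at *
  field_simp

lemma gp12_le {s : ℝ} (hs : 0 < s) (v : ℝ) : |gp1 s v| ≤ 2*(√s)⁻¹ * gp (2*s) v ∧ |gp2 s v| ≤ 6*(√s)⁻¹^2 * gp (2*s) v := by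
  have hq : √s^2 = s := Real.sq_sqrt hs.le
  have hqp : 0 < √s := Real.sqrt_pos.2 hs
  set q := √s
  have hg := gp_pos hs v
  have hG := gp_pos (s := 2*s) (by positivity) v
  obtain ⟨u, hu⟩ : ∃ u, v = u * q := ⟨v/q, by field_simp⟩
  have h2 : √2 ≤ 3/2 := by rw [Real.sqrt_le_left (by norm_num)]; norm_num
  have hexp : Real.exp (-v^2/(4*s)) * (1 + u^2/4) ≤ 1 := by
    have : -v^2/(4*s) = -(u^2/4) := by rw [hu, ← hq]; field_simp
    rw [this, Real.exp_neg, inv_mul_le_iff₀ (Real.exp_pos _), mul_one]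
    linarith [Real.add_one_le_exp (u^2/4)]
  have hE := Real.exp_pos (-v^2/(4*s))
  set E := Real.exp (-v^2/(4*s))
  have key : ∀ w c : ℝ, w ≤ c * (1+u^2/4) → 0 ≤ c → w * gp s v ≤ (3/2*c) * gp (2*s) v := by
    intro w c hw hc
    rw [gp_dbl hs]
    calc w * (√2 * (gp (2*s) v * E)) ≤ (c * (1+u^2/4)) * (√2 * (gp (2*s) v * E)) := by gcongr
      _ = √2 * c * gp (2*s) v * (E * (1+u^2/4)) := by ring
      _ ≤ 3/2 * c * gp (2*s) v * 1 := by gcongr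
      _ = _ := by ring
  constructor
  · have : |gp1 s v| = (|u| * q⁻¹) * gp s v := by
      unfold gp1; rw [abs_mul, abs_neg, abs_of_pos hg, hu, ← hq, abs_div, abs_mul, abs_of_pos hqp, abs_of_pos (by positivity : 0 < q^2)]
      field_simp
    rw [this]
    refine (key _ (q⁻¹) ?_ (by positivity)).trans ?_
    · rw [mul_comm]; gcongr
      nlinarith [sq_nonneg (|u|-2), sq_abs u]
    · gcongr; linarith [inv_pos.2 hqp]
  · have : |gp2 s v| = (|u^2-1| * q⁻¹^2) * gp s v := by
      unfold gp2; rw [abs_mul, abs_of_pos hg, hu, ← hq]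
      rw [show (u*q)^2/(q^2)^2 - 1/q^2 = (u^2-1) * q⁻¹^2 by field_simp, abs_mul, abs_of_pos (by positivity : 0 < q⁻¹^2)]
    rw [this]
    refine (key _ (4*q⁻¹^2) ?_ (by positivity)).trans ?_
    · rw [mul_comm, mul_assoc 4, mul_left_comm]; gcongr
      rw [abs_le]; constructor <;> nlinarith [sq_nonneg u]
    · apply le_of_eq; ring

lemma gp12_int {s : ℝ} (hs : 0 < s) : ∫ x, |gp1 s x| ≤ 2*(√s)⁻¹ ∧ ∫ x, |gp2 s x| ≤ 6*(√s)⁻¹^2 := by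
  have h2 : (0:ℝ) < 2*s := by positivity
  constructor
  · have := integral_mono (gp1_integrable hs).abs ((gp_integrable h2).const_mul (2*(√s)⁻¹)) (fun v => (gp12_le hs v).1)
    rwa [integral_const_mul, gp_integral h2, mul_one] at this
  · have := integral_mono (gp2_integrable hs).abs ((gp_integrable h2).const_mul (6*(√s)⁻¹^2)) (fun v => (gp12_le hs v).2)
    rwa [integral_const_mul, gp_integral h2, mul_one] at this

lemma th_near {s : ℝ} (hs : 0 < s) (x : ℝ) : |th s x - 1| ≤ 2*(√s)⁻¹ ∧ |th1 s x| ≤ 6*(√s)⁻¹^2 := by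
  constructor
  · have h := tv_sum (g := fun y => gp s (x-y)) (g' := fun y => -gp1 s (x-y))
      (fun y => by simpa using (gp_hasDeriv (s := s) (x-y)).comp_const_sub x y)
      ((gp1_cont.comp (continuous_sub_left x)).neg)
      ((gp_integrable hs).comp_sub_left x) ((gp1_integrable hs).comp_sub_left x).neg (gp_summable hs x)
    rw [integral_sub_left_eq_self (gp s), gp_integral hs] at h
    simp only [abs_neg] at h
    rw [integral_sub_left_eq_self (fun y => |gp1 s y|)] at h
    exact h.trans (gp12_int hs).1
  · have h := tv_sum (g := fun y => gp1 s (x-y)) (g' := fun y => -gp2 s (x-y))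
      (fun y => by simpa using (gp1_hasDeriv (s := s) (x-y)).comp_const_sub x y)
      ((gp2_cont.comp (continuous_sub_left x)).neg)
      ((gp1_integrable hs).comp_sub_left x) ((gp2_integrable hs).comp_sub_left x).neg (gp1_summable hs x)
    rw [integral_sub_left_eq_self (gp1 s), gp1_integral hs, sub_zero] at h
    simp only [abs_neg] at h
    rw [integral_sub_left_eq_self (fun y => |gp2 s y|)] at h
    exact h.trans (gp12_int hs).2

lemma sum_gp_le {s : ℝ} (hs : 0 < s) (T : Finset ℤ) (x : ℝ) : ∑ m ∈ T, gp s (x-m) ≤ th s x :=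
  (gp_summable hs x).sum_le_tsum _ fun m _ => (gp_pos hs _).le

lemma rs {s : ℝ} (hs : 16 ≤ s) : 0 < (√s)⁻¹ ∧ (√s)⁻¹ ≤ 1/4 ∧ (√(2*s))⁻¹ ≤ (√s)⁻¹ := by
  have h4 : (4:ℝ) ≤ √s := by rw [Real.le_sqrt (by norm_num) (by linarith)]; linarith
  refine ⟨by positivity, ?_, ?_⟩
  · rw [one_div]; exact inv_anti₀ (by norm_num) h4
  · exact inv_anti₀ (by linarith) (Real.sqrt_le_sqrt (by linarith))

lemma ee_diff {s : ℝ} (hs : 0 < s) (T : Finset ℤ) :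
    ∑ m ∈ T, |ee s m - gp (2*s) m| ≤ 2 * (√s)⁻¹ := by
  have := sum_int_le (T := T) (a := fun m : ℤ => ee s m - gp (2*s) m)
    (u := fun m x => gp s x * pr s m x - gp s x * gp s (x-m)) (h := fun x => 2*(√s)⁻¹ * gp s x)
    (fun m => (u_integrable hs m).sub (ee0_eq hs m).1)
    (fun m => by rw [integral_sub (u_integrable hs m) (ee0_eq hs m).1, ee_eq hs, (ee0_eq hs m).2])
    ((gp_integrable hs).const_mul _) (fun x => ?_)
  · rwa [integral_const_mul, gp_integral hs, mul_one] at this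
  have ht := th_pos hs x
  have hg := gp_pos hs x
  have e : ∀ m : ℤ, |gp s x * pr s m x - gp s x * gp s (x-m)| = gp s x * |1 - th s x| * (gp s (x-m) / th s x) := by
    intro m
    rw [show gp s x * pr s m x - gp s x * gp s (x-m) = gp s x * (1 - th s x) * (gp s (x-m) / th s x) by
      unfold pr; field_simp]
    rw [abs_mul, abs_mul, abs_of_pos hg, abs_of_pos (div_pos (gp_pos hs _) ht)]
  simp_rw [e]
  rw [← Finset.mul_sum, ← Finset.sum_div, abs_sub_comm]
  calc _ ≤ gp s x * (2*(√s)⁻¹) * 1 := by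
        have h1 := (th_near hs x).1
        have h2 : (∑ m ∈ T, gp s (x-m)) / th s x ≤ 1 := by rw [div_le_one ht]; exact sum_gp_le hs T x
        have h3 : 0 ≤ (∑ m ∈ T, gp s (x-m)) / th s x := div_nonneg (Finset.sum_nonneg fun m _ => (gp_pos hs _).le) ht.le
        gcongr
    _ = _ := by ring

lemma s16 {s : ℝ} (hs : 16 ≤ s) (x : ℝ) : 1/2 ≤ th s x ∧ th s x ≤ 3/2 ∧ th (2*s) x ≤ 3/2 ∧ |th1 s x / th s x| ≤ 12*(√s)⁻¹^2 := by
  have h0 : 0 < s := by linarith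
  obtain ⟨r1, r2, r3⟩ := rs hs
  have h1 := abs_le.1 (th_near h0 x).1
  have h2 := abs_le.1 (th_near (s := 2*s) (by linarith) x).1
  have h3 := (th_near h0 x).2
  have ha : 1/2 ≤ th s x := by linarith
  refine ⟨ha, by linarith, by linarith, ?_⟩
  rw [abs_div, abs_of_pos (by linarith : 0 < th s x), div_le_iff₀ (by linarith)]
  nlinarith [sq_nonneg (√s)⁻¹]

lemma ep_diff {s : ℝ} (hs : 16 ≤ s) (T : Finset ℤ) :
    ∑ m ∈ T, |ep s m - -gp2 (2*s) m| ≤ 156 * (√s)⁻¹^3 := by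
  have h0 : 0 < s := by linarith
  have h2s : (0:ℝ) < 2*s := by linarith
  obtain ⟨r1, r2, -⟩ := rs hs
  set r := (√s)⁻¹ with hr
  have := sum_int_le (T := T) (a := fun m : ℤ => ep s m - -gp2 (2*s) m)
    (u := fun m x => th s x * (pr1 s 0 x * pr1 s m x) - gp1 s x * gp1 s (x-m))
    (h := fun x => 48*r^3 * gp (2*s) x + 108*r^3 * gp s x)
    (fun m => (epi_integrable h0 0 m).sub (ep0_eq h0 m).1)
    (fun m => by rw [integral_sub (epi_integrable h0 0 m) (ep0_eq h0 m).1, (ep0_eq h0 m).2]; rfl)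
    (((gp_integrable h2s).const_mul _).add ((gp_integrable h0).const_mul _)) (fun x => ?_)
  · rw [integral_add ((gp_integrable h2s).const_mul _) ((gp_integrable h0).const_mul _),
      integral_const_mul, integral_const_mul, gp_integral h0, gp_integral h2s] at this
    linarith
  obtain ⟨t1, t2, t3, t4⟩ := s16 hs x
  have ht : 0 < th s x := by linarith
  have tn := (th_near h0 x).1
  set L := th1 s x / th s x with hL
  set G := gp (2*s) x with hG
  have hG0 : 0 < G := gp_pos h2s x
  have hg0 := gp_pos h0 x
  have hA : |gp1 s x| ≤ 2*r*G := (gp12_le h0 x).1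
  have hi : (th s x)⁻¹ ≤ 2 := by rw [inv_le_comm₀ ht (by norm_num)]; linarith
  have hS : ∑ m ∈ T, |gp1 s (x-m)| ≤ 3*r := by
    calc _ ≤ ∑ m ∈ T, 2*r*gp (2*s) (x-m) := Finset.sum_le_sum fun m _ => (gp12_le h0 _).1
      _ ≤ 2*r*(3/2) := by rw [← Finset.mul_sum]; gcongr; exact (sum_gp_le h2s T x).trans t3
      _ = _ := by ring
  have hP := sum_gp_le h0 T x
  have hu : |(th s x)⁻¹ - 1| ≤ 4*r := by
    rw [show (th s x)⁻¹ - 1 = (th s x)⁻¹ * (1 - th s x) by field_simp, abs_mul, abs_of_pos (inv_pos.2 ht), abs_sub_comm]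
    calc _ ≤ 2 * (2*r) := by gcongr
      _ = _ := by ring
  calc _ ≤ ∑ m ∈ T, ((|gp1 s x| * |(th s x)⁻¹ - 1| + gp s x * |L| * (th s x)⁻¹) * |gp1 s (x-m)| +
        (|gp1 s x| * |L| * (th s x)⁻¹ + gp s x * L^2 * (th s x)⁻¹) * gp s (x-m)) := by
        refine Finset.sum_le_sum fun m _ => ?_
        have e : th s x * (pr1 s 0 x * pr1 s m x) - gp1 s x * gp1 s (x-m) =
            gp1 s x * ((th s x)⁻¹ - 1) * gp1 s (x-m) - gp s x * L * (th s x)⁻¹ * gp1 s (x-m)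
            - gp1 s x * L * (th s x)⁻¹ * gp s (x-m) + gp s x * L^2 * (th s x)⁻¹ * gp s (x-m) := by
          unfold pr1 pr gp1; rw [← hL]; simp only [Int.cast_zero, sub_zero]; field_simp; ring
        rw [e]
        have hgm := gp_pos h0 (x-m)
        have hti := inv_pos.2 ht
        refine (abs_add_le _ _).trans ?_
        refine (add_le_add_left ((abs_sub _ _).trans (add_le_add_left (abs_sub _ _) _)) _).trans ?_
        simp only [abs_mul, abs_of_pos hg0, abs_of_pos hgm, abs_of_pos hti, abs_pow, sq_abs]
        apply le_of_eq; ring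
    _ = (|gp1 s x| * |(th s x)⁻¹ - 1| + gp s x * |L| * (th s x)⁻¹) * (∑ m ∈ T, |gp1 s (x-m)|) +
        (|gp1 s x| * |L| + gp s x * L^2) * ((th s x)⁻¹ * ∑ m ∈ T, gp s (x-m)) := by
        rw [Finset.sum_add_distrib, ← Finset.mul_sum, ← Finset.mul_sum]; ring
    _ ≤ (2*r*G * (4*r) + gp s x * (12*r^2) * 2) * (3*r) + (2*r*G*(12*r^2) + gp s x * (12*r^2)^2) * 1 := by
        have hL2 : L^2 ≤ (12*r^2)^2 := by rw [← sq_abs]; gcongr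
        have h2 : (th s x)⁻¹ * ∑ m ∈ T, gp s (x-m) ≤ 1 := by rw [inv_mul_le_iff₀ ht]; linarith
        have h3 : 0 ≤ (th s x)⁻¹ * ∑ m ∈ T, gp s (x-m) := mul_nonneg (inv_pos.2 ht).le (Finset.sum_nonneg fun m _ => (gp_pos h0 _).le)
        have h4 : 0 ≤ ∑ m ∈ T, |gp1 s (x-m)| := Finset.sum_nonneg fun m _ => abs_nonneg _
        gcongr
    _ ≤ _ := by
        have : r^4 ≤ r^3 * (1/4) := by rw [pow_succ]; gcongr
        nlinarith

lemma ep0_l1 {s : ℝ} (hs : 16 ≤ s) (T : Finset ℤ) : ∑ m ∈ T, |-gp2 (2*s) m| ≤ 6 * (√s)⁻¹^2 := by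
  have h0 : 0 < s := by linarith
  have h2s : (0:ℝ) < 2*s := by linarith
  obtain ⟨r1, r2, -⟩ := rs hs
  set r := (√s)⁻¹ with hr
  have := sum_int_le (T := T) (a := fun m : ℤ => -gp2 (2*s) m)
    (u := fun m x => gp1 s x * gp1 s (x-m)) (h := fun x => 6*r^2 * gp (2*s) x)
    (fun m => (ep0_eq h0 m).1) (fun m => (ep0_eq h0 m).2.symm)
    ((gp_integrable h2s).const_mul _) (fun x => ?_)
  · rwa [integral_const_mul, gp_integral h2s, mul_one] at this
  obtain ⟨t1, t2, t3, t4⟩ := s16 hs x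
  have hS : ∑ m ∈ T, |gp1 s (x-m)| ≤ 3*r := by
    calc _ ≤ ∑ m ∈ T, 2*r*gp (2*s) (x-m) := Finset.sum_le_sum fun m _ => (gp12_le h0 _).1
      _ ≤ 2*r*(3/2) := by rw [← Finset.mul_sum]; gcongr; exact (sum_gp_le h2s T x).trans t3
      _ = _ := by ring
  simp only [abs_mul]
  rw [← Finset.mul_sum]
  have hG0 := gp_pos h2s x
  calc _ ≤ (2*r*gp (2*s) x) * (3*r) := by gcongr; exact (gp12_le h0 x).1
    _ = _ := by ring

lemma gp2s_le {s : ℝ} (hs : 16 ≤ s) (x : ℝ) : gp (2*s) x ≤ (√s)⁻¹ := by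
  have h0 : 0 < s := by linarith
  unfold gp
  have h1 : 0 ≤ x^2/(2*(2*s)) := by positivity
  have : Real.exp (-x^2/(2*(2*s))) ≤ 1 := Real.exp_le_one_iff.2 (by rw [neg_div]; linarith)
  calc _ ≤ (√(2*π*(2*s)))⁻¹ * 1 := by gcongr
    _ ≤ _ := by
      rw [mul_one]; apply inv_anti₀ (Real.sqrt_pos.2 h0) (Real.sqrt_le_sqrt _)
      nlinarith [Real.pi_gt_three]

lemma ee_large {s : ℝ} (hs : 16 ≤ s) (m : ℤ) : ee s m ≤ 3*(√s)⁻¹ := by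
  have h := ee_diff (s := s) (by linarith) {m}
  simp only [Finset.sum_singleton] at h
  linarith [(abs_le.1 h).2, gp2s_le hs (m:ℝ)]

lemma ee_tv {s : ℝ} (hs : 16 ≤ s) (T : Finset ℤ) : ∑ m ∈ T, |ee s (m+1) - ee s m| ≤ 6*(√s)⁻¹ := by
  have h0 : 0 < s := by linarith
  have h2s : (0:ℝ) < 2*s := by linarith
  have h1 := ee_diff h0 T
  have h2 := ee_diff h0 (T.map (Equiv.addRight (1:ℤ)).toEmbedding)
  rw [Finset.sum_map] at h2
  have h3 := (tv_diff (fun x => gp_hasDeriv (s := 2*s) x) gp1_cont (gp1_integrable h2s) T).trans (gp12_int h2s).1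
  have h4 := (rs hs).2.2
  calc _ ≤ ∑ m ∈ T, (|ee s (m+1) - gp (2*s) ((m+1:ℤ))| + |gp (2*s) ((m+1:ℤ)) - gp (2*s) m| + |ee s m - gp (2*s) m|) := by
        refine Finset.sum_le_sum fun m _ => ?_
        rw [abs_sub_comm (ee s m)]
        refine le_trans (le_of_eq ?_) (abs_add_three _ _ _)
        congr 1; ring
    _ ≤ _ := by
        rw [Finset.sum_add_distrib, Finset.sum_add_distrib]
        simp only [Equiv.coe_toEmbedding, Equiv.coe_addRight] at h2
        linarith

end Th
end
end

section
open MeasureTheory Real Filter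
noncomputable section
namespace Th

lemma pi_tsum_aux {d : ℕ} (a : Fin d → ℤ → ℝ) (ha : ∀ i, Summable (fun n => |a i n|)) :
    Summable (fun n : Fin d → ℤ => |∏ i, a i (n i)|) ∧ HasSum (fun n : Fin d → ℤ => ∏ i, a i (n i)) (∏ i, ∑' n, a i n) := by
  induction d with
  | zero => exact ⟨(hasSum_fintype _).summable, by simp⟩
  | succ d ih =>
    obtain ⟨h3, h1⟩ := ih (fun i => a i.succ) (fun i => ha _)
    have h4 : Summable (fun x : ℤ × (Fin d → ℤ) => a 0 x.1 * ∏ i, a (Fin.succ i) (x.2 i)) :=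
      summable_mul_of_summable_norm (f := a 0) (g := fun x : Fin d → ℤ => ∏ i, a (Fin.succ i) (x i)) (ha 0) h3
    have h2 := (ha 0).of_abs.hasSum.mul h1 h4
    constructor
    · rw [← (Fin.consEquiv (fun _ => ℤ)).summable_iff]
      refine h4.abs.congr fun n => ?_
      simp [Fin.prod_univ_succ, Fin.consEquiv]
    · rw [← (Fin.consEquiv (fun _ => ℤ)).hasSum_iff, Fin.prod_univ_succ]
      refine h2.congr_fun fun n => ?_
      simp [Fin.prod_univ_succ, Fin.consEquiv]

lemma pi_tsum {d : ℕ} (a : Fin d → ℤ → ℝ) (ha : ∀ i, Summable (fun n => |a i n|)) :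
    HasSum (fun n : Fin d → ℤ => ∏ i, a i (n i)) (∏ i, ∑' n, a i n) := (pi_tsum_aux a ha).2

lemma heatK_eq (d : ℕ) {s : ℝ} (hs : 0 < s) (x : EuclideanSpace ℝ (Fin d)) : heatK d s x = ∏ i, gp s (x i) := by
  unfold heatK gp
  rw [Finset.prod_mul_distrib, ← Real.exp_sum, EuclideanSpace.norm_sq_eq]
  congr 1
  · rw [Finset.prod_const, Finset.card_univ, Fintype.card_fin, Real.sqrt_eq_rpow, ← Real.rpow_neg (by positivity),
      ← Real.rpow_natCast, ← Real.rpow_mul (by positivity)]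
    congr 1; ring
  · congr 1
    rw [← Finset.sum_neg_distrib, Finset.sum_div]
    simp

lemma pHeatK_eq (d : ℕ) {s : ℝ} (hs : 0 < s) (x : EuclideanSpace ℝ (Fin d)) : pHeatK d s x = ∏ i, th s (x i) := by
  unfold pHeatK th
  rw [← (pi_tsum (fun i n => gp s (x i - n)) (fun i => (gp_summable hs _).abs)).tsum_eq]
  congr 1; ext n
  rw [heatK_eq d hs]; rfl

lemma ratio_eq (d : ℕ) {s : ℝ} (hs : 0 < s) (m : ZLat d) :
    (fun y => heatK d s (y - latVec m) / pHeatK d s y) = fun y => ∏ i, pr s (m i) (y i) := by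
  funext y
  rw [heatK_eq d hs, pHeatK_eq d hs, ← Finset.prod_div_distrib]; rfl

lemma pderiv_ratio (d : ℕ) {s : ℝ} (hs : 0 < s) (m : ZLat d) (i : Fin d) (x : EuclideanSpace ℝ (Fin d)) :
    pderiv i (fun y => heatK d s (y - latVec m) / pHeatK d s y) x =
      ∏ r, (if r = i then pr1 s (m r) (x r) else pr s (m r) (x r)) := by
  rw [ratio_eq d hs]
  unfold pderiv
  have hline : HasDerivAt (fun t : ℝ => ∏ r, pr s (m r) ((x + t • EuclideanSpace.single i (1:ℝ)) r))
      (∏ r, (if r = i then pr1 s (m r) (x r) else pr s (m r) (x r))) 0 := by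
    have e : (fun t : ℝ => ∏ r, pr s (m r) ((x + t • EuclideanSpace.single i (1:ℝ)) r)) =
        fun t : ℝ => pr s (m i) (x i + t) * ∏ r ∈ Finset.univ.erase i, pr s (m r) (x r) := by
      funext t
      rw [← Finset.mul_prod_erase _ _ (Finset.mem_univ i)]
      congr 1
      · simp
      · refine Finset.prod_congr rfl fun r hr => ?_
        simp [(Finset.mem_erase.1 hr).1]
    rw [e, ← Finset.mul_prod_erase _ _ (Finset.mem_univ i), if_pos rfl]
    rw [Finset.prod_congr rfl (g := fun r => pr s (m r) (x r)) (fun r hr => if_neg (Finset.mem_erase.1 hr).1)]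
    refine HasDerivAt.mul_const ?_ _
    have := pr_hasDeriv hs (m i) (x i + 0)
    have := this.comp_const_add (x i) 0
    simpa using this
  have hd : DifferentiableAt ℝ (fun y : EuclideanSpace ℝ (Fin d) => ∏ r, pr s (m r) (y r)) x := by
    refine (HasFDerivAt.finsetProd (u := Finset.univ) (g := fun r (y : EuclideanSpace ℝ (Fin d)) => pr s (m r) (y r))
      (g' := fun r => fderiv ℝ (fun (y : EuclideanSpace ℝ (Fin d)) => pr s (m r) (y r)) x) fun r _ => ?_).differentiableAt
    exact (((pr_hasDeriv hs (m r) (x r)).differentiableAt).comp (f := fun y : EuclideanSpace ℝ (Fin d) => y r) x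
        (EuclideanSpace.proj (𝕜 := ℝ) r).differentiableAt).hasFDerivAt
  have h1 := hd.hasFDerivAt.hasLineDerivAt (EuclideanSpace.single i (1:ℝ))
  exact h1.unique hline

def kq {d : ℕ} (i : Fin d) (s : ℝ) (m : ZLat d) : ℝ := ∏ r, (if r = i then ep s (m r) else ee s (m r))

lemma kq_eq {d : ℕ} (i : Fin d) (s : ℝ) (m : ZLat d) : kq i s m = ep s (m i) * ∏ r ∈ Finset.univ.erase i, ee s (m r) := by
  unfold kq
  rw [← Finset.mul_prod_erase _ _ (Finset.mem_univ i), if_pos rfl]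
  rw [Finset.prod_congr rfl (g := fun r => ee s (m r)) (fun r hr => if_neg (Finset.mem_erase.1 hr).1)]

lemma probK_eq {d : ℕ} (i : Fin d) (m : ZLat d) : probK d i i m = -∫ s in Set.Ioi (0:ℝ), kq i s m := by
  unfold probK
  congr 1
  refine setIntegral_congr_fun measurableSet_Ioi fun s hs => ?_
  replace hs : 0 < s := hs
  have h0 : (fun y => heatK d s y / pHeatK d s y) = fun y => heatK d s (y - latVec 0) / pHeatK d s y := by
    have : latVec (0 : ZLat d) = 0 := by ext i; simp [latVec]
    rw [this]; simp
  beta_reduce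
  rw [h0]
  simp_rw [pderiv_ratio d hs, pHeatK_eq d hs]
  have e : ∀ x : EuclideanSpace ℝ (Fin d), (∏ r, th s (x r)) * ((∏ r, if r = i then pr1 s ((0 : ZLat d) r) (x r) else pr s ((0: ZLat d) r) (x r)) *
      ∏ r, if r = i then pr1 s (m r) (x r) else pr s (m r) (x r)) =
      (fun y : Fin d → ℝ => ∏ r, (fun t => if r = i then th s t * (pr1 s 0 t * pr1 s (m r) t) else th s t * (pr s 0 t * pr s (m r) t)) (y r)) x.ofLp := by
    intro x
    rw [← Finset.prod_mul_distrib, ← Finset.prod_mul_distrib]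
    refine Finset.prod_congr rfl fun r _ => ?_
    split_ifs <;> rfl
  simp_rw [e]
  have key := (EuclideanSpace.volume_preserving_symm_measurableEquiv_toLp (Fin d)).integral_comp' (fun y : Fin d → ℝ => ∏ r, (fun t => if r = i then th s t * (pr1 s 0 t * pr1 s (m r) t) else th s t * (pr s 0 t * pr s (m r) t)) (y r))
  refine Eq.trans key ?_
  refine (integral_fintype_prod_volume_eq_prod (fun r t => if r = i then th s t * (pr1 s 0 t * pr1 s (m r) t) else th s t * (pr s 0 t * pr s (m r) t))).trans ?_
  unfold kq
  refine Finset.prod_congr rfl fun r _ => ?_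
  split_ifs <;> rfl

end Th
end
end

section
open MeasureTheory Real Filter
noncomputable section
namespace Th

lemma th_conv {s r : ℝ} (hs : 0 < s) (hr : 0 < r) (x : ℝ) :
    ∫⁻ y, ENNReal.ofReal (gp r (x-y) * th s y) = ENNReal.ofReal (th (s+r) x) := by
  have h1 : ∀ y, ENNReal.ofReal (gp r (x-y) * th s y) = ∑' n : ℤ, ENNReal.ofReal (gp s (y-n) * gp r (x-y)) := by
    intro y
    rw [← ENNReal.ofReal_tsum_of_nonneg (fun n => mul_nonneg (gp_pos hs _).le (gp_pos hr _).le) ((gp_summable hs y).mul_right _),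
      tsum_mul_right, mul_comm]; rfl
  simp_rw [h1]
  rw [lintegral_tsum (fun n => by
    have h1 := (gp_cont (s := s)).comp (continuous_sub_right (n:ℝ))
    have h2 := (gp_cont (s := r)).comp (continuous_sub_left x)
    exact (h1.mul h2).measurable.ennreal_ofReal.aemeasurable)]
  unfold th
  rw [ENNReal.ofReal_tsum_of_nonneg (fun n => (gp_pos (by positivity) _).le) (gp_summable (by positivity) x)]
  congr 1; ext n
  have := gp_conv_shift hs hr x n
  rw [← this.2, ofReal_integral_eq_lintegral_ofReal this.1]
  exact ae_of_all _ fun y => mul_nonneg (gp_pos hs _).le (gp_pos hr _).le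

lemma jensen_pt {s r : ℝ} (hs : 0 < s) (hr : 0 < r) {ι : Type*} (S : Finset ι) (ν : ι → ℤ) (c c' : ι → ℝ)
    {a : ℝ × ℝ → ℝ} (hconv : ConvexOn ℝ Set.univ a) (hcont : Continuous a) (h0 : ∀ z, 0 ≤ a z) (x : ℝ) :
    ENNReal.ofReal (th (s+r) x * a (∑ m ∈ S, c m * pr (s+r) (ν m) x, ∑ m ∈ S, c' m * pr (s+r) (ν m) x)) ≤
    ∫⁻ y, ENNReal.ofReal (gp r (x-y)) * ENNReal.ofReal (th s y * a (∑ m ∈ S, c m * pr s (ν m) y, ∑ m ∈ S, c' m * pr s (ν m) y)) := by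
  have ht := th_pos (s := s+r) (by positivity) x
  set ρ : ℝ → ℝ := fun y => gp r (x-y) * th s y / th (s+r) x with hρ
  have hρ0 : ∀ y, 0 ≤ ρ y := fun y => div_nonneg (mul_nonneg (gp_pos hr _).le (th_pos hs _).le) ht.le
  have hρc : Continuous ρ := ((gp_cont.comp (continuous_sub_left x)).mul (th_cont hs)).div_const _
  set μ := (volume : Measure ℝ).withDensity (fun y => ENNReal.ofReal (ρ y)) with hμ
  have hρm : Measurable (fun y => ENNReal.ofReal (ρ y)) := hρc.measurable.ennreal_ofReal
  have hρlt : ∀ᵐ y ∂(volume : Measure ℝ), ENNReal.ofReal (ρ y) < ⊤ := ae_of_all _ fun y => ENNReal.ofReal_lt_top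
  have hprob : IsProbabilityMeasure μ := by
    constructor
    rw [hμ, withDensity_apply _ MeasurableSet.univ, Measure.restrict_univ]
    have : ∀ y, ENNReal.ofReal (ρ y) = ENNReal.ofReal (gp r (x-y) * th s y) * ENNReal.ofReal (th (s+r) x)⁻¹ := by
      intro y; rw [← ENNReal.ofReal_mul (mul_nonneg (gp_pos hr _).le (th_pos hs _).le)]; rfl
    simp_rw [this]
    rw [lintegral_mul_const' _ _ ENNReal.ofReal_ne_top, th_conv hs hr, ← ENNReal.ofReal_mul ht.le,
      mul_inv_cancel₀ ht.ne', ENNReal.ofReal_one]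
  have hpri : ∀ m, Integrable (pr s m) μ := fun m =>
    Integrable.of_bound (pr_cont hs m).aestronglyMeasurable 1 (ae_of_all _ fun y => by
      rw [Real.norm_of_nonneg (pr_nonneg hs m y)]; exact pr_le_one hs m y)
  have hprI : ∀ m, ∫ y, pr s m y ∂μ = pr (s+r) m x := by
    intro m
    rw [hμ, integral_withDensity_eq_integral_toReal_smul hρm hρlt]
    have : ∀ y, (ENNReal.ofReal (ρ y)).toReal • pr s m y = (gp s (y-m) * gp r (x-y)) / th (s+r) x := by
      intro y
      rw [ENNReal.toReal_ofReal (hρ0 y), smul_eq_mul]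
      have := th_pos hs y
      simp only [hρ]; unfold pr; field_simp
    simp_rw [this]
    rw [integral_div, (gp_conv_shift hs hr x m).2]; rfl
  have hF : ∀ c : ι → ℝ, Continuous (fun y => ∑ m ∈ S, c m * pr s (ν m) y) := fun c =>
    continuous_finsetSum _ fun m _ => (pr_cont hs _).const_mul _
  have hFb : ∀ c : ι → ℝ, ∀ y, |∑ m ∈ S, c m * pr s (ν m) y| ≤ ∑ m ∈ S, |c m| := by
    intro c y
    refine (Finset.abs_sum_le_sum_abs _ _).trans (Finset.sum_le_sum fun m _ => ?_)
    rw [abs_mul, abs_of_nonneg (pr_nonneg hs _ y)]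
    exact mul_le_of_le_one_right (abs_nonneg _) (pr_le_one hs _ y)
  have hFi : ∀ c : ι → ℝ, Integrable (fun y => ∑ m ∈ S, c m * pr s (ν m) y) μ := fun c =>
    integrable_finsetSum _ fun m _ => (hpri _).const_mul _
  have hFI : ∀ c : ι → ℝ, ∫ y, (∑ m ∈ S, c m * pr s (ν m) y) ∂μ = ∑ m ∈ S, c m * pr (s+r) (ν m) x := by
    intro c
    rw [integral_finsetSum _ fun m _ => (hpri _).const_mul _]
    simp_rw [integral_const_mul, hprI]
  have hpi : Integrable (fun y => ((∑ m ∈ S, c m * pr s (ν m) y, ∑ m ∈ S, c' m * pr s (ν m) y) : ℝ × ℝ)) μ :=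
    (hFi c).prodMk (hFi c')
  have hac : Continuous (fun y => a (∑ m ∈ S, c m * pr s (ν m) y, ∑ m ∈ S, c' m * pr s (ν m) y)) :=
    hcont.comp ((hF c).prodMk (hF c'))
  have hai : Integrable (fun y => a (∑ m ∈ S, c m * pr s (ν m) y, ∑ m ∈ S, c' m * pr s (ν m) y)) μ := by
    obtain ⟨C, hC⟩ := (((isCompact_Icc (a := -∑ m ∈ S, |c m|) (b := ∑ m ∈ S, |c m|)).prod
      (isCompact_Icc (a := -∑ m ∈ S, |c' m|) (b := ∑ m ∈ S, |c' m|))).exists_bound_of_continuousOn hcont.continuousOn)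
    exact Integrable.of_bound hac.aestronglyMeasurable C (ae_of_all _ fun y =>
      hC _ ⟨abs_le.1 (hFb c y), abs_le.1 (hFb c' y)⟩)
  have hJ := hconv.map_integral_le hcont.continuousOn isClosed_univ (ae_of_all _ fun _ => Set.mem_univ _) hpi hai
  rw [integral_pair (hFi c) (hFi c'), hFI, hFI] at hJ
  calc _ ≤ ENNReal.ofReal (th (s+r) x * ∫ y, a (∑ m ∈ S, c m * pr s (ν m) y, ∑ m ∈ S, c' m * pr s (ν m) y) ∂μ) :=
        ENNReal.ofReal_le_ofReal (mul_le_mul_of_nonneg_left hJ ht.le)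
    _ = _ := by
        rw [ENNReal.ofReal_mul ht.le, ofReal_integral_eq_lintegral_ofReal hai (ae_of_all _ fun y => h0 _), hμ,
          lintegral_withDensity_eq_lintegral_mul _ hρm hac.measurable.ennreal_ofReal,
          ← lintegral_const_mul' _ _ ENNReal.ofReal_ne_top]
        congr 1; ext y
        have hy := (th_pos hs y).le
        rw [Pi.mul_apply, ← ENNReal.ofReal_mul (hρ0 y), ← ENNReal.ofReal_mul ht.le, ← ENNReal.ofReal_mul (gp_pos hr _).le]
        congr 1; simp only [hρ]; field_simp

lemma lemJ {s t : ℝ} (hs : 0 < s) (hst : s ≤ t) {ι : Type*} (S : Finset ι) (ν : ι → ℤ) (c c' : ι → ℝ)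
    {a : ℝ × ℝ → ℝ} (hconv : ConvexOn ℝ Set.univ a) (hcont : Continuous a) (h0 : ∀ z, 0 ≤ a z) :
    ∫⁻ x, ENNReal.ofReal (th t x * a (∑ m ∈ S, c m * pr t (ν m) x, ∑ m ∈ S, c' m * pr t (ν m) x)) ≤
    ∫⁻ y, ENNReal.ofReal (th s y * a (∑ m ∈ S, c m * pr s (ν m) y, ∑ m ∈ S, c' m * pr s (ν m) y)) := by
  rcases hst.eq_or_lt with rfl | hlt
  · exact le_rfl
  obtain ⟨r, hr, rfl⟩ : ∃ r, 0 < r ∧ t = s + r := ⟨t - s, by linarith, by ring⟩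
  refine (lintegral_mono fun x => jensen_pt hs hr S ν c c' hconv hcont h0 x).trans ?_
  have hF : ∀ c : ι → ℝ, Continuous (fun y => ∑ m ∈ S, c m * pr s (ν m) y) := fun c =>
    continuous_finsetSum _ fun m _ => (pr_cont hs _).const_mul _
  have hac : Continuous (fun y => a (∑ m ∈ S, c m * pr s (ν m) y, ∑ m ∈ S, c' m * pr s (ν m) y)) :=
    hcont.comp ((hF c).prodMk (hF c'))
  have hm := ((th_cont hs).mul hac).measurable.ennreal_ofReal
  rw [lintegral_lintegral_swap]
  · refine lintegral_mono fun y => ?_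
    rw [lintegral_mul_const' _ _ ENNReal.ofReal_ne_top]
    have : ∫⁻ x, ENNReal.ofReal (gp r (x-y)) = 1 := by
      rw [← ofReal_integral_eq_lintegral_ofReal (gp_shift_integrable hr y) (ae_of_all _ fun x => (gp_pos hr _).le),
        gp_shift_integral hr, ENNReal.ofReal_one]
    rw [this, one_mul]
  · have h1 : Continuous (fun z : ℝ × ℝ => gp r (z.1 - z.2)) := gp_cont.comp (continuous_fst.sub continuous_snd)
    exact (h1.measurable.ennreal_ofReal.mul (hm.comp measurable_snd)).aemeasurable

end Th
end
end

section
open MeasureTheory Real Filter Topology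
noncomputable section
namespace Th

lemma upd_hasDeriv {f f' : ℝ → ℝ} {A : ℝ} (hd : ∀ x, 0 < x → HasDerivAt f (f' x) x) :
    ∀ x ∈ Set.Ioi (0:ℝ), HasDerivAt (Function.update f 0 A) (f' x) x := by
  intro x hx
  refine (hd x hx).congr_of_eventuallyEq ?_
  filter_upwards [isOpen_ne.mem_nhds (show x ≠ 0 from ne_of_gt hx)] with y hy
  rw [Function.update_of_ne hy]

lemma upd_cont {f : ℝ → ℝ} {A : ℝ} (h0 : Tendsto f (𝓝[>] 0) (𝓝 A)) :
    ContinuousWithinAt (Function.update f 0 A) (Set.Ici 0) 0 := by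
  rw [continuousWithinAt_update_same]
  rwa [Set.Ici_sdiff_left]

lemma upd_top {f : ℝ → ℝ} {A B : ℝ} (h : Tendsto f atTop (𝓝 B)) : Tendsto (Function.update f 0 A) atTop (𝓝 B) := by
  refine h.congr' ?_
  filter_upwards [eventually_gt_atTop 0] with y hy
  rw [Function.update_of_ne hy.ne']

lemma ftc0 {f f' : ℝ → ℝ} {A B : ℝ} (hd : ∀ x, 0 < x → HasDerivAt f (f' x) x) (h0 : Tendsto f (𝓝[>] 0) (𝓝 A))
    (h : Tendsto f atTop (𝓝 B)) (hi : IntegrableOn f' (Set.Ioi 0)) : ∫ s in Set.Ioi 0, f' s = B - A := by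
  have := integral_Ioi_of_hasDerivAt_of_tendsto (upd_cont h0) (upd_hasDeriv hd) hi (upd_top h)
  simpa using this

lemma ee_cont_s {s : ℝ} (hs : 0 < s) (m : ℤ) : ContinuousAt (fun s => ee s m) s := (ee_hasDeriv hs m).continuousAt

lemma ee_tendsto_zero (m : ℤ) : Tendsto (fun s => ee s m) (𝓝[>] 0) (𝓝 (if m = 0 then 1 else 0)) := by
  have hid : Tendsto (fun s : ℝ => s) (𝓝[>] 0) (𝓝 0) := tendsto_nhdsWithin_of_tendsto_nhds tendsto_id
  split_ifs with hm
  · subst hm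
    have h1 : Tendsto (fun s : ℝ => 1 - 48 * s * Z2) (𝓝[>] 0) (𝓝 1) := by
      simpa using ((hid.const_mul 48).mul_const Z2).const_sub 1
    refine tendsto_of_tendsto_of_tendsto_of_le_of_le' h1 tendsto_const_nhds ?_ ?_
    · filter_upwards [self_mem_nhdsWithin] with s hs using ee_zero_ge hs
    · filter_upwards [self_mem_nhdsWithin] with s hs using ee_le_one hs 0
  · have h1 : Tendsto (fun s : ℝ => 48 * s * (1/(m:ℝ)^2)) (𝓝[>] 0) (𝓝 0) := by
      have := ((hid.const_mul 48).mul_const (1/(m:ℝ)^2))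
      rwa [mul_zero, zero_mul] at this
    refine tendsto_of_tendsto_of_tendsto_of_le_of_le' tendsto_const_nhds h1 ?_ ?_
    · filter_upwards [self_mem_nhdsWithin] with s hs using ee_nonneg hs m
    · filter_upwards [self_mem_nhdsWithin] with s hs using ee_small hs hm

lemma rinv_tendsto : Tendsto (fun s : ℝ => (√s)⁻¹) atTop (𝓝 0) := tendsto_inv_atTop_zero.comp Real.tendsto_sqrt_atTop

lemma ee_tendsto_top (m : ℤ) : Tendsto (fun s => ee s m) atTop (𝓝 0) := by
  refine tendsto_of_tendsto_of_tendsto_of_le_of_le' (h := fun s => 3*(√s)⁻¹) tendsto_const_nhds ?_ ?_ ?_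
  · simpa using rinv_tendsto.const_mul 3
  · filter_upwards [eventually_gt_atTop 0] with s hs using ee_nonneg hs m
  · filter_upwards [eventually_ge_atTop 16] with s hs using ee_large hs m

lemma ep_meas (m : ℤ) : AEStronglyMeasurable (fun s => ep s m) (volume.restrict (Set.Ioi 0)) := by
  have h := (measurable_deriv (fun s => ee s m)).neg.aestronglyMeasurable (μ := volume.restrict (Set.Ioi 0))
  refine h.congr ?_
  refine (ae_restrict_mem measurableSet_Ioi).mono fun s hs => ?_
  rw [Pi.neg_apply, (ee_hasDeriv hs m).deriv, neg_neg]

lemma ep_zero_int : IntegrableOn (fun s => ep s 0) (Set.Ioi 0) := by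
  have h := integrableOn_Ioi_deriv_of_nonpos (upd_cont (ee_tendsto_zero 0)) (upd_hasDeriv fun x hx => ee_hasDeriv hx 0)
    (fun x hx => neg_nonpos.2 (ep_zero_nonneg hx)) (upd_top (ee_tendsto_top 0))
  exact h.neg.congr (ae_of_all _ fun s => by simp)

lemma ep_int (m : ℤ) : IntegrableOn (fun s => ep s m) (Set.Ioi 0) :=
  Integrable.mono' ep_zero_int (ep_meas m) ((ae_restrict_mem measurableSet_Ioi).mono fun s hs => ep_abs_le hs m)

lemma eeP_le_one {s : ℝ} (hs : 0 < s) {d : ℕ} (R : Finset (Fin d)) (m : ZLat d) :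
    0 ≤ ∏ r ∈ R, ee s (m r) ∧ ∏ r ∈ R, ee s (m r) ≤ 1 :=
  ⟨Finset.prod_nonneg fun _ _ => ee_nonneg hs _, Finset.prod_le_one (fun _ _ => ee_nonneg hs _) fun _ _ => ee_le_one hs _⟩

lemma kq_abs_le {d : ℕ} (i : Fin d) {s : ℝ} (hs : 0 < s) (m : ZLat d) : |kq i s m| ≤ |ep s (m i)| := by
  rw [kq_eq, abs_mul, abs_of_nonneg (eeP_le_one hs _ m).1]
  exact mul_le_of_le_one_right (abs_nonneg _) (eeP_le_one hs _ m).2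

lemma kq_int {d : ℕ} (i : Fin d) (m : ZLat d) : IntegrableOn (fun s => kq i s m) (Set.Ioi 0) := by
  refine Integrable.mono' (ep_int (m i)).abs ?_ ((ae_restrict_mem measurableSet_Ioi).mono fun s hs => kq_abs_le i hs m)
  simp_rw [kq_eq]
  refine (ep_meas _).mul (ContinuousOn.aestronglyMeasurable ?_ measurableSet_Ioi)
  exact continuousOn_finsetProd _ fun r _ s hs => (ee_cont_s hs _).continuousWithinAt

lemma eeP_hasDeriv {d : ℕ} {s : ℝ} (hs : 0 < s) (m : ZLat d) :
    HasDerivAt (fun s => ∏ r, ee s (m r)) (-∑ i, kq i s m) s := by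
  have h := HasDerivAt.fun_finsetProd (u := (Finset.univ : Finset (Fin d))) (f := fun r s => ee s (m r)) (fun r _ => ee_hasDeriv hs (m r))
  refine h.congr_deriv ?_
  rw [← Finset.sum_neg_distrib]
  refine Finset.sum_congr rfl fun i _ => ?_
  rw [kq_eq, smul_eq_mul]; ring

lemma eeP_zero {d : ℕ} (m : ZLat d) : Tendsto (fun s => ∏ r, ee s (m r)) (𝓝[>] 0) (𝓝 (if m = 0 then 1 else 0)) := by
  have h := tendsto_finsetProd (Finset.univ : Finset (Fin d)) fun r _ => ee_tendsto_zero (m r)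
  have e : (∏ r, if m r = 0 then (1:ℝ) else 0) = if m = 0 then 1 else 0 := by
    split_ifs with hm
    · simp [hm]
    · obtain ⟨r, hr⟩ := Function.ne_iff.1 hm
      exact Finset.prod_eq_zero (Finset.mem_univ r) (if_neg hr)
  rwa [e] at h

lemma eeP_top {d : ℕ} (hd : 0 < d) (m : ZLat d) : Tendsto (fun s => ∏ r, ee s (m r)) atTop (𝓝 0) := by
  have h := tendsto_finsetProd (Finset.univ : Finset (Fin d)) fun r _ => ee_tendsto_top (m r)
  rwa [Finset.prod_eq_zero (Finset.mem_univ (⟨0, hd⟩ : Fin d)) rfl] at h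

lemma ep_Ioc {τ : ℝ} (hτ : 0 < τ) (m : ℤ) : ∫ s in Set.Ioc 0 τ, ep s m = (if m = 0 then 1 else 0) - ee τ m := by
  have hi : IntervalIntegrable (fun s => -ep s m) volume 0 τ :=
    (intervalIntegrable_iff_integrableOn_Ioc_of_le hτ.le).2 ((ep_int m).mono_set Set.Ioc_subset_Ioi_self).neg
  have := intervalIntegral.integral_eq_sub_of_hasDerivAt_of_tendsto hτ (fun x hx => ee_hasDeriv hx.1 m) hi (ee_tendsto_zero m)
    ((ee_cont_s hτ m).tendsto.mono_left nhdsWithin_le_nhds)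
  rw [intervalIntegral.integral_of_le hτ.le, integral_neg] at this
  linarith

lemma kq_Ioi_sum {d : ℕ} (hd : 0 < d) {τ : ℝ} (hτ : 0 < τ) (m : ZLat d) :
    ∑ i, ∫ s in Set.Ioi τ, kq i s m = ∏ r, ee τ (m r) := by
  have hi : ∀ i : Fin d, IntegrableOn (fun s => kq i s m) (Set.Ioi τ) := fun i =>
    (kq_int i m).mono_set (Set.Ioi_subset_Ioi hτ.le)
  rw [← integral_finsetSum _ fun i _ => hi i]
  have h := integral_Ioi_of_hasDerivAt_of_tendsto' (a := τ) (f := fun s => ∏ r, ee s (m r)) (f' := fun s => -∑ i, kq i s m)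
    (fun s hs => eeP_hasDeriv (hτ.trans_le hs) m) (integrable_finsetSum _ fun i _ => hi i).neg (eeP_top hd m)
  rw [integral_neg] at h
  linarith

lemma kq_sum {d : ℕ} (hd : 0 < d) (m : ZLat d) :
    ∑ i, ∫ s in Set.Ioi 0, kq i s m = if m = 0 then 1 else 0 := by
  rw [← integral_finsetSum _ fun i _ => kq_int i m]
  have h := ftc0 (f' := fun s => -∑ i, kq i s m) (fun s hs => eeP_hasDeriv hs m) (eeP_zero m) (eeP_top hd m)
    (integrable_finsetSum _ fun i _ => kq_int i m).neg
  rw [integral_neg] at h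
  linarith

lemma ee_lip {s t : ℝ} (hs : 0 < s) (ht : 0 < t) (m : ℤ) : |ee t m - ee s m| ≤ D0 * |t - s| := by
  have := (convex_Ioi (0:ℝ)).norm_image_sub_le_of_norm_hasDerivWithin_le (f := fun s => ee s m) (f' := fun s => -ep s m) (C := D0)
    (fun x hx => (ee_hasDeriv hx m).hasDerivWithinAt) (fun x hx => by rw [norm_neg]; exact ep_le hx m) hs ht
  exact this

end Th
end
end

section
open MeasureTheory Real Filter Topology
noncomputable section
namespace Th

def PP {d : ℕ} (s : Fin d → ℝ) (m : ZLat d) (x : Fin d → ℝ) : ℝ := ∏ r, pr (s r) (m r) (x r)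
def TT {d : ℕ} (s : Fin d → ℝ) (x : Fin d → ℝ) : ℝ := ∏ r, th (s r) (x r)
def FF {d : ℕ} (S : Finset (ZLat d)) (f : ZLat d → ℝ) (s : Fin d → ℝ) (x : Fin d → ℝ) : ℝ := ∑ m ∈ S, f m * PP s m x
def BB {d : ℕ} (S : Finset (ZLat d)) (f g : ZLat d → ℝ) (s : Fin d → ℝ) : ℝ :=
  ∑ m ∈ S, ∑ n ∈ S, f m * g n * ∏ r, ee (s r) (n r - m r)
def IA {d : ℕ} (a : ℝ × ℝ → ℝ) (S : Finset (ZLat d)) (f g : ZLat d → ℝ) (s : Fin d → ℝ) : ℝ :=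
  ∫ x, TT s x * a (FF S f s x, FF S g s x)

section
variable {d : ℕ} {s : Fin d → ℝ} (hs : ∀ r, 0 < s r)
include hs

lemma PP_nonneg (m : ZLat d) (x : Fin d → ℝ) : 0 ≤ PP s m x := Finset.prod_nonneg fun r _ => pr_nonneg (hs r) _ _
lemma TT_pos (x : Fin d → ℝ) : 0 < TT s x := Finset.prod_pos fun r _ => th_pos (hs r) _
lemma PP_cont (m : ZLat d) : Continuous (PP s m) :=
  continuous_finsetProd _ fun r _ => (pr_cont (hs r) _).comp (continuous_apply r)
lemma TT_cont : Continuous (TT s) :=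
  continuous_finsetProd _ fun r _ => (th_cont (hs r)).comp (continuous_apply r)
lemma FF_cont (S : Finset (ZLat d)) (f : ZLat d → ℝ) : Continuous (FF S f s) :=
  continuous_finsetSum _ fun m _ => (PP_cont hs m).const_mul _

lemma PP_sum_le (S : Finset (ZLat d)) (x : Fin d → ℝ) : ∑ m ∈ S, PP s m x ≤ 1 := by
  have h := pi_tsum (fun r n => pr (s r) n (x r)) (fun r => (pr_hasSum (hs r) (x r)).summable.abs)
  rw [Finset.prod_congr rfl (fun r _ => (pr_hasSum (hs r) (x r)).tsum_eq), Finset.prod_const_one] at h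
  exact sum_le_hasSum S (fun m _ => PP_nonneg hs m x) h

lemma TP_int (m : ZLat d) : Integrable (fun x => TT s x * PP s m x) ∧ ∫ x, TT s x * PP s m x = 1 := by
  have e : (fun x => TT s x * PP s m x) = fun x => ∏ r, (fun t => gp (s r) (t - m r)) (x r) := by
    funext x; unfold TT PP; rw [← Finset.prod_mul_distrib]
    refine Finset.prod_congr rfl fun r _ => ?_
    have := (th_pos (hs r) (x r)).ne'
    unfold pr; field_simp
  rw [e]
  refine ⟨Integrable.fintype_prod fun r => gp_shift_integrable (hs r) _, ?_⟩
  refine (integral_fintype_prod_volume_eq_prod (fun r t => gp (s r) (t - m r))).trans ?_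
  exact Finset.prod_eq_one fun r _ => gp_shift_integral (hs r) _

lemma TPP_int (m n : ZLat d) : Integrable (fun x => TT s x * (PP s m x * PP s n x)) ∧
    ∫ x, TT s x * (PP s m x * PP s n x) = ∏ r, ee (s r) (n r - m r) := by
  have e : (fun x => TT s x * (PP s m x * PP s n x)) =
      fun x => ∏ r, (fun t => th (s r) t * (pr (s r) (m r) t * pr (s r) (n r) t)) (x r) := by
    funext x; unfold TT PP; rw [← Finset.prod_mul_distrib, ← Finset.prod_mul_distrib]
  rw [e]
  refine ⟨Integrable.fintype_prod fun r => eei_integrable (hs r) _ _, ?_⟩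
  refine (integral_fintype_prod_volume_eq_prod (fun r t => th (s r) t * (pr (s r) (m r) t * pr (s r) (n r) t))).trans ?_
  exact Finset.prod_congr rfl fun r _ => ee_gram _ _ _

omit hs in
lemma w_jensen {ι : Type*} (S : Finset ι) (w f : ι → ℝ) (hw : ∀ i, 0 ≤ w i) (h1 : ∑ i ∈ S, w i ≤ 1) {p : ℝ} (hp : 1 ≤ p) :
    |∑ i ∈ S, f i * w i| ^ p ≤ ∑ i ∈ S, |f i| ^ p * w i := by
  have h := (convexOn_rpow hp).map_add_sum_le (t := S) (w := w) (p := fun i => |f i|) (v := 1 - ∑ i ∈ S, w i) (q := 0)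
    (fun i _ => hw i) (by ring) (fun i _ => Set.mem_Ici.2 (abs_nonneg _)) (by linarith) (by simp)
  rw [Real.zero_rpow (by linarith), smul_zero, zero_add, zero_add] at h
  simp only [smul_eq_mul] at h
  calc _ ≤ (∑ i ∈ S, w i * |f i|) ^ p := by
        refine Real.rpow_le_rpow (abs_nonneg _) ((Finset.abs_sum_le_sum_abs _ _).trans (Finset.sum_le_sum fun i _ => ?_)) (by linarith)
        rw [abs_mul, abs_of_nonneg (hw i), mul_comm]
    _ ≤ _ := h.trans (le_of_eq (Finset.sum_congr rfl fun i _ => mul_comm _ _))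

omit hs in
lemma prod_upd (G : Fin d → ℝ → ℝ → ℝ) (i : Fin d) (t y : ℝ) (s x : Fin d → ℝ) :
    ∏ r, G r (Function.update s i t r) (Function.update x i y r) = G i t y * ∏ r ∈ Finset.univ.erase i, G r (s r) (x r) := by
  rw [← Finset.mul_prod_erase _ _ (Finset.mem_univ i)]
  congr 1
  · simp
  · refine Finset.prod_congr rfl fun r hr => ?_
    rw [Function.update_of_ne (Finset.mem_erase.1 hr).1, Function.update_of_ne (Finset.mem_erase.1 hr).1]

lemma upd_pos {i : Fin d} {t : ℝ} (ht : 0 < t) : ∀ r, 0 < Function.update s i t r := by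
  intro r; by_cases h : r = i
  · subst h; simpa using ht
  · rw [Function.update_of_ne h]; exact hs r

lemma IAl_step (S : Finset (ZLat d)) (f g : ZLat d → ℝ) {a : ℝ × ℝ → ℝ} (hconv : ConvexOn ℝ Set.univ a)
    (hcont : Continuous a) (h0 : ∀ z, 0 ≤ a z) (i : Fin d) {t : ℝ} (ht : s i ≤ t) :
    ∫⁻ x, ENNReal.ofReal (TT (Function.update s i t) x * a (FF S f (Function.update s i t) x, FF S g (Function.update s i t) x)) ≤
    ∫⁻ x, ENNReal.ofReal (TT s x * a (FF S f s x, FF S g s x)) := by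
  have hm : ∀ s : Fin d → ℝ, (∀ r, 0 < s r) → Measurable (fun x => ENNReal.ofReal (TT s x * a (FF S f s x, FF S g s x))) := fun s hs =>
    ((TT_cont hs).mul (hcont.comp ((FF_cont hs S f).prodMk (FF_cont hs S g)))).measurable.ennreal_ofReal
  have ht0 : 0 < t := (hs i).trans_le ht
  have key : ∀ t x, ∫⁻ y, ENNReal.ofReal (TT (Function.update s i t) (Function.update x i y) *
        a (FF S f (Function.update s i t) (Function.update x i y), FF S g (Function.update s i t) (Function.update x i y))) =
      ENNReal.ofReal (∏ r ∈ Finset.univ.erase i, th (s r) (x r)) *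
        ∫⁻ y, ENNReal.ofReal (th t y * a (∑ m ∈ S, (f m * ∏ r ∈ Finset.univ.erase i, pr (s r) (m r) (x r)) * pr t (m i) y,
          ∑ m ∈ S, (g m * ∏ r ∈ Finset.univ.erase i, pr (s r) (m r) (x r)) * pr t (m i) y)) := by
    intro t x
    rw [← lintegral_const_mul' _ _ ENNReal.ofReal_ne_top]
    congr 1; ext y
    rw [← ENNReal.ofReal_mul (Finset.prod_nonneg fun r _ => (th_pos (hs r) _).le)]
    have hF : ∀ f : ZLat d → ℝ, FF S f (Function.update s i t) (Function.update x i y) =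
        ∑ m ∈ S, (f m * ∏ r ∈ Finset.univ.erase i, pr (s r) (m r) (x r)) * pr t (m i) y := by
      intro f; unfold FF PP
      refine Finset.sum_congr rfl fun m _ => ?_
      rw [prod_upd (fun r t y => pr t (m r) y)]; ring
    rw [hF, hF, TT, prod_upd (fun _ t y => th t y)]
    congr 1; ring
  rw [volume_pi, lintegral_eq_lmarginal_univ (0 : Fin d → ℝ), lintegral_eq_lmarginal_univ (0 : Fin d → ℝ),
    lmarginal_erase' _ (hm _ (upd_pos hs ht0)) (Finset.mem_univ i), lmarginal_erase' _ (hm _ hs) (Finset.mem_univ i)]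
  refine lmarginal_mono (fun x => ?_) _
  simp only
  have k2 := key (s i) x
  rw [Function.update_eq_self] at k2
  rw [key, k2]
  exact mul_le_mul' le_rfl (lemJ (hs i) ht S (fun m => m i) _ _ hconv hcont h0)

end

end Th
end
end

section
open MeasureTheory Real Filter Topology
noncomputable section
namespace Th

def psi (p q x y : ℝ) : ℝ := (p-1)*(|x|^p/p+|y|^q/q)
def aa (p σ : ℝ) (z : ℝ × ℝ) : ℝ := Bell.phi p z.1 z.2 + σ * (z.1 * z.2)

section
variable {d : ℕ} {p q : ℝ}

lemma psi_FF (hp : 2 ≤ p) (hpq : p.HolderConjugate q) {s : Fin d → ℝ} (hs : ∀ r, 0 < s r) (S : Finset (ZLat d)) (f g : ZLat d → ℝ) (x : Fin d → ℝ) :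
    psi p q (FF S f s x) (FF S g s x) ≤ ∑ m ∈ S, psi p q (f m) (g m) * PP s m x := by
  have h1 := w_jensen S (fun m => PP s m x) f (fun m => PP_nonneg hs m x) (PP_sum_le hs S x) hpq.lt.le
  have h2 := w_jensen S (fun m => PP s m x) g (fun m => PP_nonneg hs m x) (PP_sum_le hs S x) hpq.symm.lt.le
  have e : ∑ m ∈ S, psi p q (f m) (g m) * PP s m x =
      (p-1) * ((∑ m ∈ S, |f m|^p * PP s m x)/p + (∑ m ∈ S, |g m|^q * PP s m x)/q) := by
    unfold psi
    rw [Finset.sum_div, Finset.sum_div, ← Finset.sum_add_distrib, Finset.mul_sum]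
    exact Finset.sum_congr rfl fun m _ => by ring
  rw [e]; unfold psi FF
  have := hpq.pos; have := hpq.symm.pos
  have : 0 ≤ p - 1 := by linarith
  gcongr

lemma aa_le (hp : 2 ≤ p) (hpq : p.HolderConjugate q) {σ : ℝ} (hσ : σ = 1 ∨ σ = -1) (z : ℝ × ℝ) :
    0 ≤ aa p σ z ∧ aa p σ z ≤ 2 * psi p q z.1 z.2 := by
  have h1 := Bell.phi_pm_nonneg hp hpq hσ z.1 z.2
  have h2 := Bell.phi_pm_nonneg hp hpq (σ := -σ) (by rcases hσ with h | h <;> simp [h]) z.1 z.2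
  have h3 := Bell.phi_le hp hpq z.1 z.2
  unfold aa psi
  constructor <;> linarith

lemma TTa_int (hp : 2 ≤ p) (hpq : p.HolderConjugate q) {s : Fin d → ℝ} (hs : ∀ r, 0 < s r) (S : Finset (ZLat d)) (f g : ZLat d → ℝ)
    {σ : ℝ} (hσ : σ = 1 ∨ σ = -1) : Integrable (fun x => TT s x * aa p σ (FF S f s x, FF S g s x)) := by
  have hc : Continuous (aa p σ) := Bell.phi_pm_cont hp hpq hσ
  have hi : Integrable (fun x => ∑ m ∈ S, 2 * psi p q (f m) (g m) * (TT s x * PP s m x)) :=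
    integrable_finsetSum _ fun m _ => ((TP_int hs m).1).const_mul _
  refine hi.mono' ((TT_cont hs).mul (hc.comp ((FF_cont hs S f).prodMk (FF_cont hs S g)))).aestronglyMeasurable (ae_of_all _ fun x => ?_)
  have h := aa_le hp hpq hσ (FF S f s x, FF S g s x)
  have hT := TT_pos hs x
  rw [Real.norm_of_nonneg (mul_nonneg hT.le h.1)]
  calc _ ≤ TT s x * (2 * ∑ m ∈ S, psi p q (f m) (g m) * PP s m x) := by
        refine mul_le_mul_of_nonneg_left (h.2.trans ?_) hT.le
        have := psi_FF hp hpq hs S f g x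
        simp only; linarith
    _ = _ := by rw [Finset.mul_sum, Finset.mul_sum]; exact Finset.sum_congr rfl fun m _ => by ring

lemma IA_mono (hp : 2 ≤ p) (hpq : p.HolderConjugate q) {s : Fin d → ℝ} (hs : ∀ r, 0 < s r) (S : Finset (ZLat d)) (f g : ZLat d → ℝ)
    {σ : ℝ} (hσ : σ = 1 ∨ σ = -1) (i : Fin d) {t : ℝ} (ht : s i ≤ t) :
    IA (aa p σ) S f g (Function.update s i t) ≤ IA (aa p σ) S f g s := by
  have hu := upd_pos hs (i := i) ((hs i).trans_le ht)
  have h := IAl_step hs S f g (Bell.phi_pm_convex hp hpq hσ) (Bell.phi_pm_cont hp hpq hσ)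
    (fun z => (aa_le hp hpq hσ z).1) i ht
  have i1 := TTa_int hp hpq hs S f g hσ
  have i2 := TTa_int hp hpq hu S f g hσ
  have n1 : ∀ {s : Fin d → ℝ}, (∀ r, 0 < s r) → 0 ≤ᵐ[volume] (fun x => TT s x * aa p σ (FF S f s x, FF S g s x)) := fun hs =>
    ae_of_all _ fun x => mul_nonneg (TT_pos hs x).le (aa_le hp hpq hσ _).1
  unfold IA
  rw [integral_eq_lintegral_of_nonneg_ae (n1 hu) i2.1, integral_eq_lintegral_of_nonneg_ae (n1 hs) i1.1]
  refine ENNReal.toReal_mono ?_ h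
  rw [← ofReal_integral_eq_lintegral_ofReal i1 (n1 hs)]
  exact ENNReal.ofReal_ne_top

def WW (p : ℝ) (S : Finset (ZLat d)) (f g : ZLat d → ℝ) (s : Fin d → ℝ) : ℝ := (IA (aa p 1) S f g s + IA (aa p (-1)) S f g s) / 2

lemma WW_nonneg (hp : 2 ≤ p) (hpq : p.HolderConjugate q) {s : Fin d → ℝ} (hs : ∀ r, 0 < s r) (S : Finset (ZLat d)) (f g : ZLat d → ℝ) :
    0 ≤ WW p S f g s := by
  have h : ∀ {σ : ℝ}, (σ = 1 ∨ σ = -1) → 0 ≤ IA (aa p σ) S f g s := fun hσ =>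
    integral_nonneg fun x => mul_nonneg (TT_pos hs x).le (aa_le hp hpq hσ _).1
  unfold WW
  linarith [h (Or.inl rfl), h (Or.inr rfl)]

lemma WW_le (hp : 2 ≤ p) (hpq : p.HolderConjugate q) {s : Fin d → ℝ} (hs : ∀ r, 0 < s r) (S : Finset (ZLat d)) (f g : ZLat d → ℝ) :
    WW p S f g s ≤ ∑ m ∈ S, psi p q (f m) (g m) := by
  unfold WW IA
  rw [← integral_add (TTa_int hp hpq hs S f g (Or.inl rfl)) (TTa_int hp hpq hs S f g (Or.inr rfl))]
  have e : ∑ m ∈ S, psi p q (f m) (g m) = (∫ x, ∑ m ∈ S, 2 * psi p q (f m) (g m) * (TT s x * PP s m x)) / 2 := by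
    rw [integral_finsetSum _ fun m _ => ((TP_int hs m).1).const_mul _, Finset.sum_div]
    refine Finset.sum_congr rfl fun m _ => ?_
    rw [integral_const_mul, (TP_int hs m).2]; ring
  rw [e]
  refine div_le_div_of_nonneg_right (integral_mono ((TTa_int hp hpq hs S f g (Or.inl rfl)).add (TTa_int hp hpq hs S f g (Or.inr rfl)))
    (integrable_finsetSum _ fun m _ => ((TP_int hs m).1).const_mul _) fun x => ?_) (by norm_num)
  have h := psi_FF hp hpq hs S f g x
  have h3 := Bell.phi_le hp hpq (FF S f s x) (FF S g s x)
  have hT := TT_pos hs x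
  calc _ = TT s x * (2 * Bell.phi p (FF S f s x) (FF S g s x)) := by simp only [aa]; ring
    _ ≤ TT s x * (2 * ∑ m ∈ S, psi p q (f m) (g m) * PP s m x) := by
        refine mul_le_mul_of_nonneg_left ?_ hT.le
        unfold psi at h ⊢; linarith
    _ = _ := by rw [Finset.mul_sum, Finset.mul_sum]; exact Finset.sum_congr rfl fun m _ => by ring

lemma IA_sub (hp : 2 ≤ p) (hpq : p.HolderConjugate q) {s : Fin d → ℝ} (hs : ∀ r, 0 < s r) (S : Finset (ZLat d)) (f g : ZLat d → ℝ) :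
    IA (aa p 1) S f g s - IA (aa p (-1)) S f g s = 2 * BB S f g s := by
  unfold IA
  rw [← integral_sub (TTa_int hp hpq hs S f g (Or.inl rfl)) (TTa_int hp hpq hs S f g (Or.inr rfl))]
  have e : ∀ x, TT s x * aa p 1 (FF S f s x, FF S g s x) - TT s x * aa p (-1) (FF S f s x, FF S g s x) =
      ∑ m ∈ S, ∑ n ∈ S, 2 * (f m * g n) * (TT s x * (PP s m x * PP s n x)) := by
    intro x
    have : TT s x * aa p 1 (FF S f s x, FF S g s x) - TT s x * aa p (-1) (FF S f s x, FF S g s x) =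
      2 * TT s x * (FF S f s x * FF S g s x) := by simp only [aa]; ring
    rw [this]; unfold FF
    rw [Finset.sum_mul_sum, Finset.mul_sum]
    refine Finset.sum_congr rfl fun m _ => ?_
    rw [Finset.mul_sum]
    exact Finset.sum_congr rfl fun n _ => by ring
  simp_rw [e]
  rw [integral_finsetSum _ fun m _ => integrable_finsetSum _ fun n _ => ((TPP_int hs m n).1).const_mul _]
  unfold BB
  rw [Finset.mul_sum]
  refine Finset.sum_congr rfl fun m _ => ?_
  rw [integral_finsetSum _ fun n _ => ((TPP_int hs m n).1).const_mul _, Finset.mul_sum]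
  refine Finset.sum_congr rfl fun n _ => ?_
  rw [integral_const_mul, (TPP_int hs m n).2]; ring

lemma WW_step (hp : 2 ≤ p) (hpq : p.HolderConjugate q) {s : Fin d → ℝ} (hs : ∀ r, 0 < s r) (S : Finset (ZLat d)) (f g : ZLat d → ℝ)
    (i : Fin d) {t : ℝ} (ht : s i ≤ t) :
    |BB S f g s - BB S f g (Function.update s i t)| ≤ WW p S f g s - WW p S f g (Function.update s i t) := by
  have hu := upd_pos hs (i := i) ((hs i).trans_le ht)
  have a1 := IA_sub hp hpq hs S f g
  have a2 := IA_sub hp hpq hu S f g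
  have b1 := IA_mono hp hpq hs S f g (Or.inl rfl) i ht
  have b2 := IA_mono hp hpq hs S f g (Or.inr rfl) i ht
  unfold WW
  rw [abs_le]; constructor <;> linarith

end

end Th
end
end

section
open MeasureTheory Real Filter Topology
noncomputable section
namespace Th

lemma prod_sub_le {ι : Type*} (R : Finset ι) (a b : ι → ℝ) (ha : ∀ i ∈ R, 0 ≤ a i ∧ a i ≤ 1) (hb : ∀ i ∈ R, 0 ≤ b i ∧ b i ≤ 1) :
    |∏ i ∈ R, a i - ∏ i ∈ R, b i| ≤ ∑ i ∈ R, |a i - b i| := by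
  classical
  induction R using Finset.induction_on with
  | empty => simp
  | insert i R hi ih =>
    rw [Finset.prod_insert hi, Finset.prod_insert hi, Finset.sum_insert hi]
    have ih' := ih (fun j hj => ha j (Finset.mem_insert_of_mem hj)) (fun j hj => hb j (Finset.mem_insert_of_mem hj))
    have h1 := ha i (Finset.mem_insert_self _ _)
    have hP0 : 0 ≤ ∏ j ∈ R, b j := Finset.prod_nonneg fun j hj => (hb j (Finset.mem_insert_of_mem hj)).1
    have hP1 : ∏ j ∈ R, b j ≤ 1 := Finset.prod_le_one (fun j hj => (hb j (Finset.mem_insert_of_mem hj)).1) fun j hj => (hb j (Finset.mem_insert_of_mem hj)).2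
    have e : a i * ∏ j ∈ R, a j - b i * ∏ j ∈ R, b j = a i * (∏ j ∈ R, a j - ∏ j ∈ R, b j) + (a i - b i) * ∏ j ∈ R, b j := by ring
    rw [e]
    refine (abs_add_le _ _).trans ?_
    rw [abs_mul, abs_mul, abs_of_nonneg h1.1, abs_of_nonneg hP0]
    have := mul_le_mul h1.2 ih' (abs_nonneg _) zero_le_one
    have := mul_le_of_le_one_right (abs_nonneg (a i - b i)) hP1
    linarith

lemma sub_quad {V : ℝ → ℝ} {a b C : ℝ} (hab : a ≤ b) (h : ∀ t h, a ≤ t → 0 ≤ h → V (t+h) ≤ V t + C*h^2) : V b ≤ V a := by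
  have key : ∀ N : ℕ, V b ≤ V a + C*(b-a)^2 * (1/((N:ℝ)+1)) := by
    intro N
    set δ := (b-a)/((N:ℝ)+1) with hδ
    have hN : (0:ℝ) < (N:ℝ)+1 := by positivity
    have hδ0 : 0 ≤ δ := div_nonneg (by linarith) hN.le
    have ind : ∀ k : ℕ, V (a + k*δ) ≤ V a + k*(C*δ^2) := by
      intro k
      induction k with
      | zero => simp
      | succ k ih =>
        have := h (a + k*δ) δ (by have : 0 ≤ k*δ := by positivity
                                  linarith) hδ0
        push_cast
        rw [show a + ((k:ℝ)+1)*δ = a + k*δ + δ by ring]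
        linarith
    have := ind (N+1)
    push_cast at this
    have e1 : a + ((N:ℝ)+1)*δ = b := by rw [hδ]; field_simp; ring
    have e2 : ((N:ℝ)+1)*(C*δ^2) = C*(b-a)^2 * (1/((N:ℝ)+1)) := by rw [hδ]; field_simp
    rwa [e1, e2] at this
  have ht := (tendsto_one_div_add_atTop_nhds_zero_nat (𝕜 := ℝ)).const_mul (C*(b-a)^2) |>.const_add (V a)
  rw [mul_zero, add_zero] at ht
  exact ge_of_tendsto' ht key

section
variable {d : ℕ}

lemma ivl {a b : ℝ} (ha : 0 < a) (hab : a ≤ b) {F : ℝ → ℝ} (hF : IntegrableOn F (Set.Ioi 0)) : IntervalIntegrable F volume a b :=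
  (intervalIntegrable_iff_integrableOn_Ioc_of_le hab).2 (hF.mono_set fun x hx => ha.trans hx.1)

lemma kq_step {t h : ℝ} (ht : 0 < t) (hh : 0 ≤ h) {s : Fin d → ℝ} (hs : ∀ r, t ≤ s r ∧ s r ≤ t+h) (i : Fin d) (hi : s i = t) (m : ZLat d) :
    |(∫ u in t..t+h, kq i u m) - (∏ r, ee (s r) (m r) - ∏ r, ee (Function.update s i (t+h) r) (m r))| ≤ d * D0^2 * h^2 := by
  set Q := ∏ r ∈ Finset.univ.erase i, ee (s r) (m r) with hQ
  have hth : t ≤ t + h := by linarith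
  have e1 : ∏ r, ee (s r) (m r) - ∏ r, ee (Function.update s i (t+h) r) (m r) = (∫ u in t..t+h, ep u (m i) * Q) := by
    rw [intervalIntegral.integral_mul_const]
    have h1 := intervalIntegral.integral_eq_sub_of_hasDerivAt (a := t) (b := t+h) (fun x hx => ee_hasDeriv (ht.trans_le (by
      rw [Set.uIcc_of_le hth] at hx; exact hx.1)) (m i)) (ivl ht hth (ep_int (m i))).neg
    rw [intervalIntegral.integral_neg] at h1
    have h2 := prod_upd (fun r t _ => ee t (m r)) i t 0 s 0
    have h3 := prod_upd (fun r t _ => ee t (m r)) i (t+h) 0 s 0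
    rw [h3]
    rw [← hi, Function.update_eq_self, hi] at h2
    rw [h2, ← hQ, ← sub_mul]; congr 1; linarith
  have e2 : (fun u => kq i u m) = fun u => ep u (m i) * ∏ r ∈ Finset.univ.erase i, ee u (m r) := by funext u; rw [kq_eq]
  rw [e1, ← intervalIntegral.integral_sub (ivl ht hth (kq_int i m)) (ivl ht hth ((ep_int (m i)).mul_const Q))]
  have hb := intervalIntegral.norm_integral_le_of_norm_le_const (a := t) (b := t+h) (C := d * D0^2 * h)
    (f := fun u => kq i u m - ep u (m i) * Q) (by
      intro u hu
      rw [Set.uIoc_of_le hth] at hu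
      have hu0 : 0 < u := ht.trans hu.1
      rw [kq_eq, ← mul_sub, norm_mul]
      have hP := prod_sub_le (Finset.univ.erase i) (fun r => ee u (m r)) (fun r => ee (s r) (m r))
        (fun r _ => ⟨ee_nonneg hu0 _, ee_le_one hu0 _⟩) (fun r _ => ⟨ee_nonneg (ht.trans_le (hs r).1) _, ee_le_one (ht.trans_le (hs r).1) _⟩)
      have hS : ∑ r ∈ Finset.univ.erase i, |ee u (m r) - ee (s r) (m r)| ≤ d * (D0 * h) := by
        calc _ ≤ ∑ r ∈ Finset.univ.erase i, D0 * h := Finset.sum_le_sum fun r _ =>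
              (ee_lip (ht.trans_le (hs r).1) hu0 _).trans (mul_le_mul_of_nonneg_left (by
                rw [abs_le]; constructor <;> linarith [hs r, hu.1, hu.2]) D0_nonneg)
          _ ≤ ∑ r : Fin d, D0 * h := Finset.sum_le_sum_of_subset_of_nonneg (Finset.erase_subset _ _) fun _ _ _ => mul_nonneg D0_nonneg hh
          _ = _ := by simp
      calc _ ≤ D0 * (d * (D0 * h)) := mul_le_mul (ep_le hu0 _) (hP.trans hS) (abs_nonneg _) D0_nonneg
        _ = _ := by ring)
  refine hb.trans (le_of_eq ?_)
  rw [add_sub_cancel_left, abs_of_nonneg hh]; ring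

def GG (S : Finset (ZLat d)) (f g : ZLat d → ℝ) (i : Fin d) (a b : ℝ) : ℝ :=
  ∑ m ∈ S, ∑ n ∈ S, f m * g n * ∫ u in a..b, kq i u (n - m)

lemma GG_step (S : Finset (ZLat d)) (f g : ZLat d → ℝ) {t h : ℝ} (ht : 0 < t) (hh : 0 ≤ h) {s : Fin d → ℝ}
    (hs : ∀ r, t ≤ s r ∧ s r ≤ t+h) (i : Fin d) (hi : s i = t) :
    |GG S f g i t (t+h) - (BB S f g s - BB S f g (Function.update s i (t+h)))| ≤ (∑ m ∈ S, ∑ n ∈ S, |f m * g n|) * (d * D0^2 * h^2) := by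
  unfold GG BB
  rw [← Finset.sum_sub_distrib, ← Finset.sum_sub_distrib, Finset.sum_mul]
  refine (Finset.abs_sum_le_sum_abs _ _).trans (Finset.sum_le_sum fun m _ => ?_)
  rw [← Finset.sum_sub_distrib, ← Finset.sum_sub_distrib, Finset.sum_mul]
  refine (Finset.abs_sum_le_sum_abs _ _).trans (Finset.sum_le_sum fun n _ => ?_)
  rw [← mul_sub, ← mul_sub, abs_mul]
  exact mul_le_mul_of_nonneg_left (kq_step ht hh hs i hi (n - m)) (abs_nonneg _)

lemma GG_diag {p q : ℝ} (hp : 2 ≤ p) (hpq : p.HolderConjugate q) (S : Finset (ZLat d)) (f g : ZLat d → ℝ) {t h : ℝ} (ht : 0 < t) (hh : 0 ≤ h)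
    {σ : Fin d → ℝ} (hσ : ∀ i, |σ i| ≤ 1) :
    ∑ i, σ i * GG S f g i t (t+h) ≤ WW p S f g (fun _ => t) - WW p S f g (fun _ => t+h) +
      d * (∑ m ∈ S, ∑ n ∈ S, |f m * g n|) * (d * D0^2) * h^2 := by
  set c : ℕ → Fin d → ℝ := fun j r => if r.val < j then t+h else t with hc
  have hcb : ∀ j r, t ≤ c j r ∧ c j r ≤ t+h := by
    intro j r; simp only [hc]; split_ifs <;> constructor <;> linarith
  have hcp : ∀ j r, 0 < c j r := fun j r => ht.trans_le (hcb j r).1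
  have hcu : ∀ i : Fin d, c (i.val+1) = Function.update (c i.val) i (t+h) := by
    intro i; funext r
    by_cases hr : r = i
    · subst hr; simp [hc]
    · have : r.val ≠ i.val := fun h => hr (Fin.ext h)
      rw [Function.update_of_ne hr]; simp only [hc]
      congr 1; apply propext; omega
  have hci : ∀ i : Fin d, c i.val i = t := by intro i; simp [hc]
  have h1 : ∀ i : Fin d, σ i * GG S f g i t (t+h) ≤ (WW p S f g (c i.val) - WW p S f g (c (i.val+1))) +
      (∑ m ∈ S, ∑ n ∈ S, |f m * g n|) * (d * D0^2 * h^2) := by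
    intro i
    have a1 := GG_step S f g ht hh (hcb i.val) i (hci i)
    have a2 := WW_step hp hpq (hcp i.val) S f g i (t := t+h) (hcb i.val i).2
    rw [← hcu] at a1 a2
    calc _ ≤ |σ i * GG S f g i t (t+h)| := le_abs_self _
      _ ≤ |GG S f g i t (t+h)| := by rw [abs_mul]; exact mul_le_of_le_one_left (abs_nonneg _) (hσ i)
      _ ≤ _ := by
        have := abs_add_le (BB S f g (c i.val) - BB S f g (c (i.val+1))) (GG S f g i t (t+h) - (BB S f g (c i.val) - BB S f g (c (i.val+1))))
        rw [add_sub_cancel] at this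
        linarith
  refine (Finset.sum_le_sum fun i _ => h1 i).trans (le_of_eq ?_)
  rw [Finset.sum_add_distrib, Fin.sum_univ_eq_sum_range (fun i => WW p S f g (c i) - WW p S f g (c (i+1))) d,
    Finset.sum_range_sub']
  have hc0 : c 0 = fun _ => t := by funext r; simp [hc]
  have hcd : c d = fun _ => t+h := by funext r; simp [hc]
  rw [hc0, hcd]; simp; ring

lemma GG_le {p q : ℝ} (hp : 2 ≤ p) (hpq : p.HolderConjugate q) (S : Finset (ZLat d)) (f g : ZLat d → ℝ) {a b : ℝ} (ha : 0 < a) (hab : a ≤ b)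
    {σ : Fin d → ℝ} (hσ : ∀ i, |σ i| ≤ 1) :
    ∑ i, σ i * GG S f g i a b ≤ ∑ m ∈ S, psi p q (f m) (g m) := by
  have hadd : ∀ i t h, a ≤ t → 0 ≤ h → GG S f g i a (t+h) = GG S f g i a t + GG S f g i t (t+h) := by
    intro i t h hat hh
    unfold GG
    rw [← Finset.sum_add_distrib]; refine Finset.sum_congr rfl fun m _ => ?_
    rw [← Finset.sum_add_distrib]; refine Finset.sum_congr rfl fun n _ => ?_
    rw [← mul_add, intervalIntegral.integral_add_adjacent_intervals (ivl ha hat (kq_int i _))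
      (ivl (ha.trans_le hat) (by linarith) (kq_int i _))]
  have h := sub_quad (V := fun t => WW p S f g (fun _ => t) + ∑ i, σ i * GG S f g i a t)
    (C := d * (∑ m ∈ S, ∑ n ∈ S, |f m * g n|) * (d * D0^2)) hab (by
      intro t h hat hh
      have := GG_diag hp hpq S f g (ha.trans_le hat) hh hσ
      simp only [hadd _ t h hat hh, mul_add, Finset.sum_add_distrib]
      linarith)
  have h0 : ∑ i, σ i * GG S f g i a a = 0 := by simp [GG]
  simp only [h0] at h
  have := WW_le hp hpq (s := fun _ : Fin d => a) (fun _ => ha) S f g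
  have := WW_nonneg hp hpq (s := fun _ : Fin d => b) (fun _ => ha.trans_le hab) S f g
  linarith

lemma thmU0 {p q : ℝ} (hp : 2 ≤ p) (hpq : p.HolderConjugate q) (S : Finset (ZLat d)) (f g : ZLat d → ℝ)
    {σ : Fin d → ℝ} (hσ : ∀ i, |σ i| ≤ 1) :
    ∑ m ∈ S, ∑ n ∈ S, f m * g n * (∑ i, σ i * probK d i i (n - m)) ≤ ∑ m ∈ S, psi p q (f m) (g m) := by
  set A : ℕ → Set ℝ := fun N => Set.Ioc (1/((N:ℝ)+1)) ((N:ℝ)+1) with hA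
  have hAU : ⋃ N, A N = Set.Ioi 0 := by
    ext x; simp only [hA, Set.mem_iUnion, Set.mem_Ioc, Set.mem_Ioi]
    constructor
    · rintro ⟨N, h, _⟩; exact lt_trans (by positivity) h
    · intro hx
      obtain ⟨N, hN⟩ := exists_nat_gt (max x (1/x))
      refine ⟨N, ?_, by linarith [le_max_left x (1/x)]⟩
      rw [one_div_lt (by positivity) hx]; linarith [le_max_right x (1/x)]
  have hAm : Monotone A := fun M N h => Set.Ioc_subset_Ioc (by gcongr) (by gcongr)
  have ht : ∀ (i : Fin d) m, Tendsto (fun N : ℕ => ∫ u in (1/((N:ℝ)+1))..((N:ℝ)+1), kq i u m) atTop (𝓝 (∫ u in Set.Ioi 0, kq i u m)) := by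
    intro i m
    have := tendsto_setIntegral_of_monotone (μ := volume) (f := fun u => kq i u m) (fun N => measurableSet_Ioc) hAm (by rw [hAU]; exact kq_int i m)
    rw [hAU] at this
    refine this.congr fun N => ?_
    rw [intervalIntegral.integral_of_le]
    rw [div_le_iff₀ (by positivity)]; nlinarith [(Nat.cast_nonneg N : (0:ℝ) ≤ N)]
  have hlim : Tendsto (fun N : ℕ => ∑ i, (-σ i) * GG S f g i (1/((N:ℝ)+1)) ((N:ℝ)+1)) atTop
      (𝓝 (∑ i, (-σ i) * ∑ m ∈ S, ∑ n ∈ S, f m * g n * ∫ u in Set.Ioi 0, kq i u (n - m))) :=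
    tendsto_finsetSum _ fun i _ => (tendsto_finsetSum _ fun m _ => tendsto_finsetSum _ fun n _ => (ht i _).const_mul _).const_mul _
  have hfin := le_of_tendsto' hlim fun N => GG_le hp hpq S f g (by positivity) (by
    rw [div_le_iff₀ (by positivity)]; nlinarith [(Nat.cast_nonneg N : (0:ℝ) ≤ N)]) (σ := fun i => -σ i) (fun i => by rw [abs_neg]; exact hσ i)
  refine le_trans (le_of_eq ?_) hfin
  simp_rw [Finset.mul_sum]
  symm
  rw [Finset.sum_comm]
  refine Finset.sum_congr rfl fun m _ => ?_
  rw [Finset.sum_comm]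
  refine Finset.sum_congr rfl fun n _ => Finset.sum_congr rfl fun i _ => ?_
  rw [probK_eq]; ring

end

end Th
end
end

section
open MeasureTheory Real Filter Topology
noncomputable section
namespace Th

def BndK {d : ℕ} (K : ZLat d → ℝ) (p q C : ℝ) : Prop := ∀ (S : Finset (ZLat d)) (f g : ZLat d → ℝ),
  ∑ m ∈ S, ∑ n ∈ S, f m * g n * K (n - m) ≤ C * (∑ m ∈ S, |f m|^p)^(1/p) * (∑ n ∈ S, |g n|^q)^(1/q)

section
variable {d : ℕ} {p q : ℝ}

lemma kq_even (i : Fin d) (s : ℝ) (m : ZLat d) : kq i s (-m) = kq i s m := by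
  unfold kq; refine Finset.prod_congr rfl fun r _ => ?_
  rw [Pi.neg_apply, ee_neg, ep_neg]

lemma probK_even (i : Fin d) (m : ZLat d) : probK d i i (-m) = probK d i i m := by
  rw [probK_eq, probK_eq]; simp_rw [kq_even]

lemma BndK.swap {K : ZLat d → ℝ} {C : ℝ} (h : BndK K p q C) (he : ∀ m, K (-m) = K m) : BndK K q p C := by
  intro S f g
  rw [Finset.sum_comm]
  refine le_trans (le_of_eq ?_) ((h S g f).trans (le_of_eq (by ring)))
  refine Finset.sum_congr rfl fun m _ => Finset.sum_congr rfl fun n _ => ?_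
  rw [← he, neg_sub]; ring

lemma rpow_zero_of {S : Finset (ZLat d)} {f : ZLat d → ℝ} {r : ℝ} (hr : 0 < r) (h : ∑ m ∈ S, |f m|^r = 0) : ∀ m ∈ S, f m = 0 := fun m hm => by
  have := (Finset.sum_eq_zero_iff_of_nonneg (fun m _ => Real.rpow_nonneg (abs_nonneg (f m)) r)).1 h m hm
  exact abs_eq_zero.1 ((Real.rpow_eq_zero (abs_nonneg _) hr.ne').1 this)

lemma thmU2 (hp : 2 ≤ p) (hpq : p.HolderConjugate q) {σ : Fin d → ℝ} (hσ : ∀ i, |σ i| ≤ 1) :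
    BndK (fun m => ∑ i, σ i * probK d i i m) p q (p-1) := by
  intro S f g
  have hq0 := hpq.symm.pos
  have hp0 := hpq.pos
  have hA0 : 0 ≤ ∑ m ∈ S, |f m|^p := Finset.sum_nonneg fun m _ => by positivity
  have hB0 : 0 ≤ ∑ m ∈ S, |g m|^q := Finset.sum_nonneg fun m _ => by positivity
  have hR : 0 ≤ (p-1) * (∑ m ∈ S, |f m|^p)^(1/p) * (∑ n ∈ S, |g n|^q)^(1/q) := by
    have : 0 ≤ p - 1 := by linarith
    positivity
  rcases hA0.eq_or_lt with hA | hA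
  · have := rpow_zero_of hp0 hA.symm
    refine le_trans (le_of_eq ?_) hR
    exact Finset.sum_eq_zero fun m hm => Finset.sum_eq_zero fun n _ => by rw [this m hm]; ring
  rcases hB0.eq_or_lt with hB | hB
  · have := rpow_zero_of hq0 hB.symm
    refine le_trans (le_of_eq ?_) hR
    exact Finset.sum_eq_zero fun m _ => Finset.sum_eq_zero fun n hn => by rw [this n hn]; ring
  set A := ∑ m ∈ S, |f m|^p
  set B := ∑ m ∈ S, |g m|^q
  have hα : 0 < A^(1/p) := by positivity
  have hβ : 0 < B^(1/q) := by positivity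
  have h := thmU0 hp hpq S (fun m => (A^(1/p))⁻¹ * f m) (fun m => (B^(1/q))⁻¹ * g m) hσ
  have e1 : ∑ m ∈ S, psi p q ((A^(1/p))⁻¹ * f m) ((B^(1/q))⁻¹ * g m) = p - 1 := by
    have k : ∀ {r X : ℝ} (x : ℝ), 0 < r → 0 < X → |(X^(1/r))⁻¹ * x|^r = X⁻¹ * |x|^r := by
      intro r X x hr hX
      rw [abs_mul, Real.mul_rpow (abs_nonneg _) (abs_nonneg _), abs_of_nonneg (by positivity), Real.inv_rpow (by positivity),
        ← Real.rpow_mul hX.le, one_div_mul_cancel hr.ne', Real.rpow_one]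
    unfold psi
    simp_rw [k _ hp0 hA, k _ hq0 hB]
    rw [← Finset.mul_sum, Finset.sum_add_distrib, ← Finset.sum_div, ← Finset.sum_div, ← Finset.mul_sum, ← Finset.mul_sum,
      inv_mul_cancel₀ hA.ne', inv_mul_cancel₀ hB.ne', one_div, one_div, hpq.inv_add_inv_eq_one, mul_one]
  have e2 : ∑ m ∈ S, ∑ n ∈ S, (A^(1/p))⁻¹ * f m * ((B^(1/q))⁻¹ * g n) * (∑ i, σ i * probK d i i (n - m)) =
      (A^(1/p) * B^(1/q))⁻¹ * ∑ m ∈ S, ∑ n ∈ S, f m * g n * (∑ i, σ i * probK d i i (n - m)) := by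
    rw [Finset.mul_sum]; refine Finset.sum_congr rfl fun m _ => ?_
    rw [Finset.mul_sum]; refine Finset.sum_congr rfl fun n _ => ?_
    rw [mul_inv]; ring
  rw [e1, e2, inv_mul_le_iff₀ (by positivity)] at h
  linarith

lemma pstar_of (hpq : p.HolderConjugate q) : (2 ≤ p → pstar p = p) ∧ (p < 2 → 2 ≤ q ∧ pstar p = q) := by
  have hq : q = p/(p-1) := hpq.conjugate_eq
  have h1 := hpq.lt
  have hp1 : 0 < p - 1 := by linarith
  unfold pstar
  rw [hq]
  constructor
  · intro h; rw [max_eq_left]; rw [div_le_iff₀ hp1]; nlinarith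
  · intro h
    refine ⟨by rw [le_div_iff₀ hp1]; linarith, ?_⟩
    rw [max_eq_right]; rw [le_div_iff₀ hp1]; nlinarith

lemma thmU (hpq : p.HolderConjugate q) {σ : Fin d → ℝ} (hσ : ∀ i, |σ i| ≤ 1) :
    BndK (fun m => ∑ i, σ i * probK d i i m) p q (pstar p - 1) := by
  rcases le_or_gt 2 p with h | h
  · rw [(pstar_of hpq).1 h]; exact thmU2 h hpq hσ
  · obtain ⟨h1, h2⟩ := (pstar_of hpq).2 h
    rw [h2]; exact (thmU2 h1 hpq.symm hσ).swap fun m => by simp only [probK_even]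

section
variable {K : ZLat d → ℝ} {C : ℝ}

lemma BndK.pair (h : BndK K p q C) (hpq : p.HolderConjugate q) (M N : Finset (ZLat d)) (f g : ZLat d → ℝ) :
    ∑ n ∈ N, g n * ∑ m ∈ M, K (n - m) * f m ≤ C * (∑ m ∈ M, |f m|^p)^(1/p) * (∑ n ∈ N, |g n|^q)^(1/q) := by
  classical
  have h1 := h (M ∪ N) (fun m => if m ∈ M then f m else 0) (fun n => if n ∈ N then g n else 0)
  have k : ∀ {r : ℝ} (A : Finset (ZLat d)) (f : ZLat d → ℝ), 0 < r → A ⊆ M ∪ N → ∑ m ∈ M ∪ N, |if m ∈ A then f m else 0|^r = ∑ m ∈ A, |f m|^r := by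
    intro r A f hr hA
    rw [← Finset.sum_subset hA fun m _ hm => by rw [if_neg hm, abs_zero, Real.zero_rpow hr.ne']]
    exact Finset.sum_congr rfl fun m hm => by rw [if_pos hm]
  rw [k M f hpq.pos Finset.subset_union_left, k N g hpq.symm.pos Finset.subset_union_right] at h1
  refine le_trans (le_of_eq ?_) h1
  rw [Finset.sum_comm, ← Finset.sum_subset (Finset.subset_union_right (s₁ := M)) (fun n _ hn => Finset.sum_eq_zero fun m _ => by rw [if_neg hn]; ring)]
  refine Finset.sum_congr rfl fun n hn => ?_
  rw [Finset.mul_sum, ← Finset.sum_subset (Finset.subset_union_left (s₂ := N)) (fun m _ hm => by rw [if_neg hm]; ring)]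
  refine Finset.sum_congr rfl fun m hm => ?_
  rw [if_pos hn, if_pos hm]; ring

lemma part_le {f : ZLat d → ℝ} (hp : 0 < p) (hf : MemLpLat d p f) (M : Finset (ZLat d)) : (∑ m ∈ M, |f m|^p)^(1/p) ≤ lpN d p f :=
  Real.rpow_le_rpow (Finset.sum_nonneg fun m _ => by positivity) (hf.sum_le_tsum M fun m _ => by positivity) (by positivity)

lemma BndK.summable (h : BndK K p q C) (hpq : p.HolderConjugate q) (hC : 0 ≤ C) {f : ZLat d → ℝ} (hf : MemLpLat d p f) (n : ZLat d) :
    Summable fun m => K (n - m) * f m := by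
  refine Summable.of_abs (summable_of_sum_le (c := C * lpN d p f) (fun m => abs_nonneg _) fun M => ?_)
  have h1 := h.pair hpq M {n} (fun m => SignType.sign (K (n-m) * f m) * f m) (fun _ => 1)
  simp only [Finset.sum_singleton, one_mul, abs_one, Real.one_rpow, mul_one] at h1
  have e : ∀ m, K (n - m) * (SignType.sign (K (n-m) * f m) * f m) = |K (n-m) * f m| := by
    intro m; rw [← sign_mul_self (K (n-m) * f m)]; ring
  simp_rw [e] at h1
  refine h1.trans (mul_le_mul_of_nonneg_left (le_trans (Real.rpow_le_rpow (Finset.sum_nonneg fun m _ => by positivity)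
    (Finset.sum_le_sum fun m _ => Real.rpow_le_rpow (abs_nonneg _) ?_ hpq.pos.le) (by have := hpq.pos; positivity)) (part_le hpq.pos hf M)) hC)
  rw [abs_mul]; refine mul_le_of_le_one_left (abs_nonneg _) ?_
  rcases SignType.sign (K (n-m) * f m) with _ | _ | _ <;> simp

lemma lp_dual (hpq : p.HolderConjugate q) {A : ℝ} (hA : 0 ≤ A) (N : Finset (ZLat d)) (F : ZLat d → ℝ)
    (h : ∀ g : ZLat d → ℝ, ∑ n ∈ N, g n * F n ≤ A * (∑ n ∈ N, |g n|^q)^(1/q)) : ∑ n ∈ N, |F n|^p ≤ A^p := by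
  set Y := ∑ n ∈ N, |F n|^p with hY
  have hY0 : 0 ≤ Y := Finset.sum_nonneg fun m _ => by positivity
  rcases hY0.eq_or_lt with h0 | h0
  · rw [← h0]; positivity
  have h1 := h fun n => SignType.sign (F n) * |F n|^(p-1)
  have hp1 : p - 1 ≠ 0 := by have := hpq.lt; intro h; linarith
  have e1 : ∑ n ∈ N, SignType.sign (F n) * |F n|^(p-1) * F n = Y := by
    refine Finset.sum_congr rfl fun n _ => ?_
    rw [mul_right_comm, sign_mul_self]
    rcases (abs_nonneg (F n)).eq_or_lt with h | h
    · rw [← h, Real.zero_rpow hpq.ne_zero, zero_mul]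
    · rw [← Real.rpow_one_add' h.le (by have := hpq.pos; intro; linarith)]; congr 1; ring
  have e2 : ∑ n ∈ N, |(SignType.sign (F n) : ℝ) * |F n|^(p-1)|^q = Y := by
    refine Finset.sum_congr rfl fun n _ => ?_
    rcases eq_or_ne (F n) 0 with h | h
    · simp [h, Real.zero_rpow hpq.ne_zero, Real.zero_rpow hpq.symm.ne_zero]
    · have : |(SignType.sign (F n) : ℝ)| = 1 := by
        rcases lt_or_gt_of_ne h with h | h <;> simp [h]
      rw [abs_mul, this, one_mul, abs_of_nonneg (by positivity), ← Real.rpow_mul (abs_nonneg _), hpq.sub_one_mul_conj]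
  rw [e1, e2] at h1
  have h2 : Y^(1/p) ≤ A := by
    have e3 : Y = Y^(1/p) * Y^(1/q) := by
      rw [← Real.rpow_add h0, one_div, one_div, hpq.inv_add_inv_eq_one, Real.rpow_one]
    have : 0 < Y^(1/q) := by positivity
    by_contra hc; push Not at hc
    nlinarith
  calc Y = (Y^(1/p))^p := by rw [← Real.rpow_mul hY0, one_div_mul_cancel hpq.ne_zero, Real.rpow_one]
    _ ≤ _ := Real.rpow_le_rpow (by positivity) h2 hpq.pos.le

variable {T : (ZLat d → ℝ) → ZLat d → ℝ}

lemma BndK.apply (h : BndK K p q C) (hpq : p.HolderConjugate q) (hC : 0 ≤ C) {f : ZLat d → ℝ} (hf : MemLpLat d p f)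
    (hT : ∀ n, T f n = ∑' m, K (n - m) * f m) : MemLpLat d p (T f) ∧ lpN d p (T f) ≤ C * lpN d p f := by
  have hl0 : 0 ≤ lpN d p f := Real.rpow_nonneg (tsum_nonneg fun n => by positivity) _
  have hp0 := hpq.pos
  have key : ∀ N : Finset (ZLat d), ∑ n ∈ N, |T f n|^p ≤ (C * lpN d p f)^p := by
    intro N
    refine lp_dual hpq (by positivity) N _ fun g => ?_
    have ht : Tendsto (fun M : Finset (ZLat d) => ∑ n ∈ N, g n * ∑ m ∈ M, K (n - m) * f m) atTop (𝓝 (∑ n ∈ N, g n * T f n)) :=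
      tendsto_finsetSum _ fun n _ => by rw [hT]; exact (h.summable hpq hC hf n).hasSum.const_mul _
    refine le_of_tendsto' ht fun M => (h.pair hpq M N f g).trans ?_
    have := part_le hpq.pos hf M
    have : 0 ≤ (∑ n ∈ N, |g n|^q)^(1/q) := Real.rpow_nonneg (Finset.sum_nonneg fun m _ => by positivity) _
    gcongr
  have hm : MemLpLat d p (T f) := summable_of_sum_le (fun n => by positivity) key
  refine ⟨hm, ?_⟩
  calc _ ≤ ((C * lpN d p f)^p)^(1/p) := Real.rpow_le_rpow (tsum_nonneg fun n => by positivity) (hm.tsum_le_of_sum_le key) (by positivity)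
    _ = _ := by rw [← Real.rpow_mul (mul_nonneg hC hl0), mul_one_div_cancel hp0.ne', Real.rpow_one]

lemma BndK.opN_le (h : BndK K p q C) (hpq : p.HolderConjugate q) (hC : 0 ≤ C)
    (hT : ∀ f, MemLpLat d p f → ∀ n, T f n = ∑' m, K (n - m) * f m) : opN d p T ≤ C := by
  refine Real.sSup_le ?_ hC
  rintro c ⟨f, hf, h1, rfl⟩
  have := (h.apply hpq hC hf (hT f hf)).2
  rwa [h1, mul_one] at this

lemma BndK.opN_bnd (h : BndK K p q C) (hpq : p.HolderConjugate q) (hC : 0 ≤ C)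
    (hT : ∀ f, MemLpLat d p f → ∀ n, T f n = ∑' m, K (n - m) * f m) : BndK K p q (opN d p T) := by
  classical
  have hp0 := hpq.pos
  have hq0 := hpq.symm.pos
  intro S f g
  have hA0 : 0 ≤ ∑ m ∈ S, |f m|^p := Finset.sum_nonneg fun m _ => by positivity
  rcases hA0.eq_or_lt with hA | hA
  · have := rpow_zero_of hp0 hA.symm
    rw [← hA, Real.zero_rpow (by positivity), mul_zero, zero_mul]
    exact le_of_eq (Finset.sum_eq_zero fun m hm => Finset.sum_eq_zero fun n _ => by rw [this m hm]; ring)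
  set A := ∑ m ∈ S, |f m|^p with hAdef
  have hα : 0 < A^(1/p) := by positivity
  set F : ZLat d → ℝ := fun m => if m ∈ S then (A^(1/p))⁻¹ * f m else 0 with hF
  have hz : ∀ m ∉ S, |F m|^p = 0 := fun m hm => by simp only [hF]; rw [if_neg hm, abs_zero, Real.zero_rpow hp0.ne']
  have hmem : MemLpLat d p F := summable_of_ne_finset_zero (s := S) hz
  have hn : lpN d p F = 1 := by
    unfold lpN
    rw [tsum_eq_sum hz]
    have : ∑ m ∈ S, |F m|^p = 1 := by
      calc _ = ∑ m ∈ S, A⁻¹ * |f m|^p := Finset.sum_congr rfl fun m hm => by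
            simp only [hF]
            rw [if_pos hm, abs_mul, Real.mul_rpow (abs_nonneg _) (abs_nonneg _), abs_of_nonneg (by positivity), Real.inv_rpow (by positivity),
              ← Real.rpow_mul hA.le, one_div_mul_cancel hp0.ne', Real.rpow_one]
        _ = 1 := by rw [← Finset.mul_sum, ← hAdef, inv_mul_cancel₀ hA.ne']
    rw [this, Real.one_rpow]
  have hTF := h.apply hpq hC hmem (hT F hmem)
  have hle : lpN d p (T F) ≤ opN d p T := by
    refine le_csSup ⟨C, ?_⟩ ⟨F, hmem, hn, rfl⟩
    rintro c ⟨f, hf, h1, rfl⟩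
    have := (h.apply hpq hC hf (hT f hf)).2
    rwa [h1, mul_one] at this
  have hTe : ∀ n, T F n = (A^(1/p))⁻¹ * ∑ m ∈ S, K (n - m) * f m := by
    intro n
    rw [hT F hmem, tsum_eq_sum (s := S) (fun m hm => by simp only [hF]; rw [if_neg hm, mul_zero]), Finset.mul_sum]
    exact Finset.sum_congr rfl fun m hm => by simp only [hF]; rw [if_pos hm]; ring
  have hH := Real.inner_le_Lp_mul_Lq S (T F) g hpq
  have h1 : ∑ n ∈ S, T F n * g n = (A^(1/p))⁻¹ * ∑ m ∈ S, ∑ n ∈ S, f m * g n * K (n - m) := by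
    rw [Finset.sum_comm, Finset.mul_sum]
    refine Finset.sum_congr rfl fun n _ => ?_
    rw [hTe, mul_assoc, Finset.sum_mul]; congr 1
    exact Finset.sum_congr rfl fun m _ => by ring
  rw [h1, inv_mul_le_iff₀ hα] at hH
  have h3 := (part_le hp0 hTF.1 S).trans hle
  have : 0 ≤ (∑ n ∈ S, |g n|^q)^(1/q) := Real.rpow_nonneg (Finset.sum_nonneg fun m _ => by positivity) _
  calc _ ≤ _ := hH
    _ ≤ A^(1/p) * (opN d p T * (∑ n ∈ S, |g n|^q)^(1/q)) := by gcongr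
    _ = _ := by ring

end
end
end Th
end
end

section
open MeasureTheory Real Filter Topology
noncomputable section
namespace Th

section
variable {d : ℕ}

lemma box_sum (T : Finset (ZLat d)) (a : Fin d → ℤ → ℝ) (c : Fin d → ℝ) (h0 : ∀ r n, 0 ≤ a r n)
    (h : ∀ r (T : Finset ℤ), ∑ n ∈ T, a r n ≤ c r) : ∑ m ∈ T, ∏ r, a r (m r) ≤ ∏ r, c r := by
  classical
  calc _ ≤ ∑ m ∈ Fintype.piFinset (fun r => T.image fun m => m r), ∏ r, a r (m r) :=
        Finset.sum_le_sum_of_subset_of_nonneg (fun m hm => Fintype.mem_piFinset.2 fun r => Finset.mem_image_of_mem _ hm)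
          fun m _ _ => Finset.prod_nonneg fun r _ => h0 _ _
    _ = ∏ r, ∑ n ∈ T.image fun m => m r, a r n := (Finset.prod_univ_sum _ _).symm
    _ ≤ _ := Finset.prod_le_prod (fun r _ => Finset.sum_nonneg fun n _ => h0 _ _) fun r _ => h r _

lemma prod_diff_le (R : Finset (Fin d)) (a b : Fin d → ℝ) :
    |∏ i ∈ R, a i - ∏ i ∈ R, b i| ≤ ∑ l ∈ R, ∏ r ∈ R, if r = l then |a r - b r| else |a r| + |b r| := by
  induction R using Finset.induction_on with
  | empty => simp
  | insert i R hi ih =>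
    rw [Finset.prod_insert hi, Finset.prod_insert hi, Finset.sum_insert hi, Finset.prod_insert hi, if_pos rfl]
    have e1 : ∏ r ∈ R, (if r = i then |a r - b r| else |a r| + |b r|) = ∏ r ∈ R, (|a r| + |b r|) :=
      Finset.prod_congr rfl fun r hr => if_neg (by rintro rfl; exact hi hr)
    have e2 : ∀ l ∈ R, ∏ r ∈ insert i R, (if r = l then |a r - b r| else |a r| + |b r|) =
        (|a i| + |b i|) * ∏ r ∈ R, (if r = l then |a r - b r| else |a r| + |b r|) := fun l hl => by
      rw [Finset.prod_insert hi, if_neg (by rintro rfl; exact hi hl)]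
    rw [e1, Finset.sum_congr rfl e2, ← Finset.mul_sum]
    have h1 : |∏ j ∈ R, b j| ≤ ∏ r ∈ R, (|a r| + |b r|) := by
      rw [Finset.abs_prod]; exact Finset.prod_le_prod (fun _ _ => abs_nonneg _) fun r _ => by linarith [abs_nonneg (a r)]
    have e : a i * ∏ j ∈ R, a j - b i * ∏ j ∈ R, b j = (a i - b i) * ∏ j ∈ R, b j + a i * (∏ j ∈ R, a j - ∏ j ∈ R, b j) := by ring
    rw [e]
    refine (abs_add_le _ _).trans ?_
    rw [abs_mul, abs_mul]
    have := mul_le_mul_of_nonneg_left h1 (abs_nonneg (a i - b i))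
    have := mul_le_mul (show |a i| ≤ |a i| + |b i| by linarith [abs_nonneg (b i)]) ih (abs_nonneg _) (by positivity)
    linarith

lemma box_diff (T : Finset (ZLat d)) (a b : Fin d → ℤ → ℝ) (u : Fin d → ℝ) {ε : ℝ} 
    (h : ∀ r (T : Finset ℤ), ∑ n ∈ T, (|a r n| + |b r n|) ≤ u r) (h' : ∀ r (T : Finset ℤ), ∑ n ∈ T, |a r n - b r n| ≤ ε * u r) :
    ∑ m ∈ T, |∏ r, a r (m r) - ∏ r, b r (m r)| ≤ d * (ε * ∏ r, u r) := by
  calc _ ≤ ∑ m ∈ T, ∑ l, ∏ r, (if r = l then |a r (m r) - b r (m r)| else |a r (m r)| + |b r (m r)|) :=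
        Finset.sum_le_sum fun m _ => prod_diff_le _ _ _
    _ = ∑ l, ∑ m ∈ T, ∏ r, (if r = l then |a r (m r) - b r (m r)| else |a r (m r)| + |b r (m r)|) := Finset.sum_comm
    _ ≤ ∑ l : Fin d, ε * ∏ r, u r := Finset.sum_le_sum fun l _ => by
        have := box_sum T (fun r n => if r = l then |a r n - b r n| else |a r n| + |b r n|) (fun r => if r = l then ε * u r else u r)
          (fun r n => by split_ifs <;> positivity) (fun r T => by split_ifs; exacts [h' r T, h r T])
        refine this.trans (le_of_eq ?_)
        rw [← Finset.mul_prod_erase _ _ (Finset.mem_univ l), if_pos rfl, ← Finset.mul_prod_erase _ u (Finset.mem_univ l), mul_assoc]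
        rw [Finset.prod_congr rfl (g := u) (fun r hr => if_neg (Finset.mem_erase.1 hr).1)]
    _ = _ := by simp

def k0 (i : Fin d) (s : ℝ) (m : ZLat d) : ℝ := ∏ r, if r = i then -gp2 (2*s) (m r) else gp (2*s) (m r)
def gG (s : ℝ) (m : ZLat d) : ℝ := 1/(4*s^2) * ∏ r, gp (2*s) (m r)

lemma k0_eq (i : Fin d) {s : ℝ} (hs : 0 < s) (m : ZLat d) : k0 i s m = -(m i:ℝ)^2 * gG s m + 1/(2*s) * ∏ r, gp (2*s) (m r) := by
  unfold k0 gG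
  rw [← Finset.mul_prod_erase _ _ (Finset.mem_univ i), if_pos rfl, ← Finset.mul_prod_erase _ (fun r => gp (2*s) (m r)) (Finset.mem_univ i),
    Finset.prod_congr rfl (g := fun r => gp (2*s) (m r)) (fun r hr => if_neg (Finset.mem_erase.1 hr).1)]
  unfold gp2; field_simp; ring

lemma large_bd (i : Fin d) {s : ℝ} (hs : 16 ≤ s) (T : Finset (ZLat d)) :
    ∑ m ∈ T, |kq i s m - k0 i s m| ≤ (d * (4 * (51 * 3^(d-1)))) * (√s)⁻¹^3 := by
  obtain ⟨r1, r2, -⟩ := rs hs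
  have hs0 : 0 < s := by linarith
  set w := (√s)⁻¹
  have hU : ∏ r : Fin d, (if r = i then 51*w^2 else 3) = 51*w^2 * 3^(d-1) := by
    rw [← Finset.mul_prod_erase _ _ (Finset.mem_univ i), if_pos rfl,
      Finset.prod_congr rfl (g := fun _ => (3:ℝ)) (fun r hr => if_neg (Finset.mem_erase.1 hr).1)]
    simp
  have hw3 : w^3 ≤ w^2/4 := by nlinarith [sq_nonneg w]
  have key : ∀ (r : Fin d) (T : Finset ℤ), ∑ n ∈ T, (|if r = i then ep s n else ee s n| + |if r = i then -gp2 (2*s) n else gp (2*s) n|) ≤ (if r = i then 51*w^2 else 3) ∧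
      ∑ n ∈ T, |(if r = i then ep s n else ee s n) - (if r = i then -gp2 (2*s) n else gp (2*s) n)| ≤ 4*w*(if r = i then 51*w^2 else 3) := by
    intro r T
    split_ifs
    · have a1 := ep_diff hs T
      have a2 := ep0_l1 hs T
      refine ⟨?_, a1.trans (by nlinarith [pow_pos r1 3])⟩
      calc _ ≤ ∑ n ∈ T, (|ep s n - -gp2 (2*s) n| + 2 * |-gp2 (2*s) n|) := Finset.sum_le_sum fun n _ => by
            have := abs_sub_abs_le_abs_sub (ep s n) (-gp2 (2*s) n); linarith
        _ ≤ _ := by rw [Finset.sum_add_distrib, ← Finset.mul_sum]; linarith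
    · have a1 := ee_diff hs0 T
      have a2 : ∑ n ∈ T, |ee s n| ≤ 1 := by
        rw [Finset.sum_congr rfl fun n _ => abs_of_nonneg (ee_nonneg hs0 n)]
        exact sum_le_hasSum T (fun n _ => ee_nonneg hs0 n) (ee_hasSum hs0)
      refine ⟨?_, a1.trans (by linarith)⟩
      calc _ ≤ ∑ n ∈ T, (|ee s n - gp (2*s) n| + 2 * |ee s n|) := Finset.sum_le_sum fun n _ => by
            have := abs_sub_abs_le_abs_sub (gp (2*s) n) (ee s n); rw [abs_sub_comm] at this; linarith
        _ ≤ _ := by rw [Finset.sum_add_distrib, ← Finset.mul_sum]; linarith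
  have := box_diff T (fun r n => if r = i then ep s n else ee s n) (fun r n => if r = i then -gp2 (2*s) n else gp (2*s) n)
    (fun r => if r = i then 51*w^2 else 3) (ε := 4*w) (fun r T => (key r T).1) (fun r T => (key r T).2)
  rw [hU] at this
  refine this.trans (le_of_eq (by ring))

def zz (n : ℤ) : ℝ := if n = 0 then 1 else 1/(n:ℝ)^2
lemma zz_sum (T : Finset ℤ) : ∑ n ∈ T, zz n ≤ 1 + Z2 := by
  have : HasSum (fun n : ℤ => (if n = 0 then (1:ℝ) else 0) + 1/(n:ℝ)^2) (1 + Z2) := (hasSum_ite_eq (0:ℤ) (1:ℝ)).add Z2_summable.hasSum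
  refine (Finset.sum_le_sum fun n _ => ?_).trans (sum_le_hasSum T (fun n _ => by positivity) this)
  unfold zz; split_ifs with h <;> simp [h]
lemma zz_nonneg (n : ℤ) : 0 ≤ zz n := by unfold zz; split_ifs <;> positivity

lemma small_pt {s : ℝ} (hs : 0 < s) (hs16 : s ≤ 16) (i : Fin d) (m : ZLat d) :
    (m i:ℝ)^2 * gG s m ≤ ((d+2).factorial * 4^(d+1) * 4^d * 64^d) * ∏ r, zz (m r) := by
  set w := (√(2*π*(2*s)))⁻¹ with hw
  have hw0 : 0 < w := by positivity
  have hws : w * s ≤ 4 := by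
    have h1 : √s ≤ √(2*π*(2*s)) := Real.sqrt_le_sqrt (by nlinarith [Real.pi_gt_three])
    have h2 : √s ≤ 4 := by rw [Real.sqrt_le_left (by norm_num)]; linarith
    calc w * s ≤ (√s)⁻¹ * s := mul_le_mul_of_nonneg_right (inv_anti₀ (by positivity) h1) hs.le
      _ = √s := by rw [inv_mul_eq_div, Real.div_sqrt]
      _ ≤ 4 := h2
  have hE : ∀ n : ℤ, Real.exp (-(n:ℝ)^2/(2*(2*s))) ≤ 64 * zz n := by
    intro n; unfold zz
    split_ifs with h
    · simp [h]
    · have hn : (0:ℝ) < (n:ℝ)^2 := by positivity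
      rw [neg_div]
      calc _ ≤ 1/((n:ℝ)^2/(2*(2*s))) := exp_neg_le1 (by positivity)
        _ = (4*s) * (1/(n:ℝ)^2) := by field_simp; norm_num
        _ ≤ _ := by gcongr; linarith
  have hEi : ∀ n : ℤ, (n:ℝ)^2 * (1/(4*s^2)) * Real.exp (-(n:ℝ)^2/(2*(2*s))) ≤ ((d+2).factorial * 4^(d+1) * s^d) * zz n := by
    intro n
    rcases eq_or_ne n 0 with rfl | h
    · simp [zz]; positivity
    rw [zz, if_neg h]
    have hn1 : (1:ℝ) ≤ (n:ℝ)^2 := by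
      have : (1:ℤ) ≤ n^2 := (by positivity : 0 < n^2)
      exact_mod_cast this
    set v := (n:ℝ)^2/(4*s) with hv
    have hv0 : 0 < v := by positivity
    have h1 := Real.pow_div_factorial_le_exp v hv0.le (d+2)
    have h2 : Real.exp (-v) ≤ (d+2).factorial / v^(d+2) := by
      rw [Real.exp_neg, inv_le_comm₀ (Real.exp_pos _) (by positivity), inv_div]; exact h1
    have e : -(n:ℝ)^2/(2*(2*s)) = -v := by rw [hv]; ring
    rw [e]
    calc _ = v / s * Real.exp (-v) := by rw [hv]; field_simp
      _ ≤ v / s * ((d+2).factorial / v^(d+2)) := by gcongr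
      _ = ((d+2).factorial * 4^(d+1) * s^d) * (1/((n:ℝ)^2)^(d+1)) := by
          rw [hv, div_pow, mul_pow]; field_simp; ring
      _ ≤ _ := by
          gcongr; exact le_self_pow₀ hn1 (by omega)
  have e1 : (m i:ℝ)^2 * gG s m = w^d * (((m i:ℝ)^2 * (1/(4*s^2)) * Real.exp (-(m i:ℝ)^2/(2*(2*s)))) *
      ∏ r ∈ Finset.univ.erase i, Real.exp (-(m r:ℝ)^2/(2*(2*s)))) := by
    unfold gG gp
    rw [Finset.prod_mul_distrib, Finset.prod_const, Finset.card_univ, Fintype.card_fin,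
      ← Finset.mul_prod_erase _ (fun r => Real.exp (-(m r:ℝ)^2/(2*(2*s)))) (Finset.mem_univ i)]
    ring
  have hP : ∏ r ∈ Finset.univ.erase i, Real.exp (-(m r:ℝ)^2/(2*(2*s))) ≤ 64^d * ∏ r ∈ Finset.univ.erase i, zz (m r) := by
    calc _ ≤ ∏ r ∈ Finset.univ.erase i, 64 * zz (m r) := Finset.prod_le_prod (fun _ _ => (Real.exp_pos _).le) fun r _ => hE _
      _ ≤ _ := by
        rw [Finset.prod_mul_distrib, Finset.prod_const]
        refine mul_le_mul_of_nonneg_right (pow_le_pow_right₀ (by norm_num) ?_) (Finset.prod_nonneg fun _ _ => zz_nonneg _)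
        refine (Finset.card_le_univ _).trans (by simp)
  rw [e1, ← Finset.mul_prod_erase _ (fun r => zz (m r)) (Finset.mem_univ i)]
  have hz := zz_nonneg (m i)
  calc _ ≤ w^d * ((((d+2).factorial * 4^(d+1) * s^d) * zz (m i)) * (64^d * ∏ r ∈ Finset.univ.erase i, zz (m r))) :=
        mul_le_mul_of_nonneg_left (mul_le_mul (hEi _) hP (Finset.prod_nonneg fun _ _ => (Real.exp_pos _).le) (by positivity)) (by positivity)
    _ = (w*s)^d * (((d+2).factorial * 4^(d+1) * 64^d) * (zz (m i) * ∏ r ∈ Finset.univ.erase i, zz (m r))) := by rw [mul_pow]; ring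
    _ ≤ 4^d * (((d+2).factorial * 4^(d+1) * 64^d) * (zz (m i) * ∏ r ∈ Finset.univ.erase i, zz (m r))) := by
        have : 0 ≤ ∏ r ∈ Finset.univ.erase i, zz (m r) := Finset.prod_nonneg fun _ _ => zz_nonneg _
        gcongr
    _ = _ := by ring

lemma small_kq (i : Fin d) {s : ℝ} (hs : 0 < s) (T : Finset (ZLat d)) : ∑ m ∈ T, |kq i s m| ≤ D0 := by
  have := box_sum T (fun r n => |if r = i then ep s n else ee s n|) (fun r => if r = i then D0 else 1) (fun _ _ => abs_nonneg _)
    (fun r T => by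
      split_ifs
      · exact ep_l1 hs T
      · rw [Finset.sum_congr rfl fun n _ => abs_of_nonneg (ee_nonneg hs n)]
        exact sum_le_hasSum T (fun n _ => ee_nonneg hs n) (ee_hasSum hs))
  rw [Finset.prod_ite_eq' Finset.univ i (fun _ => D0), if_pos (Finset.mem_univ i)] at this
  simp_rw [kq, Finset.abs_prod]; exact this

end
end Th
end
end

section
open MeasureTheory Real Filter Topology
noncomputable section
namespace Th

section
variable {d : ℕ}

lemma latVec_sq (m : ZLat d) : ‖latVec m‖^2 = ∑ r, (m r:ℝ)^2 := by
  rw [EuclideanSpace.real_norm_sq_eq]; rfl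

lemma gG_eq (m : ZLat d) {s : ℝ} (hs : 0 < s) : gG s m = (1/4 * (4*π)^(-(d:ℝ)/2)) *
    ((|(-1:ℝ)| * s^((-1:ℝ)-1)) • ((s^(-1:ℝ))^(((d:ℝ)/2+1)-1) * Real.exp (-(‖latVec m‖^2/4 * s^(-1:ℝ))))) := by
  unfold gG gp
  rw [Finset.prod_mul_distrib, Finset.prod_const, Finset.card_univ, Fintype.card_fin, ← Real.exp_sum, latVec_sq]
  have e1 : ∑ i, -(m i:ℝ)^2/(2*(2*s)) = -((∑ r, (m r:ℝ)^2)/4 * s^(-1:ℝ)) := by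
    rw [Real.rpow_neg_one, ← Finset.sum_div, Finset.sum_neg_distrib]; field_simp; norm_num
  have e2 : (√(2*π*(2*s)))⁻¹^d = (4*π)^(-(d:ℝ)/2) * (s^(-1:ℝ))^(((d:ℝ)/2+1)-1) := by
    rw [← Real.rpow_natCast, Real.sqrt_eq_rpow, ← Real.rpow_neg (by positivity), ← Real.rpow_mul (by positivity), ← Real.rpow_mul hs.le,
      show 2*π*(2*s) = (4*π)*s by ring, Real.mul_rpow (by positivity) hs.le]
    congr 2 <;> ring
  have e3 : s^((-1:ℝ)-1) = (s^2)⁻¹ := by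
    rw [show (-1:ℝ)-1 = -(2:ℕ) by norm_num, Real.rpow_neg hs.le, Real.rpow_natCast]
  rw [e1, e2, e3, smul_eq_mul, abs_neg, abs_one, one_mul, one_div, mul_inv]
  ring

lemma gG_int {m : ZLat d} (hm : m ≠ 0) : IntegrableOn (fun s => gG s m) (Set.Ioi 0) ∧
    ∫ s in Set.Ioi 0, gG s m = cConst d / ‖latVec m‖^(d+2) := by
  have hR : 0 < ‖latVec m‖ := by
    rw [norm_pos_iff]; intro h; apply hm
    funext i
    have := congrFun (congrArg WithLp.ofLp h) i
    simpa [latVec] using this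
  have hG : 0 < Real.Gamma ((d:ℝ)/2+1) := Real.Gamma_pos_of_pos (by positivity)
  have h : ∫ s in Set.Ioi 0, gG s m = cConst d / ‖latVec m‖^(d+2) := by
    rw [setIntegral_congr_fun measurableSet_Ioi fun s hs => gG_eq m hs, integral_const_mul,
      integral_comp_rpow_Ioi (fun u => u^(((d:ℝ)/2+1)-1) * Real.exp (-(‖latVec m‖^2/4 * u))) (by norm_num),
      Real.integral_rpow_mul_exp_neg_mul_Ioi (by positivity) (by positivity)]
    unfold cConst
    rw [show ((d:ℝ)+2)/2 = (d:ℝ)/2+1 by ring, one_div_div, Real.div_rpow (by norm_num) (by positivity), Real.mul_rpow (by norm_num) Real.pi_pos.le,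
      ← Real.rpow_natCast ‖latVec m‖ 2, ← Real.rpow_mul hR.le, ← Real.rpow_natCast ‖latVec m‖ (d+2),
      show ((2:ℕ):ℝ)*((d:ℝ)/2+1) = ((d+2:ℕ):ℝ) by push_cast; ring]
    have e : (1/4:ℝ) * (4:ℝ)^(-(d:ℝ)/2) * (4:ℝ)^((d:ℝ)/2+1) = 1 := by
      rw [mul_assoc, ← Real.rpow_add (by norm_num), show -(d:ℝ)/2 + ((d:ℝ)/2+1) = 1 by ring]; norm_num
    calc _ = ((1/4:ℝ) * (4:ℝ)^(-(d:ℝ)/2) * (4:ℝ)^((d:ℝ)/2+1)) * (π^(-(d:ℝ)/2) * Real.Gamma ((d:ℝ)/2+1) / ‖latVec m‖^((d+2:ℕ):ℝ)) := by ring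
      _ = _ := by rw [e, one_mul]
  refine ⟨?_, h⟩
  by_contra hc
  have h0 := integral_undef hc
  rw [h0] at h
  have : 0 < cConst d / ‖latVec m‖^(d+2) := by
    unfold cConst; rw [show ((d:ℝ)+2)/2 = (d:ℝ)/2+1 by ring]; positivity
  linarith

def EE (j k : Fin d) (m : ZLat d) : ℝ := (discK d j j m - discK d k k m) - (probK d j j m - probK d k k m)

def Ph (j k : Fin d) (s : ℝ) (m : ZLat d) : ℝ := ((m j:ℝ)^2 - (m k:ℝ)^2) * gG s m - (kq k s m - kq j s m)

lemma discK_sub (j k : Fin d) (m : ZLat d) : IntegrableOn (fun s => ((m j:ℝ)^2 - (m k:ℝ)^2) * gG s m) (Set.Ioi 0) ∧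
    discK d j j m - discK d k k m = ∫ s in Set.Ioi 0, ((m j:ℝ)^2 - (m k:ℝ)^2) * gG s m := by
  rcases eq_or_ne m 0 with rfl | hm
  · simp [discK]
  obtain ⟨h1, h2⟩ := gG_int hm
  refine ⟨h1.const_mul _, ?_⟩
  rw [integral_const_mul, h2]
  simp only [discK, if_neg hm]; ring

lemma EE_eq (j k : Fin d) (m : ZLat d) : IntegrableOn (fun s => Ph j k s m) (Set.Ioi 0) ∧ EE j k m = ∫ s in Set.Ioi 0, Ph j k s m := by
  obtain ⟨h1, h2⟩ := discK_sub j k m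
  have h3 : IntegrableOn (fun s => kq k s m - kq j s m) (Set.Ioi 0) := (kq_int k m).sub (kq_int j m)
  refine ⟨h1.sub h3, ?_⟩
  unfold EE Ph
  rw [integral_sub h1 h3, ← h2, integral_sub (kq_int k m) (kq_int j m), probK_eq, probK_eq]
  ring

def bE (d : ℕ) (s : ℝ) : ℝ := if s ≤ 16 then 2 * ((d+2).factorial * 4^(d+1) * 4^d * 64^d) * (1+Z2)^d + 2 * D0
  else 2 * (d * (4 * (51 * 3^(d-1)))) * (√s)⁻¹^3

lemma Ph_sum (j k : Fin d) {s : ℝ} (hs : 0 < s) (T : Finset (ZLat d)) : ∑ m ∈ T, |Ph j k s m| ≤ bE d s := by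
  unfold bE; split_ifs with h
  · have hz : ∑ m ∈ T, ∏ r, zz (m r) ≤ (1+Z2)^d := (box_sum T (fun _ n => zz n) (fun _ => 1 + Z2) (fun _ => zz_nonneg) fun _ => zz_sum).trans (by simp)
    have hg : ∀ m : ZLat d, 0 ≤ gG s m := fun m => mul_nonneg (by positivity) (Finset.prod_nonneg fun r _ => (gp_pos (by positivity) _).le)
    calc _ ≤ ∑ m ∈ T, (2 * ((d+2).factorial * 4^(d+1) * 4^d * 64^d) * ∏ r, zz (m r) + |kq k s m| + |kq j s m|) := Finset.sum_le_sum fun m _ => by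
          have a1 := small_pt hs h j m
          have a2 := small_pt hs h k m
          have a3 := mul_nonneg (sq_nonneg (m j:ℝ)) (hg m)
          have a4 := mul_nonneg (sq_nonneg (m k:ℝ)) (hg m)
          have a5 : |((m j:ℝ)^2 - (m k:ℝ)^2) * gG s m| ≤ 2 * ((d+2).factorial * 4^(d+1) * 4^d * 64^d) * ∏ r, zz (m r) := by
            rw [sub_mul, abs_le]; constructor <;> linarith
          have a6 := abs_sub (((m j:ℝ)^2 - (m k:ℝ)^2) * gG s m) (kq k s m - kq j s m)
          have a7 := abs_sub (kq k s m) (kq j s m)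
          unfold Ph; linarith
      _ ≤ _ := by
          rw [Finset.sum_add_distrib, Finset.sum_add_distrib, ← Finset.mul_sum]
          have := small_kq j hs T
          have := small_kq k hs T
          have := mul_le_mul_of_nonneg_left hz (by positivity : (0:ℝ) ≤ 2 * ((d+2).factorial * 4^(d+1) * 4^d * 64^d))
          linarith
  · push Not at h
    calc _ ≤ ∑ m ∈ T, (|kq k s m - k0 k s m| + |kq j s m - k0 j s m|) := Finset.sum_le_sum fun m _ => by
          have e : Ph j k s m = -(kq k s m - k0 k s m) + (kq j s m - k0 j s m) := by
            unfold Ph; rw [k0_eq _ hs, k0_eq _ hs]; ring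
          rw [e]; refine (abs_add_le _ _).trans (le_of_eq ?_); rw [abs_neg]
      _ ≤ _ := by
          rw [Finset.sum_add_distrib]
          have := large_bd j h.le T
          have := large_bd k h.le T
          linarith

lemma bE_int : IntegrableOn (bE d) (Set.Ioi 0) := by
  rw [← Set.Ioc_union_Ioi_eq_Ioi (by norm_num : (0:ℝ) ≤ 16)]
  refine IntegrableOn.union ?_ ?_
  · refine (integrableOn_const (C := 2 * ((d+2).factorial * 4^(d+1) * 4^d * 64^d) * (1+Z2)^d + 2 * D0) (by simp)).congr_fun (fun s hs => ?_) measurableSet_Ioc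
    unfold bE; rw [if_pos hs.2]
  · have h := (integrableOn_Ioi_rpow_of_lt (a := -3/2) (by norm_num) (by norm_num : (0:ℝ) < 16)).const_mul (2 * (d * (4 * (51 * 3^(d-1)))))
    refine IntegrableOn.congr_fun h (fun s hs => ?_) measurableSet_Ioi
    have hs' : (16:ℝ) < s := hs
    have h0 : 0 < s := by linarith
    unfold bE; rw [if_neg (not_le.2 hs')]
    congr 1
    rw [← Real.rpow_natCast, Real.sqrt_eq_rpow, ← Real.rpow_neg h0.le, ← Real.rpow_mul h0.le]; norm_num

lemma EE_summable (j k : Fin d) : Summable fun m => |EE j k m| := by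
  refine summable_of_sum_le (c := ∫ s in Set.Ioi 0, bE d s) (fun _ => abs_nonneg _) fun T => ?_
  calc _ ≤ ∑ m ∈ T, ∫ s in Set.Ioi 0, |Ph j k s m| := Finset.sum_le_sum fun m _ => by
        rw [(EE_eq j k m).2]; exact abs_integral_le_integral_abs
    _ = ∫ s in Set.Ioi 0, ∑ m ∈ T, |Ph j k s m| := (integral_finsetSum _ fun m _ => (EE_eq j k m).1.abs).symm
    _ ≤ _ := setIntegral_mono_on (integrable_finsetSum _ fun m _ => (EE_eq j k m).1.abs) bE_int measurableSet_Ioi fun s hs => Ph_sum j k hs T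

lemma norm_swap (e : Equiv.Perm (Fin d)) (m : ZLat d) : ‖latVec (fun r => m (e r))‖ = ‖latVec m‖ := by
  rw [← sq_eq_sq₀ (norm_nonneg _) (norm_nonneg _), latVec_sq, latVec_sq]
  exact Equiv.sum_comp e fun r => (m r:ℝ)^2

lemma discK_swap (e : Equiv.Perm (Fin d)) (i : Fin d) (m : ZLat d) : discK d i i (fun r => m (e r)) = discK d (e i) (e i) m := by
  have h : ((fun r => m (e r)) = (0 : ZLat d)) ↔ m = 0 := by
    constructor
    · intro h; funext r; have := congrFun h (e.symm r); simpa using this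
    · rintro rfl; rfl
  unfold discK
  simp only [h, norm_swap]

lemma probK_swap (e : Equiv.Perm (Fin d)) (i : Fin d) (m : ZLat d) : probK d i i (fun r => m (e r)) = probK d (e i) (e i) m := by
  rw [probK_eq, probK_eq]
  congr 2; funext s
  unfold kq
  rw [← Equiv.prod_comp e (fun r => if r = e i then ep s (m r) else ee s (m r))]
  exact Finset.prod_congr rfl fun r _ => by simp only [EmbeddingLike.apply_eq_iff_eq]

lemma EE_tsum (j k : Fin d) : ∑' m, EE j k m = 0 := by
  have h := Equiv.tsum_eq (Equiv.arrowCongr (Equiv.swap j k) (Equiv.refl ℤ)) (EE j k)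
  have e : ∀ m : ZLat d, EE j k (Equiv.arrowCongr (Equiv.swap j k) (Equiv.refl ℤ) m) = -EE j k m := by
    intro m
    have : Equiv.arrowCongr (Equiv.swap j k) (Equiv.refl ℤ) m = fun r => m (Equiv.swap j k r) := by funext r; simp [Equiv.arrowCongr]
    rw [this]; unfold EE
    simp only [discK_swap, probK_swap, Equiv.swap_apply_left, Equiv.swap_apply_right]; ring
  simp_rw [e] at h
  rw [tsum_neg] at h; linarith

lemma discK_even (i : Fin d) (m : ZLat d) : discK d i i (-m) = discK d i i m := by
  have : latVec (-m) = -latVec m := by ext r; simp [latVec]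
  unfold discK; simp [this]

lemma EE_even (j k : Fin d) (m : ZLat d) : EE j k (-m) = EE j k m := by
  unfold EE; simp only [discK_even, probK_even]

lemma discK_bd (i : Fin d) (m : ZLat d) : |discK d i i m| ≤ |cConst d| * ∏ r, (if m r = 0 then (1:ℝ) else |(m r:ℝ)|⁻¹) := by
  unfold discK
  split_ifs with hm
  · rw [abs_zero]; exact mul_nonneg (abs_nonneg _) (Finset.prod_nonneg fun r _ => by split_ifs <;> positivity)
  have hle : ∀ r, |(m r:ℝ)| ≤ ‖latVec m‖ := fun r => PiLp.norm_apply_le (latVec m) r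
  have h1 : 1 ≤ ‖latVec m‖ := by
    obtain ⟨r, hr⟩ := Function.ne_iff.1 hm
    refine le_trans ?_ (hle r)
    exact_mod_cast Int.one_le_abs hr
  set N := ‖latVec m‖
  have hN : 0 < N := by linarith
  rw [abs_div, abs_mul, abs_mul, abs_of_nonneg (by positivity : (0:ℝ) ≤ N^(d+2)), mul_assoc, mul_div_assoc]
  refine mul_le_mul_of_nonneg_left ?_ (abs_nonneg _)
  calc _ ≤ N * N / N^(d+2) := by gcongr <;> exact hle i
    _ = ∏ r : Fin d, N⁻¹ := by rw [Finset.prod_const, Finset.card_univ, Fintype.card_fin, inv_pow, pow_add]; field_simp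
    _ ≤ _ := Finset.prod_le_prod (fun _ _ => by positivity) fun r _ => by
        split_ifs with h
        · exact inv_le_one_of_one_le₀ h1
        · exact inv_anti₀ (by positivity) (hle r)

lemma discK_mem (i : Fin d) {q : ℝ} (hq : 1 < q) : Summable fun m => |discK d i i m|^q := by
  have hs : Summable fun n : ℤ => |(if n = 0 then (1:ℝ) else |(n:ℝ)|⁻¹)^q| := by
    have h1 : Summable fun n : ℤ => (if n = 0 then (1:ℝ) else 0) + |(n:ℝ)|^(-q) :=
      (hasSum_ite_eq (0:ℤ) (1:ℝ)).summable.add (Real.summable_abs_int_rpow hq)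
    refine h1.of_nonneg_of_le (fun _ => abs_nonneg _) fun n => ?_
    split_ifs with h
    · rw [Real.one_rpow, abs_one]; have : 0 ≤ |(n:ℝ)|^(-q) := by positivity
      linarith
    · rw [abs_of_nonneg (by positivity), Real.inv_rpow (abs_nonneg _), Real.rpow_neg (abs_nonneg _), zero_add]
  have h := (pi_tsum_aux (fun (_ : Fin d) n => (if n = 0 then (1:ℝ) else |(n:ℝ)|⁻¹)^q) fun _ => hs).1.mul_left (|cConst d|^q)
  refine h.of_nonneg_of_le (fun m => by positivity) fun m => ?_
  have h0 : 0 ≤ ∏ r, (if m r = 0 then (1:ℝ) else |(m r:ℝ)|⁻¹) := Finset.prod_nonneg fun r _ => by split_ifs <;> positivity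
  refine (Real.rpow_le_rpow (abs_nonneg _) (discK_bd i m) (by linarith)).trans (le_of_eq ?_)
  rw [Real.mul_rpow (abs_nonneg _) h0, Real.finsetProd_rpow _ _ (fun r _ => by split_ifs <;> positivity), abs_of_nonneg (Real.rpow_nonneg h0 q)]

end
end Th
end
end

section
open MeasureTheory Real Filter Topology
noncomputable section
namespace Th

section
variable {d : ℕ} {p q : ℝ}

lemma shift_le {E : ZLat d → ℝ} (hE : Summable fun m => |E m|) (S : Finset (ZLat d)) (m : ZLat d) :
    ∑ n ∈ S, |E (n - m)| ≤ ∑' n, |E n| := by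
  rw [← (Equiv.subRight m).tsum_eq fun n => |E n|]
  exact ((Equiv.subRight m).summable_iff.2 hE).sum_le_tsum S fun n _ => abs_nonneg _

lemma shift_le' {E : ZLat d → ℝ} (hE : Summable fun m => |E m|) (S : Finset (ZLat d)) (n : ZLat d) :
    ∑ m ∈ S, |E (n - m)| ≤ ∑' n, |E n| := by
  rw [← (Equiv.subLeft n).tsum_eq fun n => |E n|]
  exact ((Equiv.subLeft n).summable_iff.2 hE).sum_le_tsum S fun n _ => abs_nonneg _

lemma BndK_l1 (hpq : p.HolderConjugate q) {E : ZLat d → ℝ} (hE : Summable fun m => |E m|) : BndK E p q (∑' m, |E m|) := by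
  intro S f g
  have hp := hpq.pos
  have hq := hpq.symm.pos
  set C := ∑' m, |E m|
  have hC : 0 ≤ C := tsum_nonneg fun _ => abs_nonneg _
  have hH := Real.inner_le_Lp_mul_Lq (S ×ˢ S) (fun x => |f x.1| * |E (x.2 - x.1)|^(1/p)) (fun x => |g x.2| * |E (x.2 - x.1)|^(1/q)) hpq
  have e : ∀ {r : ℝ} (_ : 0 < r) (a b : ℝ), |(|a| * |b|^(1/r))|^r = |a|^r * |b| := by
    intro r hr a b
    rw [abs_of_nonneg (by positivity), Real.mul_rpow (abs_nonneg _) (by positivity), ← Real.rpow_mul (abs_nonneg _), one_div_mul_cancel hr.ne', Real.rpow_one]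
  simp only [e hp, e hq, Finset.sum_product] at hH
  have h1 : ∑ m ∈ S, ∑ n ∈ S, |f m|^p * |E (n-m)| ≤ C * ∑ m ∈ S, |f m|^p := by
    simp_rw [← Finset.mul_sum]; rw [Finset.mul_sum]
    exact Finset.sum_le_sum fun m _ => by rw [mul_comm]; exact mul_le_mul_of_nonneg_right (shift_le hE S m) (by positivity)
  have h2 : ∑ m ∈ S, ∑ n ∈ S, |g n|^q * |E (n-m)| ≤ C * ∑ m ∈ S, |g m|^q := by
    rw [Finset.sum_comm]
    simp_rw [← Finset.mul_sum]; rw [Finset.mul_sum]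
    exact Finset.sum_le_sum fun m _ => by rw [mul_comm]; exact mul_le_mul_of_nonneg_right (shift_le' hE S m) (by positivity)
  have n1 : 0 ≤ ∑ m ∈ S, |f m|^p := Finset.sum_nonneg fun m _ => by positivity
  have n2 : 0 ≤ ∑ m ∈ S, |g m|^q := Finset.sum_nonneg fun m _ => by positivity
  calc _ ≤ ∑ m ∈ S, ∑ n ∈ S, |f m| * |E (n - m)|^(1/p) * (|g n| * |E (n - m)|^(1/q)) := Finset.sum_le_sum fun m _ => Finset.sum_le_sum fun n _ => by
        refine (le_abs_self _).trans (le_of_eq ?_)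
        rw [abs_mul, abs_mul]
        have : |E (n-m)| = |E (n-m)|^(1/p) * |E (n-m)|^(1/q) := by
          rw [← Real.rpow_add' (abs_nonneg _) (by rw [one_div, one_div, hpq.inv_add_inv_eq_one]; norm_num), one_div, one_div, hpq.inv_add_inv_eq_one, Real.rpow_one]
        conv_lhs => rw [this]
        ring
    _ ≤ _ := hH
    _ ≤ (C * ∑ m ∈ S, |f m|^p)^(1/p) * (C * ∑ m ∈ S, |g m|^q)^(1/q) := mul_le_mul
        (Real.rpow_le_rpow (Finset.sum_nonneg fun m _ => Finset.sum_nonneg fun n _ => by positivity) h1 (by positivity))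
        (Real.rpow_le_rpow (Finset.sum_nonneg fun m _ => Finset.sum_nonneg fun n _ => by positivity) h2 (by positivity))
        (Real.rpow_nonneg (Finset.sum_nonneg fun m _ => Finset.sum_nonneg fun n _ => by positivity) _) (by positivity)
    _ = (C^(1/p) * C^(1/q)) * (∑ m ∈ S, |f m|^p)^(1/p) * (∑ n ∈ S, |g n|^q)^(1/q) := by
        rw [Real.mul_rpow hC n1, Real.mul_rpow hC n2]; ring
    _ = _ := by
        rw [← Real.rpow_add' hC (by rw [one_div, one_div, hpq.inv_add_inv_eq_one]; norm_num), one_div, one_div, hpq.inv_add_inv_eq_one, Real.rpow_one]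

lemma BndK.add {K L : ZLat d → ℝ} {C D : ℝ} (h : BndK K p q C) (h' : BndK L p q D) : BndK (fun m => K m + L m) p q (C + D) := by
  intro S f g
  simp only [mul_add, Finset.sum_add_distrib, add_mul]
  exact add_le_add (h S f g) (h' S f g)

def PK (j k : Fin d) (m : ZLat d) : ℝ := probK d j j m - probK d k k m

def sg (j k i : Fin d) : ℝ := if i = j then 1 else if i = k then -1 else 0

lemma sg_le (j k i : Fin d) : |sg j k i| ≤ 1 := by unfold sg; split_ifs <;> norm_num

lemma sg_sum {j k : Fin d} (h : j ≠ k) (F : Fin d → ℝ) : ∑ i, sg j k i * F i = F j - F k := by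
  have : ∀ i, sg j k i * F i = (if i = j then F j else 0) - (if i = k then F k else 0) := by
    intro i; unfold sg; split_ifs with h1 h2 h2
    · exact absurd (h1.symm.trans h2) h
    · rw [h1]; ring
    · rw [h2]; ring
    · ring
  simp [this, Finset.sum_sub_distrib]

lemma PK_bnd (hpq : p.HolderConjugate q) {j k : Fin d} (hjk : j ≠ k) : BndK (PK j k) p q (pstar p - 1) := by
  have := thmU hpq (sg_le j k)
  simp only [sg_sum hjk] at this
  exact this

lemma DK_bnd (hpq : p.HolderConjugate q) {j k : Fin d} (hjk : j ≠ k) :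
    BndK (fun m => PK j k m + EE j k m) p q ((pstar p - 1) + ∑' m, |EE j k m|) := (PK_bnd hpq hjk).add (BndK_l1 hpq (EE_summable j k))

lemma pstar_nonneg (hpq : p.HolderConjugate q) : 0 ≤ pstar p - 1 := by
  have : p ≤ pstar p := le_max_left _ _
  have := hpq.lt; linarith

lemma Rprob_T (hpq : p.HolderConjugate q) (j k : Fin d) (f : ZLat d → ℝ) (hf : MemLpLat d p f) (n : ZLat d) :
    Rprob d j j f n - Rprob d k k f n = ∑' m, PK j k (n - m) * f m := by
  have hs : ∀ i : Fin d, Summable fun m => probK d i i (n - m) * f m := by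
    intro i
    have := thmU (d := d) hpq (σ := fun r => if r = i then 1 else 0) (fun r => by split_ifs <;> simp)
    simp only [ite_mul, one_mul, zero_mul, Finset.sum_ite_eq', Finset.mem_univ, if_true] at this
    exact this.summable hpq (pstar_nonneg hpq) hf n
  unfold Rprob PK
  rw [← (hs j).tsum_sub (hs k)]
  exact tsum_congr fun m => by ring

lemma Rdis_T (hpq : p.HolderConjugate q) (j k : Fin d) (f : ZLat d → ℝ) (hf : MemLpLat d p f) (n : ZLat d) :
    Rdis d j j f n - Rdis d k k f n = ∑' m, (PK j k (n - m) + EE j k (n - m)) * f m := by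
  have hs : ∀ i : Fin d, Summable fun m => discK d i i m * f (n - m) := by
    intro i
    refine Summable.of_abs ?_
    simp only [abs_mul]
    exact Real.summable_mul_of_Lp_Lq_of_nonneg hpq.symm (fun m => abs_nonneg _) (fun m => abs_nonneg _) (discK_mem i hpq.symm.lt)
      ((Equiv.subLeft n).summable_iff.2 hf)
  unfold Rdis
  rw [← (hs j).tsum_sub (hs k), ← (Equiv.subLeft n).tsum_eq]
  refine tsum_congr fun m => ?_
  simp only [Equiv.subLeft_apply, sub_sub_cancel]
  unfold PK EE; ring

end
end Th
end
end

section
open MeasureTheory Real Filter Topology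
noncomputable section
namespace Th

lemma ep_hasSum {s : ℝ} (hs : 0 < s) : HasSum (ep s) 0 := by
  have h := hasSum_integral_of_summable_integral_norm (fun m => epi_integrable hs 0 m)
    (summable_of_sum_le (fun m => integral_nonneg fun x => norm_nonneg _) (ep_l10 hs))
  have e : ∀ x, ∑' m, th s x * (pr1 s 0 x * pr1 s m x) = 0 := by
    intro x
    have h1 := ((mom_hasSum hs x).1.sub ((pr_hasSum hs x).mul_left (th1 s x / th s x + x/s))).mul_left (th s x * pr1 s 0 x)
    rw [mul_one, sub_self, mul_zero] at h1
    refine (HasSum.congr_fun h1 fun m => ?_).tsum_eq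
    unfold pr1; ring
  simp_rw [e, integral_zero] at h
  exact h

lemma ep_l1_large {s : ℝ} (hs : 16 ≤ s) (T : Finset ℤ) : ∑ m ∈ T, |ep s m| ≤ 45 * (√s)⁻¹^2 := by
  obtain ⟨r1, r2, -⟩ := rs hs
  have h1 := ep_diff hs T
  have h2 := ep0_l1 hs T
  calc _ ≤ ∑ m ∈ T, (|ep s m - -gp2 (2*s) m| + |-gp2 (2*s) m|) := Finset.sum_le_sum fun m _ => by
        have := abs_add_le (ep s m - -gp2 (2*s) m) (-gp2 (2*s) m)
        rwa [sub_add_cancel] at this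
    _ ≤ _ := by
        rw [Finset.sum_add_distrib]
        nlinarith [mul_le_mul_of_nonneg_left r2 (sq_nonneg (√s)⁻¹)]

lemma ep_intτ (τ : ℝ) (m : ℤ) : IntegrableOn (fun s => ep s m) (Set.Ioc 0 τ) := (ep_int m).mono_set Set.Ioc_subset_Ioi_self

lemma w_summable (τ : ℝ) : Summable fun m : ℤ => ∫ s in Set.Ioc 0 τ, |ep s m| := by
  refine summable_of_sum_le (c := ∫ s in Set.Ioc 0 τ, D0) (fun m => integral_nonneg fun _ => abs_nonneg _) fun T => ?_
  rw [← integral_finsetSum _ fun m _ => (ep_intτ τ m).abs]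
  exact setIntegral_mono_on (integrable_finsetSum _ fun m _ => (ep_intτ τ m).abs) (integrableOn_const (by simp)) measurableSet_Ioc
    fun s hs => ep_l1 hs.1 T

lemma ep_tail (τ : ℝ) : Tendsto (fun T : Finset ℤ => ∫ s in Set.Ioc 0 τ, |∑ m ∈ T, ep s m|) atTop (𝓝 0) := by
  have h := tendsto_integral_filter_of_dominated_convergence (μ := volume.restrict (Set.Ioc 0 τ)) (l := (atTop : Filter (Finset ℤ)))
    (F := fun T s => |∑ m ∈ T, ep s m|) (f := fun _ => (0:ℝ)) (fun _ => D0)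
    (Eventually.of_forall fun T => (integrable_finsetSum T fun m _ => ep_intτ τ m).abs.aestronglyMeasurable)
    (Eventually.of_forall fun T => (ae_restrict_iff' measurableSet_Ioc).2 (ae_of_all _ fun s hs => by
      rw [Real.norm_eq_abs, abs_abs]; exact (Finset.abs_sum_le_sum_abs _ _).trans (ep_l1 hs.1 T)))
    (integrableOn_const (by simp))
    ((ae_restrict_iff' measurableSet_Ioc).2 (ae_of_all _ fun s hs => by
      have := (ep_hasSum hs.1).abs; rwa [abs_zero] at this))
  rwa [integral_zero] at h

def lam (c : ℕ) (v : ℤ) : ℝ := min 1 (|(v:ℝ)|/c)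

lemma lam_nonneg (c : ℕ) (v : ℤ) : 0 ≤ lam c v := le_min zero_le_one (by positivity)
lemma lam_le (c : ℕ) (v : ℤ) : lam c v ≤ 1 := min_le_left _ _
lemma lam_tendsto (v : ℤ) : Tendsto (fun c => lam c v) atTop (𝓝 0) := by
  have h : Tendsto (fun c : ℕ => |(v:ℝ)|/c) atTop (𝓝 0) := tendsto_const_div_atTop_nhds_zero_nat _
  exact squeeze_zero (fun c => lam_nonneg c v) (fun c => min_le_right _ _) h

lemma tsum_lam {ι : Type*} {w : ι → ℝ} (hw : Summable w) (h0 : ∀ m, 0 ≤ w m) {l : ℕ → ι → ℝ} {C : ℝ} (hl : ∀ c m, 0 ≤ l c m ∧ l c m ≤ C)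
    (ht : ∀ m, Tendsto (fun c => l c m) atTop (𝓝 0)) : Tendsto (fun c => ∑' m, w m * l c m) atTop (𝓝 0) := by
  have := tendsto_tsum_of_dominated_convergence (bound := fun m => w m * C) (f := fun c m => w m * l c m) (g := fun _ => 0) (𝓕 := (atTop : Filter ℕ))
    (hw.mul_right C) (fun m => by simpa using (ht m).const_mul (w m)) (Eventually.of_forall fun c m => by
      rw [Real.norm_eq_abs, abs_of_nonneg (mul_nonneg (h0 m) (hl c m).1)]; exact mul_le_mul_of_nonneg_left (hl c m).2 (h0 m))
  rwa [tsum_zero] at this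

lemma rint {τ : ℝ} (hτ : 0 < τ) : IntegrableOn (fun s : ℝ => (√s)⁻¹^3) (Set.Ioi τ) ∧ ∫ s in Set.Ioi τ, (√s)⁻¹^3 = 2 * (√τ)⁻¹ := by
  have e : ∀ s : ℝ, 0 < s → s^(-3/2:ℝ) = (√s)⁻¹^3 := fun s h0 => by
    rw [← Real.rpow_natCast, Real.sqrt_eq_rpow, ← Real.rpow_neg h0.le, ← Real.rpow_mul h0.le]; norm_num
  refine ⟨(integrableOn_Ioi_rpow_of_lt (a := -3/2) (by norm_num) hτ).congr_fun (fun s hs => e s (hτ.trans hs)) measurableSet_Ioi, ?_⟩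
  rw [← setIntegral_congr_fun measurableSet_Ioi (fun s hs => e s (hτ.trans hs)), integral_Ioi_rpow_of_lt (by norm_num) hτ, Real.sqrt_eq_rpow, ← Real.rpow_neg hτ.le]
  norm_num; ring

end Th
end
end

section
open MeasureTheory Real Filter Topology
noncomputable section
namespace Th

def II (L : ℕ) : Finset ℤ := Finset.Ico 0 (L:ℤ)

lemma II_sum (L : ℕ) (F : ℤ → ℝ) : ∑ t ∈ II L, F t = ∑ t ∈ Finset.range L, F t := by
  symm
  refine Finset.sum_bij (fun t _ => (t:ℤ)) (fun t ht => ?_) (fun a _ b _ h => by exact_mod_cast h) (fun t ht => ?_) fun t _ => rfl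
  · have := Finset.mem_range.1 ht; simp only [II, Finset.mem_Ico]; omega
  · simp only [II, Finset.mem_Ico] at ht
    exact ⟨t.toNat, by rw [Finset.mem_range]; omega, by omega⟩

lemma II_card (L : ℕ) : (II L).card = L := by simp [II]

lemma div_sum {c : ℕ} (hc : 0 < c) (k : ℕ) (v : ℤ) : ∑ t ∈ Finset.range (c*k), (((t:ℤ) / c - ((t:ℤ) - v) / c : ℤ) : ℝ) = v * k := by
  have step : ∀ v : ℤ, ∑ t ∈ Finset.range (c*k), ((((t:ℤ) - v) / c - ((t:ℤ) - (v+1)) / c : ℤ) : ℝ) = k := by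
    intro v
    have := Finset.sum_range_sub (fun t : ℕ => ((((t:ℤ) - (v+1)) / c : ℤ) : ℝ)) (c*k)
    have e : (((c*k:ℕ):ℤ) - (v+1)) / c = ((0:ℕ) - (v+1)) / c + k := by
      rw [show (((c*k:ℕ):ℤ) - (v+1)) = ((0:ℕ) - (v+1)) + c * k by push_cast; ring, Int.add_mul_ediv_left _ _ (by omega)]
    rw [e] at this
    push_cast at this ⊢
    rw [add_sub_cancel_left] at this
    rw [← this]
    refine Finset.sum_congr rfl fun t _ => ?_
    rw [show (t:ℤ) + 1 - (v+1) = t - v by ring]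
  induction v using Int.induction_on with
  | zero => simp
  | succ v ih =>
    have := step v
    push_cast at this ih ⊢
    rw [Finset.sum_sub_distrib] at this ih ⊢; linarith
  | pred v ih =>
    have := step (-v-1)
    rw [show (-(v:ℤ)-1+1) = -v by ring] at this
    push_cast at this ih ⊢
    rw [Finset.sum_sub_distrib] at this ih ⊢; linarith

lemma count1 {c : ℕ} (hc : 0 < c) {L : ℕ} (hL : c ∣ L) (v : ℤ) :
    ∑ t ∈ II L, (if (t - v) / (c:ℤ) = t / c then (0:ℝ) else 1) ≤ L * lam c v := by
  obtain ⟨k, rfl⟩ := hL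
  have hc' : (0:ℤ) < c := by exact_mod_cast hc
  rw [II_sum]
  unfold lam
  rw [mul_min_of_nonneg _ _ (by positivity)]
  refine le_min ?_ ?_
  · calc _ ≤ ∑ t ∈ Finset.range (c*k), (1:ℝ) := Finset.sum_le_sum fun t _ => by split_ifs <;> norm_num
      _ = _ := by simp
  · have e : ((c*k:ℕ):ℝ) * (|(v:ℝ)|/c) = |(v:ℝ) * k| := by
      rw [abs_mul, abs_of_nonneg (by positivity : (0:ℝ) ≤ k)]; push_cast; field_simp
    rw [e, ← div_sum hc]
    have h1 : ∀ a b : ℤ, (if b = a then (0:ℝ) else 1) ≤ |((a - b : ℤ):ℝ)| := by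
      intro a b; split_ifs with h
      · positivity
      · exact_mod_cast Int.one_le_abs (sub_ne_zero.2 (Ne.symm h))
    refine (Finset.sum_le_sum fun t _ => h1 _ _).trans (le_of_eq ?_)
    rcases le_total 0 v with h | h
    · have hn : ∀ t : ℕ, (0:ℝ) ≤ (((t:ℤ) / c - ((t:ℤ) - v) / c : ℤ) : ℝ) := fun t => by
        exact Int.cast_nonneg (sub_nonneg.2 (Int.ediv_le_ediv hc' (by linarith)))
      rw [abs_of_nonneg (Finset.sum_nonneg fun t _ => hn t)]
      exact Finset.sum_congr rfl fun t _ => abs_of_nonneg (hn t)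
    · have hn : ∀ t : ℕ, (((t:ℤ) / c - ((t:ℤ) - v) / c : ℤ) : ℝ) ≤ 0 := fun t => by
        exact Int.cast_nonpos.2 (sub_nonpos.2 (Int.ediv_le_ediv hc' (by linarith)))
      rw [abs_of_nonpos (Finset.sum_nonpos fun t _ => hn t), ← Finset.sum_neg_distrib]
      exact Finset.sum_congr rfl fun t _ => abs_of_nonpos (hn t)

lemma slow1 {c L : ℕ} (hc : 0 < c) (hL : c ∣ L) {y : ℤ → ℝ} {D : ℝ} (hD : ∀ u, |y u| ≤ D) (h0 : ∀ u ∉ II L, y u = 0)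
    (hy : ∀ u v : ℤ, u / (c:ℤ) = v / c → y u = y v) (κ : ℤ → ℝ) (T : Finset ℤ) (hT : Finset.Ioo (-(L:ℤ)) L ⊆ T) :
    ∑ t ∈ II L, |∑ u ∈ II L, κ (t - u) * y u| ≤ L * (2 * D * ∑ m ∈ T, |κ m| * lam c m + D * |∑ m ∈ T, κ m|) := by
  have hD0 : 0 ≤ D := (abs_nonneg _).trans (hD 0)
  have e : ∀ t ∈ II L, ∑ u ∈ II L, κ (t - u) * y u = ∑ m ∈ T, κ m * (y (t - m) - y t) + y t * ∑ m ∈ T, κ m := by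
    intro t ht
    rw [Finset.mul_sum, ← Finset.sum_add_distrib]
    have : ∀ m ∈ T, κ m * (y (t - m) - y t) + y t * κ m = κ m * y (t - m) := fun m _ => by ring
    rw [Finset.sum_congr rfl this]
    have hs : (II L).image (fun u => t - u) ⊆ T := by
      intro m hm
      obtain ⟨u, hu, rfl⟩ := Finset.mem_image.1 hm
      apply hT; simp only [II, Finset.mem_Ico, Finset.mem_Ioo] at *; omega
    rw [← Finset.sum_subset hs, Finset.sum_image fun a _ b _ h => by simpa using h]
    · simp
    · intro m _ hm
      rw [h0 (t - m), mul_zero]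
      intro h; exact hm (Finset.mem_image.2 ⟨_, h, by ring⟩)
  have h2 : ∀ m : ℤ, ∑ t ∈ II L, |y (t - m) - y t| ≤ 2 * D * (L * lam c m) := fun m => by
    refine le_trans ?_ (mul_le_mul_of_nonneg_left (count1 hc hL m) (by positivity))
    rw [Finset.mul_sum]
    refine Finset.sum_le_sum fun t _ => ?_
    split_ifs with h
    · rw [hy _ _ h]; simp
    · have := abs_sub (y (t-m)) (y t); have := hD (t-m); have := hD t; linarith
  calc _ ≤ ∑ t ∈ II L, (∑ m ∈ T, |κ m| * |y (t - m) - y t| + D * |∑ m ∈ T, κ m|) := Finset.sum_le_sum fun t ht => by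
        rw [e t ht]
        refine (abs_add_le _ _).trans (add_le_add ((Finset.abs_sum_le_sum_abs _ _).trans (le_of_eq ?_)) ?_)
        · exact Finset.sum_congr rfl fun m _ => abs_mul _ _
        · rw [abs_mul]; exact mul_le_mul_of_nonneg_right (hD t) (abs_nonneg _)
    _ = ∑ m ∈ T, |κ m| * ∑ t ∈ II L, |y (t - m) - y t| + L * (D * |∑ m ∈ T, κ m|) := by
        rw [Finset.sum_add_distrib, Finset.sum_comm, Finset.sum_const, II_card, nsmul_eq_mul]
        simp_rw [Finset.mul_sum]
    _ ≤ ∑ m ∈ T, |κ m| * (2 * D * (L * lam c m)) + L * (D * |∑ m ∈ T, κ m|) :=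
        add_le_add (Finset.sum_le_sum fun m _ => mul_le_mul_of_nonneg_left (h2 m) (abs_nonneg _)) le_rfl
    _ = _ := by
        rw [mul_add, Finset.mul_sum, Finset.mul_sum]
        congr 1; exact Finset.sum_congr rfl fun m _ => by ring

lemma osc1 {b k : ℕ} {y : ℤ → ℝ} {D : ℝ} (hD : ∀ u, |y u| ≤ D)
    (hb : ∀ a : ℕ, ∑ r ∈ Finset.range b, y (b * a + r) = 0) {κ : ℤ → ℝ} {V : ℝ} (hV : ∀ T : Finset ℤ, ∑ m ∈ T, |κ (m+1) - κ m| ≤ V) (t : ℤ) :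
    |∑ u ∈ II (b*k), κ (t - u) * y u| ≤ D * b * V := by
  have hD0 : 0 ≤ D := (abs_nonneg _).trans (hD 0)
  have key : |∑ u ∈ Finset.range (b*k), κ (t - u) * y u| ≤ D * b * ∑ u ∈ Finset.range (b*k), |κ (t-u-1+1) - κ (t-u-1)| := by
    induction k with
    | zero => simp
    | succ k ih =>
      rw [Nat.mul_succ, Finset.sum_range_add, Finset.sum_range_add, mul_add]
      refine (abs_add_le _ _).trans (add_le_add ih ?_)
      push_cast
      have e : ∑ r ∈ Finset.range b, κ (t - (b*k+r)) * y (b*k+r) = ∑ r ∈ Finset.range b, (κ (t - (b*k+r)) - κ (t - b*k)) * y (b*k+r) := by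
        simp_rw [sub_mul]; rw [Finset.sum_sub_distrib, ← Finset.mul_sum, hb k, mul_zero, sub_zero]
      rw [e]
      set X := ∑ r ∈ Finset.range b, |κ (t-(b*k+r)-1+1) - κ (t-(b*k+r)-1)| with hX
      have hr : ∀ r ∈ Finset.range b, |κ (t - (b*k+r)) - κ (t - b*k)| ≤ X := by
        intro r hr
        have := Finset.sum_range_sub (fun r : ℕ => κ (t - (b*k+r))) r
        push_cast at this; rw [add_zero] at this
        rw [← this]
        refine (Finset.abs_sum_le_sum_abs _ _).trans ((Finset.sum_le_sum_of_subset_of_nonneg (Finset.range_mono (Finset.mem_range.1 hr).le) fun _ _ _ => abs_nonneg _).trans (le_of_eq ?_))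
        refine Finset.sum_congr rfl fun i _ => ?_
        rw [abs_sub_comm]; congr 3 <;> ring
      calc _ ≤ ∑ r ∈ Finset.range b, X * D := (Finset.abs_sum_le_sum_abs _ _).trans (Finset.sum_le_sum fun r h => by
            rw [abs_mul]; exact mul_le_mul (hr r h) (hD _) (abs_nonneg _) ((abs_nonneg _).trans (hr r h)))
        _ = _ := by rw [Finset.sum_const, Finset.card_range, nsmul_eq_mul]; ring
  rw [II_sum]
  refine key.trans (mul_le_mul_of_nonneg_left ?_ (by positivity))
  refine le_trans (le_of_eq ?_) (hV ((Finset.range (b*k)).image fun u : ℕ => t - u - 1))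
  rw [Finset.sum_image fun a _ b _ h => by simpa using h]

section
variable {d : ℕ}

def Bx (d L : ℕ) : Finset (ZLat d) := Fintype.piFinset fun _ => II L
def Bx0 (i : Fin d) (L : ℕ) : Finset (ZLat d) := Fintype.piFinset fun r => if r = i then {0} else II L

lemma Bx_split (i : Fin d) (L : ℕ) (F : ZLat d → ℝ) : ∑ m ∈ Bx d L, F m = ∑ m ∈ Bx0 i L, ∑ u ∈ II L, F (Function.update m i u) := by
  rw [← Finset.sum_product']
  refine Finset.sum_bij' (fun m _ => (Function.update m i 0, m i)) (fun x _ => Function.update x.1 i x.2) (fun m hm => ?_) (fun x hx => ?_)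
    (fun m _ => by simp) (fun x hx => ?_) fun m _ => by simp
  · have hm := Fintype.mem_piFinset.1 hm
    refine Finset.mem_product.2 ⟨Fintype.mem_piFinset.2 fun r => ?_, hm i⟩
    rcases eq_or_ne r i with rfl | h
    · simp
    · simp only [if_neg h, Function.update_of_ne h]; exact hm r
  · obtain ⟨h1, h2⟩ := Finset.mem_product.1 hx
    have h1 := Fintype.mem_piFinset.1 h1
    refine Fintype.mem_piFinset.2 fun r => ?_
    rcases eq_or_ne r i with rfl | h
    · simpa using h2
    · have := h1 r; rw [if_neg h] at this; simpa [Function.update_of_ne h] using this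
  · obtain ⟨h1, h2⟩ := Finset.mem_product.1 hx
    have := Fintype.mem_piFinset.1 h1 i
    rw [if_pos rfl, Finset.mem_singleton] at this
    ext
    · simp only [Function.update_idem]; rw [← this, Function.update_eq_self]
    · simp

lemma Bx_card (L : ℕ) : (Bx d L).card = L^d := by
  simp [Bx, Fintype.card_piFinset, II_card]

lemma Bx0_card (i : Fin d) (L : ℕ) : ((Bx0 i L).card : ℝ) * L = L^d := by
  have := Bx_split i L fun _ => (1:ℝ)
  simp only [Finset.sum_const, Bx_card, II_card, nsmul_eq_mul, mul_one] at this
  rw [← this]; push_cast; rfl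

lemma Bx_count {c : ℕ} (hc : 0 < c) {L : ℕ} (hL : c ∣ L) (i : Fin d) (v : ℤ) :
    ∑ n ∈ Bx d L, (if (n i - v) / (c:ℤ) = n i / c then (0:ℝ) else 1) ≤ L^d * lam c v := by
  rw [Bx_split i]
  simp only [Function.update_self, Finset.sum_const, nsmul_eq_mul]
  rw [← Bx0_card i L, mul_assoc]
  exact mul_le_mul_of_nonneg_left (count1 hc hL v) (by positivity)

lemma prod_upd2 (i : Fin d) (κ : Fin d → ℤ → ℝ) (n m : ZLat d) (u : ℤ) :
    ∏ r, κ r (n r - Function.update m i u r) = κ i (n i - u) * ∏ r ∈ Finset.univ.erase i, κ r (n r - m r) := by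
  rw [← Finset.mul_prod_erase _ _ (Finset.mem_univ i), Function.update_self]
  congr 1
  exact Finset.prod_congr rfl fun r hr => by rw [Function.update_of_ne (Finset.mem_erase.1 hr).1]

lemma Bx0_sum (i : Fin d) (L : ℕ) (a : Fin d → ℤ → ℝ) (c : Fin d → ℝ) (h0 : ∀ r n, 0 ≤ a r n)
    (h : ∀ r ≠ i, ∀ (T : Finset ℤ), ∑ n ∈ T, a r n ≤ c r) :
    ∑ m ∈ Bx0 i L, ∏ r ∈ Finset.univ.erase i, a r (m r) ≤ ∏ r ∈ Finset.univ.erase i, c r := by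
  have := box_sum (Bx0 i L) (fun r n => if r = i then (if n = 0 then 1 else 0) else a r n) (fun r => if r = i then 1 else c r)
    (fun r n => by split_ifs; exacts [zero_le_one, le_rfl, h0 _ _]) (fun r T => by
      split_ifs with hr
      · rw [Finset.sum_ite_eq']; split_ifs <;> norm_num
      · exact h r hr T)
  have e : ∀ {f : Fin d → ℝ}, ∏ r ∈ Finset.univ.erase i, (if r = i then 1 else f r) = ∏ r ∈ Finset.univ.erase i, f r := fun {f} =>
    Finset.prod_congr rfl fun r hr => if_neg (Finset.mem_erase.1 hr).1
  rw [← Finset.mul_prod_erase _ (fun r => if r = i then 1 else c r) (Finset.mem_univ i), if_pos rfl, one_mul, e] at this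
  refine le_trans (le_of_eq (Finset.sum_congr rfl fun m hm => ?_)) this
  have h2 := Fintype.mem_piFinset.1 hm i
  rw [if_pos rfl, Finset.mem_singleton] at h2
  rw [← Finset.mul_prod_erase _ _ (Finset.mem_univ i), if_pos rfl, if_pos h2, one_mul]
  exact Finset.prod_congr rfl fun r hr => (if_neg (Finset.mem_erase.1 hr).1).symm

lemma genO (i : Fin d) {b k : ℕ} {y : ZLat d → ℝ} {D : ℝ} (hD : ∀ u, |y u| ≤ D)
    (hb : ∀ (m : ZLat d) (a : ℕ), ∑ r ∈ Finset.range b, y (Function.update m i (b * a + r)) = 0) (κ : Fin d → ℤ → ℝ) (C : Fin d → ℝ) {V : ℝ}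
    (hV : ∀ T : Finset ℤ, ∑ m ∈ T, |κ i (m+1) - κ i m| ≤ V) (hC : ∀ r ≠ i, ∀ T : Finset ℤ, ∑ m ∈ T, |κ r m| ≤ C r) (n : ZLat d) :
    |∑ m ∈ Bx d (b*k), y m * ∏ r, κ r (n r - m r)| ≤ D * b * V * ∏ r ∈ Finset.univ.erase i, C r := by
  have hD0 : 0 ≤ D := (abs_nonneg _).trans (hD 0)
  have hV0 : 0 ≤ V := by simpa using hV ∅
  rw [Bx_split i]
  simp_rw [prod_upd2]
  calc _ ≤ ∑ m ∈ Bx0 i (b*k), (D * b * V) * ∏ r ∈ Finset.univ.erase i, |κ r (n r - m r)| := by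
        refine (Finset.abs_sum_le_sum_abs _ _).trans (Finset.sum_le_sum fun m _ => ?_)
        have : ∑ u ∈ II (b*k), y (Function.update m i u) * (κ i (n i - u) * ∏ r ∈ Finset.univ.erase i, κ r (n r - m r)) =
            (∑ u ∈ II (b*k), κ i (n i - u) * y (Function.update m i u)) * ∏ r ∈ Finset.univ.erase i, κ r (n r - m r) := by
          rw [Finset.sum_mul]; exact Finset.sum_congr rfl fun u _ => by ring
        rw [this, abs_mul, Finset.abs_prod]
        exact mul_le_mul_of_nonneg_right (osc1 (y := fun u => y (Function.update m i u)) (fun u => hD _) (hb m) hV (n i)) (Finset.prod_nonneg fun _ _ => abs_nonneg _)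
    _ ≤ _ := by
        rw [← Finset.mul_sum]
        refine mul_le_mul_of_nonneg_left (Bx0_sum i _ (fun r u => |κ r (n r - u)|) C (fun _ _ => abs_nonneg _) fun r hr T => ?_) (by positivity)
        have := hC r hr (T.image fun u => n r - u)
        rwa [Finset.sum_image fun a _ b _ h => by simpa using h] at this

lemma genS (i : Fin d) {c L : ℕ} (hc : 0 < c) (hL : c ∣ L) {y : ZLat d → ℝ} {D : ℝ} (hD : ∀ u, |y u| ≤ D) (h0 : ∀ u ∉ Bx d L, y u = 0)
    (hy : ∀ (m : ZLat d) (u v : ℤ), u / (c:ℤ) = v / c → y (Function.update m i u) = y (Function.update m i v))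
    (κ : Fin d → ℤ → ℝ) (hκ : ∀ r ≠ i, ∀ T : Finset ℤ, ∑ m ∈ T, |κ r m| ≤ 1) (T : Finset ℤ) (hT : Finset.Ioo (-(L:ℤ)) L ⊆ T) :
    ∑ n ∈ Bx d L, |∑ m ∈ Bx d L, y m * ∏ r, κ r (n r - m r)| ≤ L^d * (2 * D * ∑ m ∈ T, |κ i m| * lam c m + D * |∑ m ∈ T, κ i m|) := by
  set X := 2 * D * ∑ m ∈ T, |κ i m| * lam c m + D * |∑ m ∈ T, κ i m|
  have h1 : ∀ n : ZLat d, |∑ m ∈ Bx d L, y m * ∏ r, κ r (n r - m r)| ≤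
      ∑ m ∈ Bx0 i L, (∏ r ∈ Finset.univ.erase i, |κ r (n r - m r)|) * |∑ u ∈ II L, κ i (n i - u) * y (Function.update m i u)| := fun n => by
    rw [Bx_split i]
    simp_rw [prod_upd2]
    refine (Finset.abs_sum_le_sum_abs _ _).trans (Finset.sum_le_sum fun m _ => le_of_eq ?_)
    rw [← Finset.abs_prod, ← abs_mul, Finset.mul_sum]
    congr 1; exact Finset.sum_congr rfl fun u _ => by ring
  have h2 : ∀ m : ZLat d, ∑ t ∈ II L, |∑ u ∈ II L, κ i (t - u) * y (Function.update m i u)| ≤ L * X := fun m =>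
    slow1 hc hL (fun u => hD _) (fun u hu => h0 _ fun h => hu (by simpa using Fintype.mem_piFinset.1 h i)) (hy m) (κ i) T hT
  have hX : 0 ≤ L * X := (Finset.sum_nonneg fun _ _ => abs_nonneg _).trans (h2 0)
  calc _ ≤ ∑ m ∈ Bx0 i L, ∑ n ∈ Bx d L, (∏ r ∈ Finset.univ.erase i, |κ r (n r - m r)|) * |∑ u ∈ II L, κ i (n i - u) * y (Function.update m i u)| := by
        rw [Finset.sum_comm]; exact Finset.sum_le_sum fun n _ => h1 n
    _ ≤ ∑ m ∈ Bx0 i L, L * X := Finset.sum_le_sum fun m _ => by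
        rw [Bx_split i]
        have e : ∀ (n : ZLat d) (t : ℤ), ∏ r ∈ Finset.univ.erase i, |κ r (Function.update n i t r - m r)| = ∏ r ∈ Finset.univ.erase i, |κ r (n r - m r)| := fun n t =>
          Finset.prod_congr rfl fun r hr => by rw [Function.update_of_ne (Finset.mem_erase.1 hr).1]
        simp_rw [e, Function.update_self, ← Finset.mul_sum]
        rw [← Finset.sum_mul]
        calc _ ≤ (∏ r ∈ Finset.univ.erase i, (1:ℝ)) * (L * X) := mul_le_mul
              (Bx0_sum i _ (fun r u => |κ r (u - m r)|) (fun _ => 1) (fun _ _ => abs_nonneg _) fun r hr T => by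
                have := hκ r hr (T.image fun u => u - m r)
                rwa [Finset.sum_image fun a _ b _ h => by simpa using h] at this) (h2 m) (Finset.sum_nonneg fun _ _ => abs_nonneg _) (by simp)
          _ = _ := by simp
    _ = _ := by rw [Finset.sum_const, nsmul_eq_mul, ← mul_assoc, Bx0_card]

end
end Th
end
end

section
open MeasureTheory Real Filter Topology
noncomputable section
namespace Th
section
variable {d : ℕ}

lemma core {i e : Fin d} (hie : i ≠ e) (b : ℕ) {η : ℝ} (hη : 0 < η) : ∃ c0 : ℕ, ∀ c ≥ c0, 0 < c → ∀ k : ℕ, c ∣ b * k →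
    ∀ (y g : ZLat d → ℝ) (D G : ℝ), (∀ u, |y u| ≤ D) → (∀ u, |g u| ≤ G) → (∀ u ∉ Bx d (b*k), y u = 0) →
    (∀ (m : ZLat d) (u v : ℤ), u / (c:ℤ) = v / c → y (Function.update m i u) = y (Function.update m i v)) →
    (∀ (m : ZLat d) (a : ℕ), ∑ r ∈ Finset.range b, y (Function.update m e (b * a + r)) = 0) →
    |∑ m ∈ Bx d (b*k), ∑ n ∈ Bx d (b*k), y m * g n * ∫ s in Set.Ioi 0, kq i s (n - m)| ≤ η * (D * G * (b*k:ℕ)^d) := by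
  obtain ⟨τ, hτ16, hτ⟩ : ∃ τ : ℝ, 16 ≤ τ ∧ b * 270 * (2 * (√τ)⁻¹) ≤ η/2 := by
    have h : Tendsto (fun τ : ℝ => b * 270 * (2 * (√τ)⁻¹)) atTop (𝓝 0) := by
      simpa using (rinv_tendsto.const_mul 2).const_mul (b * 270 : ℝ)
    obtain ⟨τ, h1, h2⟩ := ((h.eventually_le_const (by linarith : (0:ℝ) < η/2)).and (eventually_ge_atTop 16)).exists
    exact ⟨τ, h2, h1⟩
  have hτ0 : 0 < τ := by linarith
  have hl := (tsum_lam (w_summable τ) (fun m => integral_nonneg fun _ => abs_nonneg _) (l := lam) (C := 1)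
    (fun c m => ⟨lam_nonneg c m, lam_le c m⟩) lam_tendsto).const_mul 2
  rw [mul_zero] at hl
  obtain ⟨c0, hc0⟩ := eventually_atTop.1 (hl.eventually_le_const (by linarith : (0:ℝ) < η/2))
  refine ⟨c0, fun c hcc hc k hL y g D G hD hG h0 hy hb => ?_⟩
  have hl := hc0 c hcc
  have hD0 : 0 ≤ D := (abs_nonneg _).trans (hD 0)
  have hG0 : 0 ≤ G := (abs_nonneg _).trans (hG 0)
  set L := b * k with hLdef
  set A : ℝ → ZLat d → ℝ := fun s n => ∑ m ∈ Bx d L, y m * kq i s (n - m) with hA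
  have hAi : ∀ n, IntegrableOn (fun s => A s n) (Set.Ioi 0) := fun n => integrable_finsetSum _ fun m _ => (kq_int i (n-m)).const_mul _
  have hAs : ∀ n, IntegrableOn (fun s => A s n) (Set.Ioc 0 τ) := fun n => (hAi n).mono_set Set.Ioc_subset_Ioi_self
  have hAl : ∀ n, IntegrableOn (fun s => A s n) (Set.Ioi τ) := fun n => (hAi n).mono_set (Set.Ioi_subset_Ioi hτ0.le)
  have e1 : ∑ m ∈ Bx d L, ∑ n ∈ Bx d L, y m * g n * ∫ s in Set.Ioi 0, kq i s (n - m) = ∑ n ∈ Bx d L, g n * ∫ s in Set.Ioi 0, A s n := by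
    rw [Finset.sum_comm]
    refine Finset.sum_congr rfl fun n _ => ?_
    rw [integral_finsetSum _ fun m _ => (kq_int i (n-m)).const_mul _, Finset.mul_sum]
    exact Finset.sum_congr rfl fun m _ => by rw [integral_const_mul]; ring
  have large : ∀ n, ∫ s in Set.Ioi τ, |A s n| ≤ D * (η/2) := by
    intro n
    have hr := rint hτ0
    calc _ ≤ ∫ s in Set.Ioi τ, D * (b * 270) * (√s)⁻¹^3 := by
          refine setIntegral_mono_on (hAl n).abs (hr.1.const_mul _) measurableSet_Ioi fun s hs => ?_
          have hs16 : 16 ≤ s := hτ16.trans (le_of_lt hs)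
          have hs0 : 0 < s := by linarith
          have := genO e (k := k) hD hb (fun r v => if r = i then ep s v else ee s v) (fun r => if r = i then 45 * (√s)⁻¹^2 else 1) (V := 6 * (√s)⁻¹)
            (fun T => by simp only [if_neg hie.symm]; exact ee_tv hs16 T) (fun r _ T => by
              split_ifs
              · exact ep_l1_large hs16 T
              · calc _ = ∑ m ∈ T, ee s m := Finset.sum_congr rfl fun m _ => abs_of_nonneg (ee_nonneg hs0 m)
                  _ ≤ _ := sum_le_hasSum T (fun m _ => ee_nonneg hs0 m) (ee_hasSum hs0)) n
          rw [Finset.prod_ite_eq', if_pos (Finset.mem_erase.2 ⟨hie, Finset.mem_univ i⟩)] at this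
          exact this.trans (le_of_eq (by ring))
      _ = D * (b * 270 * (2 * (√τ)⁻¹)) := by rw [integral_const_mul, hr.2]; ring
      _ ≤ _ := mul_le_mul_of_nonneg_left hτ hD0
  have small : ∑ n ∈ Bx d L, ∫ s in Set.Ioc 0 τ, |A s n| ≤ (L:ℝ)^d * (D * (η/2)) := by
    rw [← integral_finsetSum _ fun n _ => (hAs n).abs]
    have hT : ∀ T : Finset ℤ, Finset.Ioo (-(L:ℤ)) L ⊆ T → ∫ s in Set.Ioc 0 τ, ∑ n ∈ Bx d L, |A s n| ≤
        (L:ℝ)^d * (D * (η/2) + D * ∫ s in Set.Ioc 0 τ, |∑ m ∈ T, ep s m|) := by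
      intro T hT
      have i1 : IntegrableOn (fun s => 2 * D * ∑ m ∈ T, |ep s m| * lam c m) (Set.Ioc 0 τ) :=
        (integrable_finsetSum _ fun m _ => (ep_intτ τ m).abs.mul_const _).const_mul _
      have i2 : IntegrableOn (fun s => D * |∑ m ∈ T, ep s m|) (Set.Ioc 0 τ) :=
        (integrable_finsetSum _ fun m _ => ep_intτ τ m).abs.const_mul _
      calc _ ≤ ∫ s in Set.Ioc 0 τ, (L:ℝ)^d * (2 * D * ∑ m ∈ T, |ep s m| * lam c m + D * |∑ m ∈ T, ep s m|) := by
            refine setIntegral_mono_on (integrable_finsetSum _ fun n _ => (hAs n).abs) ((i1.add i2).const_mul _) measurableSet_Ioc fun s hs => ?_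
            have := genS i hc hL hD h0 hy (fun r v => if r = i then ep s v else ee s v) (fun r hr T => by
              simp only [if_neg hr]
              calc _ = ∑ m ∈ T, ee s m := Finset.sum_congr rfl fun m _ => abs_of_nonneg (ee_nonneg hs.1 m)
                _ ≤ _ := sum_le_hasSum T (fun m _ => ee_nonneg hs.1 m) (ee_hasSum hs.1)) T hT
            simp only [if_true] at this
            exact this
        _ = (L:ℝ)^d * (D * (2 * ∑ m ∈ T, (∫ s in Set.Ioc 0 τ, |ep s m|) * lam c m) + D * ∫ s in Set.Ioc 0 τ, |∑ m ∈ T, ep s m|) := by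
            rw [integral_const_mul, integral_add i1 i2, integral_const_mul, integral_const_mul, integral_finsetSum _ fun m _ => (ep_intτ τ m).abs.mul_const _]
            simp_rw [integral_mul_const]; ring
        _ ≤ _ := by
            refine mul_le_mul_of_nonneg_left (add_le_add (mul_le_mul_of_nonneg_left (le_trans ?_ hl) hD0) le_rfl) (by positivity)
            refine mul_le_mul_of_nonneg_left (Summable.sum_le_tsum T (fun m _ => mul_nonneg (integral_nonneg fun _ => abs_nonneg _) (lam_nonneg c m)) ?_) zero_le_two
            exact Summable.of_nonneg_of_le (fun m => mul_nonneg (integral_nonneg fun _ => abs_nonneg _) (lam_nonneg c m))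
              (fun m => mul_le_of_le_one_right (integral_nonneg fun _ => abs_nonneg _) (lam_le c m)) (w_summable τ)
    have lim := (((ep_tail τ).const_mul D).const_add (D * (η/2))).const_mul ((L:ℝ)^d)
    rw [mul_zero, add_zero] at lim
    exact ge_of_tendsto lim ((eventually_ge_atTop _).mono hT)
  rw [e1]
  calc _ ≤ ∑ n ∈ Bx d L, G * ((∫ s in Set.Ioc 0 τ, |A s n|) + D * (η/2)) := by
        refine (Finset.abs_sum_le_sum_abs _ _).trans (Finset.sum_le_sum fun n _ => ?_)
        rw [abs_mul]
        refine mul_le_mul (hG n) ?_ (abs_nonneg _) hG0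
        refine abs_integral_le_integral_abs.trans ?_
        rw [← Set.Ioc_union_Ioi_eq_Ioi hτ0.le, setIntegral_union Set.Ioc_disjoint_Ioi_same measurableSet_Ioi (hAs n).abs (hAl n).abs]
        exact add_le_add le_rfl (large n)
    _ = G * ((∑ n ∈ Bx d L, ∫ s in Set.Ioc 0 τ, |A s n|) + (L:ℝ)^d * (D * (η/2))) := by
        rw [← Finset.mul_sum, Finset.sum_add_distrib, Finset.sum_const, Bx_card, nsmul_eq_mul]; push_cast; rfl
    _ ≤ G * ((L:ℝ)^d * (D * (η/2)) + (L:ℝ)^d * (D * (η/2))) := mul_le_mul_of_nonneg_left (add_le_add small le_rfl) hG0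
    _ = _ := by ring

def Pr (L : ℕ) (K y g : ZLat d → ℝ) : ℝ := ∑ m ∈ Bx d L, ∑ n ∈ Bx d L, y m * g n * K (n - m)

lemma corePK {j k : Fin d} (hjk : j ≠ k) {e : Fin d} {ε : ℝ} (he : (e = j ∧ ε = -1) ∨ (e = k ∧ ε = 1)) (b : ℕ) {η : ℝ} (hη : 0 < η) :
    ∃ c0 : ℕ, ∀ c ≥ c0, 0 < c → ∀ L : ℕ, c ∣ L → b ∣ L →
    ∀ (y g : ZLat d → ℝ) (D G : ℝ), (∀ u, |y u| ≤ D) → (∀ u, |g u| ≤ G) → (∀ u ∉ Bx d L, y u = 0) →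
    (∀ i ≠ e, ∀ (m : ZLat d) (u v : ℤ), u / (c:ℤ) = v / c → y (Function.update m i u) = y (Function.update m i v)) →
    (∀ (m : ZLat d) (a : ℕ), ∑ r ∈ Finset.range b, y (Function.update m e (b * a + r)) = 0) →
    |Pr L (PK j k) y g - ε * ∑ m ∈ Bx d L, y m * g m| ≤ η * (D * G * (L:ℝ)^d) := by
  have hη' : 0 < η / (d+1) := by positivity
  choose! c0 hc0 using fun (i : Fin d) (hi : i ≠ e) => core hi b hη'
  refine ⟨∑ i, c0 i, fun c hcc hc L hL hbL y g D G hD hG h0 hy hb => ?_⟩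
  obtain ⟨l, rfl⟩ := hbL
  set L := b * l
  set q : Fin d → ZLat d → ℝ := fun i m => ∫ s in Set.Ioi 0, kq i s m
  have hq : ∀ i ≠ e, |Pr L (q i) y g| ≤ η / (d+1) * (D * G * (L:ℝ)^d) := fun i hi =>
    hc0 i hi c ((Finset.single_le_sum (fun i _ => Nat.zero_le (c0 i)) (Finset.mem_univ i)).trans hcc) hc l hL y g D G hD hG h0 (hy i hi) hb
  have hδ : ∑ i, Pr L (q i) y g = ∑ m ∈ Bx d L, y m * g m := by
    unfold Pr
    rw [Finset.sum_comm]
    refine Finset.sum_congr rfl fun m hm => ?_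
    rw [Finset.sum_comm]
    have : ∀ n, ∑ i, y m * g n * q i (n - m) = if n = m then y m * g m else 0 := by
      intro n
      rw [← Finset.mul_sum, kq_sum (Fin.pos e)]
      rcases eq_or_ne n m with rfl | h
      · simp
      · rw [if_neg h, if_neg (sub_ne_zero.2 h), mul_zero]
    rw [Finset.sum_congr rfl fun n _ => this n, Finset.sum_ite_eq', if_pos hm]
  have hP : Pr L (PK j k) y g = Pr L (q k) y g - Pr L (q j) y g := by
    unfold Pr
    simp_rw [← Finset.sum_sub_distrib, PK, probK_eq]
    exact Finset.sum_congr rfl fun m _ => Finset.sum_congr rfl fun n _ => by ring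
  have hrest : |∑ i ∈ Finset.univ.erase e, Pr L (q i) y g| ≤ (d:ℝ) * (η / (d+1) * (D * G * (L:ℝ)^d)) - η / (d+1) * (D * G * (L:ℝ)^d) := by
    refine (Finset.abs_sum_le_sum_abs _ _).trans ((Finset.sum_le_sum fun i hi => hq i (Finset.mem_erase.1 hi).1).trans (le_of_eq ?_))
    rw [Finset.sum_const, Finset.card_erase_of_mem (Finset.mem_univ e), Finset.card_univ, Fintype.card_fin, nsmul_eq_mul, Nat.cast_sub (Fin.pos e)]
    push_cast; ring
  have hsp := Finset.add_sum_erase Finset.univ (fun i => Pr L (q i) y g) (Finset.mem_univ e)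
  simp only [hδ] at hsp
  have hX0 : 0 ≤ η / (d+1) * (D * G * (L:ℝ)^d) :=
    mul_nonneg hη'.le (mul_nonneg (mul_nonneg ((abs_nonneg _).trans (hD 0)) ((abs_nonneg _).trans (hG 0))) (by positivity))
  have hX : η * (D * G * (L:ℝ)^d) = (d:ℝ) * (η / (d+1) * (D * G * (L:ℝ)^d)) + η / (d+1) * (D * G * (L:ℝ)^d) := by field_simp
  rw [hP, hX, ← hsp]
  rw [abs_le] at hrest ⊢
  rcases he with ⟨rfl, rfl⟩ | ⟨rfl, rfl⟩
  · have h2 := abs_le.1 (hq k hjk.symm)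
    constructor <;> linarith
  · have h2 := abs_le.1 (hq j hjk)
    constructor <;> linarith

lemma coreE {E : ZLat d → ℝ} (hE : Summable fun m => |E m|) (hE0 : ∑' m, E m = 0) {η : ℝ} (hη : 0 < η) :
    ∃ c0 : ℕ, ∀ c ≥ c0, 0 < c → ∀ L : ℕ, c ∣ L →
    ∀ (y g : ZLat d → ℝ) (D G : ℝ), (∀ u, |y u| ≤ D) → (∀ u, |g u| ≤ G) → (∀ u ∉ Bx d L, y u = 0) →
    (∀ m m' : ZLat d, (∀ r, m r / (c:ℤ) = m' r / c) → y m = y m') → |Pr L E y g| ≤ η * (D * G * (L:ℝ)^d) := by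
  have hl0 : ∀ (c : ℕ) (u : ZLat d), 0 ≤ ∑ r, lam c (u r) ∧ ∑ r, lam c (u r) ≤ d := fun c u =>
    ⟨Finset.sum_nonneg fun r _ => lam_nonneg _ _, (Finset.sum_le_sum fun r _ => lam_le c (u r)).trans (by simp)⟩
  have hl := (tsum_lam hE (fun m => abs_nonneg _) (l := fun c (u : ZLat d) => ∑ r, lam c (u r)) (C := d) hl0
    (fun u => by simpa using tendsto_finsetSum Finset.univ fun r _ => lam_tendsto (u r))).const_mul 2
  rw [mul_zero] at hl
  obtain ⟨c0, hc0⟩ := eventually_atTop.1 (hl.eventually_le_const hη)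
  refine ⟨c0, fun c hcc hc L hL y g D G hD hG h0 hy => ?_⟩
  have hl := hc0 c hcc
  have hD0 : 0 ≤ D := (abs_nonneg _).trans (hD 0)
  have hG0 : 0 ≤ G := (abs_nonneg _).trans (hG 0)
  have hdiff : ∀ n u : ZLat d, |y (n - u) - y n| ≤ 2 * D := fun n u => by
    have := abs_sub (y (n-u)) (y n); have := hD (n-u); have := hD n; linarith
  have sm : ∀ n : ZLat d, Summable fun u => |E u| * |y (n - u) - y n| := fun n =>
    Summable.of_nonneg_of_le (fun u => by positivity) (fun u => mul_le_mul_of_nonneg_left (hdiff n u) (abs_nonneg _)) (hE.mul_right _)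
  have h1 : ∀ n : ZLat d, |∑ m ∈ Bx d L, y m * E (n - m)| ≤ ∑' u, |E u| * |y (n - u) - y n| := by
    intro n
    have e : ∑ m ∈ Bx d L, y m * E (n - m) = ∑' u, E u * (y (n - u) - y n) := by
      rw [← tsum_eq_sum (L := SummationFilter.unconditional _) (s := Bx d L) (f := fun m => y m * E (n - m)) fun m hm => by rw [h0 m hm, zero_mul], ← (Equiv.subLeft n).tsum_eq]
      have s2 : Summable fun u => E u * y n := hE.of_abs.mul_right _
      have s1 : Summable fun u => E u * (y (n - u) - y n) := Summable.of_abs (by simpa only [abs_mul] using sm n)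
      have : ∑' u, E u * (y (n - u) - y n) + ∑' u, E u * y n = ∑' u, (E u * (y (n - u) - y n) + E u * y n) := (s1.tsum_add s2).symm
      rw [tsum_mul_right, hE0, zero_mul, add_zero] at this
      rw [this]
      refine tsum_congr fun u => ?_
      simp only [Equiv.subLeft_apply, sub_sub_cancel]; ring
    rw [e]
    have := norm_tsum_le_tsum_norm (f := fun u => E u * (y (n - u) - y n)) (by simpa only [Real.norm_eq_abs, abs_mul] using sm n)
    simpa only [Real.norm_eq_abs, abs_mul] using this
  have h2 : ∀ u : ZLat d, ∑ n ∈ Bx d L, |y (n - u) - y n| ≤ 2 * D * ((L:ℝ)^d * ∑ r, lam c (u r)) := by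
    intro u
    calc _ ≤ ∑ n ∈ Bx d L, 2 * D * ∑ r, (if (n r - u r) / (c:ℤ) = n r / c then (0:ℝ) else 1) := Finset.sum_le_sum fun n _ => by
          by_cases h : ∀ r, (n r - u r) / (c:ℤ) = n r / c
          · rw [hy (n - u) n h, sub_self, abs_zero]
            exact mul_nonneg (by positivity) (Finset.sum_nonneg fun r _ => by split_ifs <;> norm_num)
          · push Not at h
            obtain ⟨r, hr⟩ := h
            refine (hdiff n u).trans (le_mul_of_one_le_right (by positivity) ?_)
            refine le_trans (le_of_eq (if_neg hr).symm) (Finset.single_le_sum (f := fun r => if (n r - u r) / (c:ℤ) = n r / c then (0:ℝ) else 1) (fun r _ => by split_ifs <;> norm_num) (Finset.mem_univ r))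
      _ = 2 * D * ∑ r, ∑ n ∈ Bx d L, (if (n r - u r) / (c:ℤ) = n r / c then (0:ℝ) else 1) := by
          rw [← Finset.mul_sum, Finset.sum_comm]
      _ ≤ _ := by
          rw [Finset.mul_sum (a := (L:ℝ)^d)]
          exact mul_le_mul_of_nonneg_left (Finset.sum_le_sum fun r _ => Bx_count hc hL r (u r)) (by positivity)
  have sl : Summable fun u => |E u| * ∑ r, lam c (u r) :=
    Summable.of_nonneg_of_le (fun u => mul_nonneg (abs_nonneg _) (hl0 c u).1) (fun u => mul_le_mul_of_nonneg_left (hl0 c u).2 (abs_nonneg _)) (hE.mul_right _)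
  unfold Pr
  rw [Finset.sum_comm]
  calc _ ≤ ∑ n ∈ Bx d L, G * ∑' u, |E u| * |y (n - u) - y n| := by
        refine (Finset.abs_sum_le_sum_abs _ _).trans (Finset.sum_le_sum fun n _ => ?_)
        have : ∑ m ∈ Bx d L, y m * g n * E (n - m) = g n * ∑ m ∈ Bx d L, y m * E (n - m) := by
          rw [Finset.mul_sum]; exact Finset.sum_congr rfl fun m _ => by ring
        rw [this, abs_mul]
        exact mul_le_mul (hG n) (h1 n) (abs_nonneg _) hG0
    _ = G * ∑' u, |E u| * ∑ n ∈ Bx d L, |y (n - u) - y n| := by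
        rw [← Finset.mul_sum, ← Summable.tsum_finsetSum fun n _ => sm n]
        simp_rw [Finset.mul_sum]
    _ ≤ G * ∑' u, (2 * D * (L:ℝ)^d) * (|E u| * ∑ r, lam c (u r)) := by
        refine mul_le_mul_of_nonneg_left (Summable.tsum_le_tsum (fun u => ?_) ?_ (sl.mul_left _)) hG0
        · exact (mul_le_mul_of_nonneg_left (h2 u) (abs_nonneg _)).trans (le_of_eq (by ring))
        · simp_rw [Finset.mul_sum]; exact summable_sum fun n _ => sm n
    _ = D * G * (L:ℝ)^d * (2 * ∑' u, |E u| * ∑ r, lam c (u r)) := by rw [tsum_mul_left]; ring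
    _ ≤ D * G * (L:ℝ)^d * η := mul_le_mul_of_nonneg_left hl (by positivity)
    _ = _ := by ring

end
end Th
end
end

section
open MeasureTheory Real Filter Topology
noncomputable section
namespace Th

structure Prm (p a : ℝ) where
  M : ℕ
  hM : 2 ≤ M
  θ : ℝ
  ρ : ℝ
  h0 : 0 < θ
  h1 : θ ≤ 1
  hr : 1 ≤ ρ
  e2 : (1 - 2*θ) * ρ = 1
  hu : a * (θ + (M-1)*(θ*(ρ+1))) ≤ 1
  hp : 1 ≤ ρ^p * (1 - 1/M)

lemma prm_ex {p a : ℝ} (ha : 1 < a) (hap : a < p) : Nonempty (Prm p a) := by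
  obtain ⟨M, hM⟩ := exists_nat_ge (max 2 (p/(p-a)))
  have h2 : (2:ℝ) ≤ M := (le_max_left _ _).trans hM
  have h3 : p/(p-a) ≤ M := (le_max_right _ _).trans hM
  have ha0 : 0 < a := by linarith
  have hM0 : (0:ℝ) < M := by linarith
  rw [div_le_iff₀ (by linarith)] at h3
  obtain ⟨x, hx⟩ : ∃ x : ℝ, x = 1/(a*M) := ⟨_, rfl⟩
  have hax : a * x * M = 1 := by rw [hx]; field_simp
  have hx0 : 0 < x := by rw [hx]; positivity
  have hMx : M * x < 1 := by nlinarith [mul_pos hM0 hx0]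
  have hx1 : x < 1/2 := by nlinarith
  have hρ : 0 < 1 - x := by linarith
  refine ⟨⟨M, by exact_mod_cast h2, x/2, (1-x)⁻¹, by linarith, by linarith, (one_le_inv₀ hρ).2 (by linarith), ?_, ?_, ?_⟩⟩
  · field_simp
  · have : x/2 + (M-1)*(x/2*((1-x)⁻¹+1)) ≤ x * M := by
      rw [show x/2 + (M-1)*(x/2*((1-x)⁻¹+1)) = x/2 * (1 + (M-1)*(2-x)/(1-x)) by field_simp; ring]
      have : 1 + (M-1)*(2-x)/(1-x) ≤ 2 * M := by
        rw [← le_sub_iff_add_le', div_le_iff₀ hρ]; nlinarith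
      nlinarith
    nlinarith
  · have hM1 : (1:ℝ)/M = a * x := by rw [← hax]; field_simp
    rw [hM1, Real.inv_rpow hρ.le, inv_mul_eq_div, one_le_div (by positivity)]
    have hpx : 0 < 1 + p * x := by nlinarith
    calc (1-x)^p ≤ (Real.exp (-x))^p := Real.rpow_le_rpow hρ.le (by linarith [Real.add_one_le_exp (-x)]) (by linarith)
      _ = (Real.exp (p*x))⁻¹ := by rw [← Real.exp_mul, ← Real.exp_neg]; congr 1; ring
      _ ≤ (1 + p*x)⁻¹ := inv_anti₀ hpx (by linarith [Real.add_one_le_exp (p*x)])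
      _ ≤ _ := by
        rw [inv_le_iff_one_le_mul₀ hpx]
        have : p * (a * x) ≤ p - a := by
          have : p * (a * x) ≤ (M * (p - a)) * (a * x) := mul_le_mul_of_nonneg_right h3 (by positivity)
          calc _ ≤ _ := this
            _ = (a * x * M) * (p - a) := by ring
            _ = _ := by rw [hax, one_mul]
        nlinarith [mul_le_mul_of_nonneg_right this hx0.le]

section
variable {d : ℕ} {p a : ℝ} (P : Prm p a) (j k : Fin d) (S : ℕ → ℕ)

def dr (l : ℕ) : Fin d := if Even l then j else k
def om (l : ℕ) (x : ZLat d) : ℤ := (x (dr j k l) / (S (l+1) : ℤ)) % (P.M : ℤ)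
def al : ℕ → ZLat d → ℝ
  | 0, x => if ∀ r, x r / (S 0 : ℤ) = 0 then 1 else 0
  | l+1, x => if om P j k S l x = 0 then 0 else al l x
def ka : ℝ := P.θ * (P.ρ + 1)
def uu : ℝ := P.θ + (P.M - 1) * ka P
def dd (l : ℕ) (x : ZLat d) : ℝ := al P j k S l x * ((-1)^l * P.ρ^l * (ka P * (if om P j k S l x = 0 then (P.M:ℝ) - 1 else -1)))

variable {S} {n : ℕ} (hS0 : ∀ l, 0 < S l) (hS : ∀ l < n, P.M * S (l+1) ∣ S l)

lemma div_dep {c c' : ℕ} (h : c ∣ c') {u v : ℤ} (huv : u / (c:ℤ) = v / c) : u / (c':ℤ) = v / c' := by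
  obtain ⟨w, rfl⟩ := h
  push_cast
  rw [← Int.ediv_ediv_of_nonneg (by positivity), ← Int.ediv_ediv_of_nonneg (by positivity), huv]

lemma S_dvd (hS : ∀ l < n, P.M * S (l+1) ∣ S l) {l : ℕ} (e : ℕ) (h : l + e ≤ n) : S (l+e) ∣ S l := by
  induction e with
  | zero => exact dvd_rfl
  | succ e ih => exact ((Dvd.intro_left _ rfl).trans (hS (l+e) (by omega))).trans (ih (by omega))

lemma al_dep (hS : ∀ l < n, P.M * S (l+1) ∣ S l) {l : ℕ} (hl : l ≤ n) {x x' : ZLat d} (h : ∀ r, x r / (S l : ℤ) = x' r / S l) : al P j k S l x = al P j k S l x' := by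
  induction l with
  | zero => simp only [al, h]
  | succ l ih =>
    rw [al, al, om, om, h, ih (by omega) fun r => div_dep (S_dvd P hS 1 hl) (h r)]

lemma dd_dep (hS : ∀ l < n, P.M * S (l+1) ∣ S l) {l : ℕ} (hl : l < n) {x x' : ZLat d} (h : ∀ r, x r / (S n : ℤ) = x' r / S n) : dd P j k S l x = dd P j k S l x' := by
  have h1 : ∀ r, x r / (S (l+1) : ℤ) = x' r / S (l+1) := fun r => by
    have := S_dvd P hS (l := l+1) (n-(l+1)) (by omega)
    rw [show l+1+(n-(l+1)) = n by omega] at this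
    exact div_dep this (h r)
  rw [dd, dd, om, om, h1, al_dep P j k hS hl.le fun r => div_dep (S_dvd P hS 1 hl) (h1 r)]

lemma dd_slow (hS : ∀ l < n, P.M * S (l+1) ∣ S l) {l : ℕ} (hl : l < n) {i : Fin d} (hi : i ≠ dr j k l) (m : ZLat d) (u v : ℤ) (h : u / (S l : ℤ) = v / S l) :
    dd P j k S l (Function.update m i u) = dd P j k S l (Function.update m i v) := by
  rw [dd, dd, om, om, Function.update_of_ne hi.symm, Function.update_of_ne hi.symm, al_dep P j k hS hl.le fun r => ?_]
  rcases eq_or_ne r i with rfl | hr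
  · simpa using h
  · simp [Function.update_of_ne hr]

lemma dd_osc (hS0 : ∀ l, 0 < S l) (hS : ∀ l < n, P.M * S (l+1) ∣ S l) {l : ℕ} (hl : l < n) (m : ZLat d) (t : ℕ) :
    ∑ r ∈ Finset.range (P.M * S (l+1)), dd P j k S l (Function.update m (dr j k l) ((P.M * S (l+1) : ℕ) * t + r)) = 0 := by
  set s := S (l+1)
  have hs : 0 < s := hS0 _
  have hM := P.hM
  have hMs : 0 < P.M * s := by positivity
  have h1 : ∀ r ∈ Finset.range (P.M * s), dd P j k S l (Function.update m (dr j k l) ((P.M * s : ℕ) * t + r)) =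
      al P j k S l (Function.update m (dr j k l) ((P.M * s : ℕ) * t)) * ((-1)^l * P.ρ^l * ka P) * (P.M * (if r < s then 1 else 0) - 1) := by
    intro r hr
    have hr := Finset.mem_range.1 hr
    have e1 : al P j k S l (Function.update m (dr j k l) ((P.M * s : ℕ) * t + r)) = al P j k S l (Function.update m (dr j k l) ((P.M * s : ℕ) * t)) := by
      refine al_dep P j k hS hl.le fun i => ?_
      rcases eq_or_ne i (dr j k l) with rfl | hi
      · simp only [Function.update_self]
        refine div_dep (hS l hl) ?_
        change ((P.M * s : ℕ) * t + r : ℤ) / ((P.M * s : ℕ) : ℤ) = _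
        rw [Int.mul_add_ediv_left _ _ (by positivity), Int.mul_ediv_cancel_left _ (by positivity), Int.ediv_eq_zero_of_lt (by positivity) (by exact_mod_cast hr), add_zero]
      · simp [Function.update_of_ne hi]
    have e2 : om P j k S l (Function.update m (dr j k l) ((P.M * s : ℕ) * t + r)) = 0 ↔ r < s := by
      rw [om, Function.update_self]
      change ((P.M * s : ℕ) * t + r : ℤ) / (s : ℤ) % P.M = 0 ↔ _
      rw [show ((P.M * s : ℕ) * t + r : ℤ) = s * (P.M * t) + r by push_cast; ring, Int.mul_add_ediv_left _ _ (by positivity), Int.mul_add_emod_self_left]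
      have : ((r:ℤ) / s) % P.M = ((r / s : ℕ) : ℤ) := by
        rw [← Int.natCast_ediv, ← Int.natCast_emod, Nat.mod_eq_of_lt]
        exact Nat.div_lt_of_lt_mul (by rwa [mul_comm])
      rw [this]
      norm_cast
      rw [Nat.div_eq_zero_iff]; omega
    rw [dd, e1]
    by_cases h : r < s
    · rw [if_pos (e2.2 h), if_pos h]; ring
    · rw [if_neg (fun h' => h (e2.1 h')), if_neg h]; ring
  rw [Finset.sum_congr rfl h1, ← Finset.mul_sum, Finset.sum_sub_distrib, ← Finset.mul_sum, ← Finset.sum_filter]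
  have : (Finset.range (P.M * s)).filter (· < s) = Finset.range s := by
    ext r; simp only [Finset.mem_filter, Finset.mem_range]
    have : s ≤ P.M * s := Nat.le_mul_of_pos_left _ (by omega)
    omega
  rw [this]; simp

lemma Bx_zero (e : Fin d) {b L : ℕ} (hb : b ∣ L) {y : ZLat d → ℝ} (h : ∀ (m : ZLat d) (t : ℕ), ∑ r ∈ Finset.range b, y (Function.update m e ((b:ℤ) * t + r)) = 0) :
    ∑ x ∈ Bx d L, y x = 0 := by
  obtain ⟨w, rfl⟩ := hb
  rw [Bx_split e]
  refine Finset.sum_eq_zero fun m hm => ?_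
  rw [II_sum]
  clear hm
  induction w with
  | zero => simp
  | succ w ih =>
    rw [Nat.mul_succ, Finset.sum_range_add, ih, zero_add, ← h m w]
    exact Finset.sum_congr rfl fun r _ => by push_cast; rfl

lemma mem_Bx {L : ℕ} (hL : 0 < L) (x : ZLat d) : x ∈ Bx d L ↔ ∀ r, x r / (L:ℤ) = 0 := by
  rw [Bx, Fintype.mem_piFinset]
  refine forall_congr' fun r => ?_
  rw [II, Finset.mem_Ico]
  refine ⟨fun h => Int.ediv_eq_zero_of_lt h.1 h.2, fun h => ?_⟩
  have h1 := Int.mul_ediv_add_emod (x r) L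
  have hL' : (0:ℤ) < L := by exact_mod_cast hL
  rw [h, mul_zero, zero_add] at h1
  exact ⟨h1 ▸ Int.emod_nonneg _ hL'.ne', h1 ▸ Int.emod_lt_of_pos _ hL'⟩

lemma al_01 (l : ℕ) (x : ZLat d) : al P j k S l x = 0 ∨ al P j k S l x = 1 := by
  induction l with
  | zero => rw [al]; split_ifs <;> simp
  | succ l ih => rw [al]; split_ifs <;> simp [ih]

lemma al_out (hS0 : ∀ l, 0 < S l) (l : ℕ) {x : ZLat d} (hx : x ∉ Bx d (S 0)) : al P j k S l x = 0 := by
  induction l with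
  | zero => rw [al, if_neg]; rwa [mem_Bx (hS0 0)] at hx
  | succ l ih => rw [al, ih, ite_self]

lemma al_sum (hS0 : ∀ l, 0 < S l) (hS : ∀ l < n, P.M * S (l+1) ∣ S l) {l : ℕ} (hl : l ≤ n) :
    ∑ x ∈ Bx d (S 0), al P j k S l x = (S 0 : ℝ)^d * (1 - 1/P.M)^l := by
  induction l with
  | zero =>
    rw [Finset.sum_congr rfl (g := fun _ => (1:ℝ)) fun x hx => by rw [al, if_pos ((mem_Bx (hS0 0) x).1 hx)]]
    simp [Bx_card]
  | succ l ih =>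
    have hM : (0:ℝ) < P.M := by have := P.hM; positivity
    have hdv : P.M * S (l+1) ∣ S 0 := (hS l hl).trans (by have := S_dvd P hS (l := 0) l (by omega); rwa [zero_add] at this)
    have hz := Bx_zero (dr j k l) hdv (dd_osc P j k hS0 hS hl)
    have hc : (-1)^l * P.ρ^l * ka P * P.M ≠ 0 := by
      have := P.hr; have := P.h0
      have hk : 0 < ka P := by unfold ka; positivity
      have hρ : 0 < P.ρ := by linarith
      have : ((-1:ℝ))^l ≠ 0 := pow_ne_zero _ (by norm_num)
      positivity
    have e : ∀ x, al P j k S (l+1) x = al P j k S l x * (1 - 1/P.M) - ((-1)^l * P.ρ^l * ka P * P.M)⁻¹ * dd P j k S l x := by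
      intro x
      rw [al, dd]
      rw [eq_sub_iff_add_eq', ← eq_sub_iff_add_eq, inv_mul_eq_iff_eq_mul₀ hc]
      split_ifs <;> field_simp <;> ring
    simp_rw [e]
    rw [Finset.sum_sub_distrib, ← Finset.mul_sum, hz, ← Finset.sum_mul, ih (by omega)]; ring

end
end Th
end
end

section
open MeasureTheory Real Filter Topology
noncomputable section
namespace Th
section
variable {d : ℕ} {p q a : ℝ} (P : Prm p a) (j k : Fin d) (S : ℕ → ℕ)

def ff (n : ℕ) (x : ZLat d) : ℝ := ∑ l ∈ Finset.range n, dd P j k S l x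
def hh (n : ℕ) (x : ZLat d) : ℝ := ∑ l ∈ Finset.range n, -(-1)^l * dd P j k S l x
def WX (n : ℕ) (x : ZLat d) : ℝ := ∑ l ∈ Finset.range n, (uu P * P.ρ^l)^p * (al P j k S l x - al P j k S (l+1) x)

lemma ka_pos : 0 < ka P := by have := P.hr; have := P.h0; unfold ka; positivity
lemma uu_pos : 0 < uu P := by
  have := P.h0; have h : (2:ℝ) ≤ P.M := by exact_mod_cast P.hM
  have := mul_pos (by linarith : (0:ℝ) < P.M - 1) (ka_pos P)
  unfold uu; linarith

variable {S}

lemma inv (ha : 1 < a) (hS0 : ∀ l, 0 < S l) {x : ZLat d} (hx : x ∈ Bx d (S 0)) (n : ℕ) :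
    (al P j k S n x = 1 ∧ P.θ + ff P j k S n x = (-1)^n * P.ρ^n * P.θ ∧ 1 - P.θ + hh P j k S n x = (1-P.θ) * P.ρ^n ∧ WX P j k S n x = 0) ∨
    (al P j k S n x = 0 ∧ (a-1) * |P.θ + ff P j k S n x| ≤ |1 - P.θ + hh P j k S n x| ∧ WX P j k S n x ≤ |P.θ + ff P j k S n x|^p) := by
  induction n with
  | zero => left; simp [al, ff, hh, WX, (mem_Bx (hS0 0) x).1 hx]
  | succ n ih =>
    have hsq : ((-1:ℝ))^n * (-1)^n = 1 := by rw [← mul_pow]; norm_num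
    have hab : |((-1:ℝ))^n| = 1 := by rw [abs_pow]; simp
    have hρ : 0 < P.ρ^n := pow_pos (by linarith [P.hr]) n
    have e2 := P.e2
    have hu := P.hu
    have hu0 := uu_pos P
    rw [ff, hh, WX, Finset.sum_range_succ, Finset.sum_range_succ, Finset.sum_range_succ, ← ff, ← hh, ← WX, ← add_assoc, ← add_assoc]
    rcases ih with ⟨h1, h2, h3, h4⟩ | ⟨h1, h2, h3⟩
    · rw [h2, h3, h4]
      by_cases ho : om P j k S n x = 0
      · right
        have e : (-1)^n * P.ρ^n * P.θ + dd P j k S n x = (-1)^n * (uu P * P.ρ^n) := by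
          rw [dd, h1, if_pos ho, uu]; ring
        have e' : (1-P.θ) * P.ρ^n + -(-1)^n * dd P j k S n x = (1 - uu P) * P.ρ^n := by
          rw [dd, h1, if_pos ho, uu]; linear_combination (-(ka P * P.ρ^n * (P.M - 1))) * hsq
        have hal : al P j k S (n+1) x = 0 := by rw [al, if_pos ho]
        have hau : a * uu P ≤ 1 := hu
        have hu1 : uu P ≤ 1 := by nlinarith
        rw [e, e', hal, h1, abs_mul, hab, one_mul, abs_mul, abs_of_pos hu0, abs_of_pos hρ, abs_of_nonneg (mul_nonneg (sub_nonneg.2 hu1) hρ.le)]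
        refine ⟨rfl, ?_, by simp⟩
        rw [← mul_assoc]; exact mul_le_mul_of_nonneg_right (by linarith) hρ.le
      · left
        refine ⟨by rw [al, if_neg ho, h1], ?_, ?_, by rw [al, if_neg ho]; ring⟩
        · rw [dd, h1, if_neg ho, ka]; ring
        · rw [dd, h1, if_neg ho, ka]; linear_combination (P.θ * (P.ρ+1) * P.ρ^n) * hsq - P.ρ^n * e2
    · right
      have hal : al P j k S (n+1) x = 0 := by rw [al, h1, ite_self]
      have : dd P j k S n x = 0 := by rw [dd, h1, zero_mul]
      rw [this, hal, h1]
      simpa using ⟨h2, h3⟩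

lemma inv1 (ha : 1 < a) (hp : 0 < p) (hS0 : ∀ l, 0 < S l) {x : ZLat d} (hx : x ∈ Bx d (S 0)) (n : ℕ) :
    (a-1) * |P.θ + ff P j k S n x| ≤ |1 - P.θ + hh P j k S n x| ∧ WX P j k S n x ≤ |P.θ + ff P j k S n x|^p := by
  rcases inv P j k ha hS0 hx n with ⟨-, h2, h3, h4⟩ | h
  · refine ⟨?_, by rw [h4]; positivity⟩
    have hρ : 0 < P.ρ^n := pow_pos (by linarith [P.hr]) n
    have := P.h1
    have h0 := P.h0
    have hM : (2:ℝ) ≤ P.M := by exact_mod_cast P.hM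
    have hu : a * uu P ≤ 1 := P.hu
    have : P.θ ≤ uu P := by unfold uu; nlinarith [ka_pos P]
    have hat : a * P.θ ≤ 1 := (mul_le_mul_of_nonneg_left this (by linarith)).trans hu
    rw [h2, h3, abs_mul, abs_mul, abs_pow, abs_neg, abs_one, one_pow, one_mul, abs_of_pos hρ, abs_of_pos h0, abs_of_nonneg (mul_nonneg (by linarith) hρ.le)]
    nlinarith
  · exact h.2

lemma WX_sum (hp : 0 < p) {n : ℕ} (hS0 : ∀ l, 0 < S l) (hS : ∀ l < n, P.M * S (l+1) ∣ S l) :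
    (S 0:ℝ)^d * (n * (uu P^p / P.M)) ≤ ∑ x ∈ Bx d (S 0), WX P j k S n x := by
  have hu0 := uu_pos P
  have hM : (2:ℝ) ≤ P.M := by exact_mod_cast P.hM
  have hρ : 0 < P.ρ := by linarith [P.hr]
  unfold WX
  rw [Finset.sum_comm]
  calc _ = ∑ l ∈ Finset.range n, (S 0:ℝ)^d * (uu P^p / P.M) := by
        rw [Finset.sum_const, Finset.card_range, nsmul_eq_mul]; ring
    _ ≤ _ := Finset.sum_le_sum fun l hl => by
        have hl := Finset.mem_range.1 hl
        rw [← Finset.mul_sum, Finset.sum_sub_distrib, al_sum P j k hS0 hS hl.le, al_sum P j k hS0 hS hl]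
        rw [Real.mul_rpow hu0.le (by positivity), ← Real.rpow_natCast P.ρ, ← Real.rpow_mul hρ.le, mul_comm (l:ℝ) p, Real.rpow_mul hρ.le, Real.rpow_natCast]
        have h1 : 1 ≤ (P.ρ^p * (1 - 1/P.M))^l := one_le_pow₀ P.hp
        rw [mul_pow] at h1
        calc _ = (S 0:ℝ)^d * (uu P^p / P.M) * 1 := (mul_one _).symm
          _ ≤ (S 0:ℝ)^d * (uu P^p / P.M) * ((P.ρ^p)^l * (1 - 1/P.M)^l) := mul_le_mul_of_nonneg_left h1 (by positivity)
          _ = _ := by rw [pow_succ]; field_simp; ring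

lemma dd_le {n l : ℕ} (hl : l ≤ n) (x : ZLat d) : |dd P j k S l x| ≤ P.ρ^n * (ka P * P.M) := by
  have hM : (2:ℝ) ≤ P.M := by exact_mod_cast P.hM
  have hρ : 0 < P.ρ := by linarith [P.hr]
  have hk := ka_pos P
  have h1 : |al P j k S l x| ≤ 1 := by rcases al_01 P j k (S := S) l x with h | h <;> simp [h]
  have h2 : |(if om P j k S l x = 0 then (P.M:ℝ) - 1 else -1)| ≤ P.M := by split_ifs <;> rw [abs_le] <;> constructor <;> linarith
  have h3 : P.ρ^l ≤ P.ρ^n := pow_le_pow_right₀ P.hr hl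
  rw [dd, abs_mul, abs_mul, abs_mul, abs_mul, abs_pow, abs_neg, abs_one, one_pow, one_mul, abs_of_pos (pow_pos hρ l), abs_of_pos hk]
  calc _ ≤ 1 * (P.ρ^n * (ka P * P.M)) := mul_le_mul h1 (mul_le_mul h3 (mul_le_mul_of_nonneg_left h2 hk.le) (by positivity) (by positivity)) (by positivity) zero_le_one
    _ = _ := one_mul _

lemma Pr_sum (L n : ℕ) (K g : ZLat d → ℝ) (y : ℕ → ZLat d → ℝ) : Pr L K (fun x => ∑ l ∈ Finset.range n, y l x) g = ∑ l ∈ Finset.range n, Pr L K (y l) g := by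
  unfold Pr
  rw [Finset.sum_comm (s := Finset.range n)]
  refine Finset.sum_congr rfl fun m _ => ?_
  rw [Finset.sum_comm (s := Finset.range n)]
  exact Finset.sum_congr rfl fun m' _ => by rw [Finset.sum_mul, Finset.sum_mul]

lemma pairing (hpq : p.HolderConjugate q) {j k : Fin d} (hjk : j ≠ k) {E : ZLat d → ℝ} (hE : Summable fun m => |E m|) (hE0 : ∑' m, E m = 0)
    {N : ℝ} (hN : BndK (fun m => PK j k m + E m) p q N) (n : ℕ) : ∃ S : ℕ → ℕ, (∀ l, 0 < S l) ∧ (∀ l < n, P.M * S (l+1) ∣ S l) ∧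
    ∑ x ∈ Bx d (S 0), |hh P j k S n x|^p - (S 0:ℝ)^d ≤ N * (∑ x ∈ Bx d (S 0), |ff P j k S n x|^p)^(1/p) * (∑ x ∈ Bx d (S 0), |hh P j k S n x|^p)^(1/q) := by
  have hp1 : 0 < p - 1 := by have := hpq.lt; linarith
  have hρ : 0 < P.ρ := by linarith [P.hr]
  obtain ⟨D, hDe⟩ : ∃ D, D = P.ρ^n * (ka P * P.M) := ⟨_, rfl⟩
  have hD0 : 0 ≤ D := by rw [hDe]; have := ka_pos P; positivity
  obtain ⟨G, hGe⟩ : ∃ G, G = (n * D)^(p-1) := ⟨_, rfl⟩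
  have hG0 : 0 ≤ G := by rw [hGe]; positivity
  obtain ⟨η, hη⟩ : ∃ η : ℝ, η = 1/(2*n*D*G+1) := ⟨_, rfl⟩
  have hη0 : 0 < η := by rw [hη]; positivity
  have hηle : 2*n*D*G*η ≤ 1 := by rw [hη, mul_one_div, div_le_one (by positivity)]; linarith
  have he : ∀ l : ℕ, (dr j k l = j ∧ -(-1:ℝ)^l = -1) ∨ (dr j k l = k ∧ -(-1:ℝ)^l = 1) := by
    intro l; unfold dr
    rcases Nat.even_or_odd l with h | h
    · left; simp [h, h.neg_one_pow]
    · right; simp [Nat.not_even_iff_odd.2 h, h.neg_one_pow]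
  choose c0 hc0 using fun l b : ℕ => corePK hjk (he l) b hη0
  obtain ⟨B0, hB0⟩ := coreE hE hE0 hη0
  have hM := P.hM
  set C : ℕ → ℕ := fun i => Nat.rec (B0+1) (fun i c => P.M * c * (c0 (n-(i+1)) (P.M * c) + 1)) i with hC
  have hCs : ∀ i, C (i+1) = P.M * C i * (c0 (n-(i+1)) (P.M * C i) + 1) := fun i => rfl
  have hC0 : ∀ i, 0 < C i := by
    intro i; induction i with
    | zero => exact Nat.succ_pos _
    | succ i ih => rw [hCs]; positivity
  obtain ⟨S, hS⟩ : ∃ S : ℕ → ℕ, S = fun l => C (n-l) := ⟨_, rfl⟩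
  have hS0 : ∀ l, 0 < S l := fun l => by rw [hS]; exact hC0 _
  have hS1 : ∀ l < n, S l = P.M * S (l+1) * (c0 l (P.M * S (l+1)) + 1) := fun l hl => by
    simp only [hS]
    have := hCs (n-(l+1))
    rwa [show n-(l+1)+1 = n-l by omega, show n-(n-l) = l by omega] at this
  have hSd : ∀ l < n, P.M * S (l+1) ∣ S l := fun l hl => ⟨_, hS1 l hl⟩
  refine ⟨S, hS0, hSd, ?_⟩
  have hd0 : ∀ l ≤ n, S l ∣ S 0 := fun l hl => by have := S_dvd P hSd (l := 0) l (by omega); rwa [zero_add] at this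
  obtain ⟨h, hh'⟩ : ∃ h, h = hh P j k S n := ⟨_, rfl⟩
  obtain ⟨f, hf'⟩ : ∃ f, f = ff P j k S n := ⟨_, rfl⟩
  set L := S 0
  set g : ZLat d → ℝ := fun x => SignType.sign (h x) * |h x|^(p-1) with hg
  have hga : ∀ x, |g x| = |h x|^(p-1) := by
    intro x
    rcases eq_or_ne (h x) 0 with h0 | h0
    · simp [hg, h0, Real.zero_rpow hp1.ne']
    · have : |(SignType.sign (h x) : ℝ)| = 1 := by rcases lt_or_gt_of_ne h0 with h | h <;> simp [h]
      simp only [hg]; rw [abs_mul, this, one_mul, abs_of_nonneg (by positivity)]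
  have hdD : ∀ l < n, ∀ x, |dd P j k S l x| ≤ D := fun l hl x => hDe ▸ dd_le P j k hl.le x
  have hfD : ∀ x, |f x| ≤ n * D := fun x => by
    rw [hf', ff]
    refine (Finset.abs_sum_le_sum_abs _ _).trans ((Finset.sum_le_sum fun l hl => hdD l (Finset.mem_range.1 hl) x).trans (by simp))
  have hhD : ∀ x, |h x| ≤ n * D := fun x => by
    rw [hh', hh]
    refine (Finset.abs_sum_le_sum_abs _ _).trans ((Finset.sum_le_sum fun l hl => ?_).trans (by simp : ∑ l ∈ Finset.range n, D ≤ n * D))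
    rw [abs_mul, abs_neg, abs_pow, abs_neg, abs_one, one_pow, one_mul]; exact hdD l (Finset.mem_range.1 hl) x
  have hgG : ∀ x, |g x| ≤ G := fun x => by rw [hga, hGe]; exact Real.rpow_le_rpow (abs_nonneg _) (hhD x) hp1.le
  have hz : ∀ l, ∀ x ∉ Bx d L, dd P j k S l x = 0 := fun l x hx => by rw [dd, al_out P j k hS0 l hx, zero_mul]
  have e1 : ∑ x ∈ Bx d L, h x * g x = ∑ x ∈ Bx d L, |h x|^p := by
    refine Finset.sum_congr rfl fun x _ => ?_
    simp only [hg]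
    rw [← mul_assoc, mul_comm (h x), sign_mul_self]
    rcases (abs_nonneg (h x)).eq_or_lt with h | h
    · rw [← h, Real.zero_rpow hpq.ne_zero, zero_mul]
    · rw [← Real.rpow_one_add' h.le (by have := hpq.pos; intro; linarith)]; congr 1; ring
  have e2 : ∑ x ∈ Bx d L, |g x|^q = ∑ x ∈ Bx d L, |h x|^p :=
    Finset.sum_congr rfl fun x _ => by rw [hga, ← Real.rpow_mul (abs_nonneg _), hpq.sub_one_mul_conj]
  have hE1 : |Pr L E f g| ≤ η * ((n*D) * G * (L:ℝ)^d) := by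
    have hb : B0 ≤ S n := by rw [hS]; simp [hC]
    refine hB0 (S n) hb (hS0 n) L (hd0 n le_rfl) f g _ G hfD hgG (fun x hx => ?_) fun m m' hm => ?_
    · rw [hf']; exact Finset.sum_eq_zero fun l _ => hz l x hx
    · rw [hf']; exact Finset.sum_congr rfl fun l hl => dd_dep P j k hSd (Finset.mem_range.1 hl) hm
  have hP1 : |Pr L (PK j k) f g - ∑ x ∈ Bx d L, h x * g x| ≤ n * (η * (D * G * (L:ℝ)^d)) := by
    have a1 : Pr L (PK j k) f g = ∑ l ∈ Finset.range n, Pr L (PK j k) (dd P j k S l) g := by rw [hf']; exact Pr_sum L n _ g _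
    have a2 : ∑ x ∈ Bx d L, h x * g x = ∑ l ∈ Finset.range n, -(-1)^l * ∑ x ∈ Bx d L, dd P j k S l x * g x := by
      simp_rw [hh', hh, Finset.sum_mul, Finset.mul_sum]
      rw [Finset.sum_comm]
      exact Finset.sum_congr rfl fun l _ => Finset.sum_congr rfl fun x _ => by ring
    rw [a1, a2, ← Finset.sum_sub_distrib]
    refine (Finset.abs_sum_le_sum_abs _ _).trans ((Finset.sum_le_sum fun l hl => ?_).trans (by simp : ∑ l ∈ Finset.range n, (η * (D * G * (L:ℝ)^d)) ≤ n * (η * (D * G * (L:ℝ)^d))))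
    have hl := Finset.mem_range.1 hl
    refine hc0 l (P.M * S (l+1)) (S l) ?_ (hS0 l) L (hd0 l hl.le) ((hSd l hl).trans (hd0 l hl.le)) _ g D G (hdD l hl) hgG (hz l)
      (fun i hi m u v => dd_slow P j k hSd hl hi m u v) (dd_osc P j k hS0 hSd hl)
    rw [hS1 l hl]
    have : 0 < P.M * S (l+1) := by have := hS0 (l+1); positivity
    nlinarith
  have hmain := hN (Bx d L) f g
  have a3 : ∑ m ∈ Bx d L, ∑ n ∈ Bx d L, f m * g n * (PK j k (n-m) + E (n-m)) = Pr L (PK j k) f g + Pr L E f g := by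
    simp only [Pr, mul_add, Finset.sum_add_distrib]
  rw [a3, e2] at hmain
  rw [e1] at hP1
  have := abs_le.1 hE1
  have := abs_le.1 hP1
  rw [← hh', ← hf']
  have : 2*n*D*G*η * (L:ℝ)^d ≤ 1 * (L:ℝ)^d := mul_le_mul_of_nonneg_right hηle (by positivity)
  linarith

lemma lowK (P : Prm p a) (hpq : p.HolderConjugate q) {j k : Fin d} (hjk : j ≠ k) {E : ZLat d → ℝ} (hE : Summable fun m => |E m|) (hE0 : ∑' m, E m = 0)
    {N : ℝ} (hN : BndK (fun m => PK j k m + E m) p q N) (ha : 1 < a) {K : ℝ} (hK : a + 1 ≤ (a-1) * K) : a - 1 ≤ N + (a+1)/K := by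
  have hp0 := hpq.pos
  have hp1 := hpq.lt.le
  have hq0 := hpq.symm.pos
  have hK0 : 0 < K := by by_contra h; push Not at h; nlinarith
  have hc0 : 0 < uu P^p / P.M := by have := uu_pos P; have := P.hM; positivity
  obtain ⟨n, hn⟩ := exists_nat_ge ((K+1)^p / (uu P^p / P.M))
  rw [div_le_iff₀ hc0] at hn
  obtain ⟨S, hS0, hS, hmain⟩ := pairing P hpq hjk hE hE0 hN n
  set L := S 0
  set f := ff P j k S n
  set h := hh P j k S n
  have hV : 0 < (L:ℝ)^d := by have := hS0 0; positivity
  set V := (L:ℝ)^d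
  set v := V^(1/p) with hv
  have hv0 : 0 < v := by positivity
  set X := (∑ x ∈ Bx d L, |f x|^p)^(1/p)
  set Z := ∑ x ∈ Bx d L, |h x|^p
  have hZ0 : 0 ≤ Z := Finset.sum_nonneg fun x _ => by positivity
  have hconst : ∀ c : ℝ, 0 ≤ c → (∑ x ∈ Bx d L, |c|^p)^(1/p) = c * v := by
    intro c hc
    rw [Finset.sum_const, Bx_card, nsmul_eq_mul, abs_of_nonneg hc, Real.mul_rpow (by positivity) (by positivity), ← Real.rpow_mul hc, mul_one_div_cancel hp0.ne', Real.rpow_one]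
    push_cast; ring
  have hpw : ∀ (c : ℝ), 0 ≤ c → ∀ y : ZLat d → ℝ, c * (∑ x ∈ Bx d L, |y x|^p)^(1/p) = (∑ x ∈ Bx d L, (c * |y x|)^p)^(1/p) := by
    intro c hc y
    simp_rw [Real.mul_rpow hc (abs_nonneg _)]
    rw [← Finset.mul_sum, Real.mul_rpow (by positivity) (Finset.sum_nonneg fun x _ => by positivity), ← Real.rpow_mul hc, mul_one_div_cancel hp0.ne', Real.rpow_one]
  set F : ZLat d → ℝ := fun x => P.θ + f x with hF
  set Gf : ZLat d → ℝ := fun x => 1 - P.θ + h x with hGf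
  have hθ0 := P.h0
  have hθ1 := P.h1
  have m1 : X ≤ (∑ x ∈ Bx d L, |F x|^p)^(1/p) + P.θ * v := by
    have := Real.Lp_add_le (Bx d L) F (fun _ => -P.θ) hp1
    simp only [hF, add_neg_cancel_comm, abs_neg] at this
    rwa [hconst _ hθ0.le] at this
  have m2 : (∑ x ∈ Bx d L, |Gf x|^p)^(1/p) ≤ (1-P.θ) * v + Z^(1/p) := by
    have := Real.Lp_add_le (Bx d L) (fun _ => 1 - P.θ) h hp1
    rwa [hconst _ (by linarith)] at this
  have m3 : (a-1) * (∑ x ∈ Bx d L, |F x|^p)^(1/p) ≤ (∑ x ∈ Bx d L, |Gf x|^p)^(1/p) := by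
    rw [hpw _ (by linarith)]
    refine Real.rpow_le_rpow (Finset.sum_nonneg fun x _ => Real.rpow_nonneg (mul_nonneg (by linarith) (abs_nonneg _)) _) (Finset.sum_le_sum fun x hx => ?_) (by positivity)
    exact Real.rpow_le_rpow (mul_nonneg (by linarith) (abs_nonneg _)) (inv1 P j k ha hp0 hS0 hx n).1 hp0.le
  have m4 : (K+1) * v ≤ (∑ x ∈ Bx d L, |F x|^p)^(1/p) := by
    have h1 := (WX_sum P j k hp0 hS0 hS).trans (Finset.sum_le_sum fun x hx => (inv1 P j k ha hp0 hS0 hx n).2)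
    have h2 : V * (K+1)^p ≤ ∑ x ∈ Bx d L, |F x|^p := (mul_le_mul_of_nonneg_left hn hV.le).trans h1
    refine le_trans (le_of_eq ?_) (Real.rpow_le_rpow (by positivity) h2 (by positivity))
    rw [Real.mul_rpow hV.le (by positivity), ← Real.rpow_mul (by positivity), mul_one_div_cancel hp0.ne', Real.rpow_one]; ring
  have m5 : (∑ x ∈ Bx d L, |F x|^p)^(1/p) ≤ P.θ * v + X := by
    have := Real.Lp_add_le (Bx d L) (fun _ => P.θ) f hp1
    rwa [hconst _ hθ0.le] at this
  set Y := Z^(1/p) with hY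
  have hX : K * v ≤ X := by nlinarith
  have hYX : (a-1) * X - a * v ≤ Y := by
    have := mul_le_mul_of_nonneg_left m1 (by linarith : 0 ≤ a - 1)
    have : (a-1) * (P.θ * v) + (1 - P.θ) * v ≤ a * v := by
      rw [← mul_assoc, ← add_mul]; refine mul_le_mul_of_nonneg_right ?_ hv0.le; nlinarith
    linarith
  have hYv : v ≤ Y := by
    have := mul_le_mul_of_nonneg_left hX (by linarith : 0 ≤ a - 1)
    have := mul_le_mul_of_nonneg_right hK hv0.le
    linarith
  have hsplit : ∀ W : ℝ, 0 < W → W = W^(1/p) * W^(1/q) := fun W hW => by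
    rw [← Real.rpow_add hW, one_div, one_div, hpq.inv_add_inv_eq_one, Real.rpow_one]
  have hZV : V ≤ Z := (Real.rpow_le_rpow_iff hV.le hZ0 (by positivity)).1 hYv
  have hZ : 0 < Z := hV.trans_le hZV
  have hfin : Y ≤ N * X + v := by
    have hz : 0 < Z^(1/q) := by positivity
    have h1 : V^(1/q) ≤ Z^(1/q) := Real.rpow_le_rpow hV.le hZV (by positivity)
    have h2 : V ≤ v * Z^(1/q) := (hsplit V hV).le.trans (mul_le_mul_of_nonneg_left h1 hv0.le)
    have h3 := hsplit Z hZ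
    refine le_of_mul_le_mul_right ?_ hz
    rw [hY, ← h3]; linarith
  have hX0 : 0 < X := (mul_pos hK0 hv0).trans_le hX
  have : (a + 1) * v ≤ (a+1)/K * X := by
    rw [div_mul_eq_mul_div, le_div_iff₀ hK0]; nlinarith
  refine le_of_mul_le_mul_right ?_ hX0
  linarith

end

lemma thmL {d : ℕ} {p q : ℝ} (hpq : p.HolderConjugate q) {j k : Fin d} (hjk : j ≠ k) {E : ZLat d → ℝ} (hE : Summable fun m => |E m|) (hE0 : ∑' m, E m = 0)
    {N : ℝ} (hN : BndK (fun m => PK j k m + E m) p q N) : p - 1 ≤ N := by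
  have hp := hpq.lt
  refine le_of_forall_lt fun b hb => ?_
  obtain ⟨a, h1, h2⟩ := exists_between (max_lt hp (by linarith : b + 1 < p))
  have ha : 1 < a := (le_max_left _ _).trans_lt h1
  have hba : b < a - 1 := by have := (le_max_right _ _).trans_lt h1; linarith
  obtain ⟨P⟩ := prm_ex ha h2
  refine hba.trans_le (le_of_tendsto_of_tendsto' (b := atTop) (f := fun i : ℕ => a - 1) (g := fun i : ℕ => N + (a+1)/(i + (a+1)/(a-1))) tendsto_const_nhds ?_ fun i => ?_)
  · have : Tendsto (fun i : ℕ => (i:ℝ) + (a+1)/(a-1)) atTop atTop := tendsto_atTop_add_const_right _ _ tendsto_natCast_atTop_atTop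
    simpa using (this.const_div_atTop (a+1)).const_add N
  · refine lowK P hpq hjk hE hE0 hN ha ?_
    rw [mul_add, mul_div_cancel₀ _ (by linarith)]
    have : 0 ≤ (a-1) * (i:ℝ) := mul_nonneg (by linarith) (by positivity)
    linarith

lemma thmL' {d : ℕ} {p q : ℝ} (hpq : p.HolderConjugate q) {j k : Fin d} (hjk : j ≠ k) {E : ZLat d → ℝ} (hE : Summable fun m => |E m|) (hE0 : ∑' m, E m = 0)
    (hEe : ∀ m, E (-m) = E m) {N : ℝ} (hN : BndK (fun m => PK j k m + E m) p q N) : pstar p - 1 ≤ N := by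
  rcases le_or_gt 2 p with h | h
  · rw [(pstar_of hpq).1 h]; exact thmL hpq hjk hE hE0 hN
  · rw [((pstar_of hpq).2 h).2]
    exact thmL hpq.symm hjk hE hE0 (hN.swap fun m => by simp only [PK, probK_even, hEe])

end Th

theorem stmtX (d : ℕ) (p : ℝ) (hp : 1 < p) (j k : Fin d) (hjk : j ≠ k) :
    opN d p (fun f n => Rprob d j j f n - Rprob d k k f n) = pstar p - 1 ∧
      pstar p - 1 ≤ opN d p (fun f n => Rdis d j j f n - Rdis d k k f n) := by
  have hpq := Real.HolderConjugate.conjExponent hp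
  have h0 := Th.pstar_nonneg hpq
  refine ⟨le_antisymm ((Th.PK_bnd hpq hjk).opN_le hpq h0 (Th.Rprob_T hpq j k)) ?_, ?_⟩
  · have := (Th.PK_bnd hpq hjk).opN_bnd hpq h0 (Th.Rprob_T hpq j k)
    exact Th.thmL' hpq hjk (E := fun _ => 0) (by simp) (by simp) (fun _ => rfl) (by simpa only [add_zero] using this)
  · have h1 : 0 ≤ pstar p - 1 + ∑' m, |Th.EE j k m| := add_nonneg h0 (tsum_nonneg fun _ => abs_nonneg _)
    exact Th.thmL' hpq hjk (Th.EE_summable j k) (Th.EE_tsum j k) (Th.EE_even j k) ((Th.DK_bnd hpq hjk).opN_bnd hpq h1 (Th.Rdis_T hpq j k))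
end
end

theorem stmt1 (d : ℕ) (hd : 2 ≤ d) (p : ℝ) (hp : 1 < p) (j k : Fin d) (hjk : j ≠ k) :
    opN d p (fun f n => Rprob d j j f n - Rprob d k k f n) = pstar p - 1 ∧
    pstar p - 1 ≤ opN d p (fun f n => Rdis d j j f n - Rdis d k k f n) := by
  exact stmtX d p hp j k hjk

end
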